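/- Let f_1(z), …, f_n(z) be E-functions such that the column vector Y(z) = (f_1(z), …, f_n(z))^T satisfies Y'(z) = A(z) Y(z) where A(z) is an n×n matrix with entries in ℚ̄(z), and let T(z) ∈ ℚ̄[z] be a nonzero polynomial such that T(z)A(z) has entries in ℚ̄[z]. Then for every algebraic number α with α·T(α) ≠ 0, the transcendence degree over ℚ̄ of the field ℚ̄(f_1(α), …, f_n(α)) equals the transcendence degree over ℚ̄(z) of the field ℚ̄(z)(f_1(z), …, f_n(z)). -/

import Mathlib

noncomputable section

/-- `ℚ̄`: the field of algebraic numbers, i.e. the algebraic closure of `ℚ` inside `ℂ`. -/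
def Qbar : IntermediateField ℚ ℂ := algebraicClosure ℚ ℂ

/-- `f : ℂ → ℂ` is the E-function with Taylor coefficients `aₙ/n!` (the `aₙ` being
algebraic numbers): `f(z) = ∑ aₙ/n! zⁿ`; the conjugates of the `aₙ` grow at most
geometrically; the `aₙ` admit denominators growing at most geometrically; and `f`
satisfies a nonzero linear differential equation with coefficients in `ℚ̄(z)`
(equivalently, after clearing denominators, with polynomial coefficients all of
whose coefficients are algebraic). -/
def IsEFunctionWith (a : ℕ → Qbar) (f : ℂ → ℂ) : Prop :=
  (∀ z : ℂ, HasSum (fun n : ℕ => (a n : ℂ) / n.factorial * z ^ n) (f z)) ∧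
  (∃ C : ℝ, 0 < C ∧ ∀ σ : Qbar →+* ℂ, ∀ n : ℕ, ‖σ (a n)‖ ≤ C ^ (n + 1)) ∧
  (∃ D : ℝ, 0 < D ∧ ∃ d : ℕ → ℕ, (∀ n : ℕ, d n ≠ 0 ∧ (d n : ℝ) ≤ D ^ (n + 1)) ∧
    ∀ n : ℕ, ∀ m ≤ n, IsIntegral ℤ ((d n : ℂ) * (a m : ℂ))) ∧
  (∃ r : ℕ, ∃ p : Fin (r + 1) → Polynomial ℂ,
    (∀ j, ∀ i, IsAlgebraic ℚ ((p j).coeff i)) ∧ (∃ j, p j ≠ 0) ∧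
    ∀ z : ℂ, ∑ j : Fin (r + 1), (p j).eval z * iteratedDeriv (j : ℕ) f z = 0)

/-- `f : ℂ → ℂ` is an E-function. -/
def IsEFunction (f : ℂ → ℂ) : Prop := ∃ a : ℕ → Qbar, IsEFunctionWith a f

/-- A family of functions `g i : ℂ → ℂ` is algebraically independent over `ℚ̄(z)`:
no nonzero polynomial in the `g i` with coefficients in `ℚ̄[z]` (equivalently, after
clearing denominators, in `ℚ̄(z)`) vanishes identically. -/
def AlgIndepFuncsOverQbarZ {ι : Type*} (g : ι → ℂ → ℂ) : Prop :=
  ∀ P : MvPolynomial ι (Polynomial ℂ),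
    (∀ m : ι →₀ ℕ, ∀ k : ℕ, IsAlgebraic ℚ ((P.coeff m).coeff k)) →
    (∀ z : ℂ, MvPolynomial.eval (fun i => g i z)
      (MvPolynomial.map (Polynomial.evalRingHom z) P) = 0) →
    P = 0

namespace SiegelShidlovskii
open Polynomial

section Minors
variable {R : Type*} [CommRing R]

theorem det_mul_eq_sum {m s : Type*} [Fintype m] [Fintype s] [DecidableEq s]
    (A : Matrix s m R) (B : Matrix m s R) :
    (A * B).det = ∑ τ : s → m, (∏ a, A a (τ a)) * (B.submatrix τ id).det := by
  classical
  have h : (A * B) = fun a => ∑ j, A a j • B j := by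
    ext a b
    simp [Matrix.mul_apply]
  have := (Matrix.detRowAlternating (n := s) (R := R)).toMultilinearMap.map_sum
    (fun a j => A a j • B j)
  have h2 : (A * B).det = Matrix.detRowAlternating (fun a => ∑ j, A a j • B j) := by
    rw [h]; rfl
  rw [h2]
  refine this.trans (Finset.sum_congr rfl fun τ _ => ?_)
  rw [MultilinearMap.map_smul_univ]
  rfl

theorem exists_submatrix_det_ne_zero_of_mul_eq_one [Nontrivial R] {m s : Type*} [Fintype m]
    [Fintype s] [DecidableEq s] {Z : Matrix s m R} {Y : Matrix m s R} (h : Z * Y = 1) :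
    ∃ J : s → m, (Y.submatrix J id).det ≠ 0 := by
  by_contra! hJ
  have := det_mul_eq_sum Z Y
  simp [h, hJ] at this

theorem exists_mul_eq_one_of_mulVec {F : Type*} [Field F] {m s : Type*} [Fintype m] [Fintype s]
    [DecidableEq s] (Y : Matrix m s F) (h : ∀ v, Y.mulVec v = 0 → v = 0) :
    ∃ Z : Matrix s m F, Z * Y = 1 := by
  classical
  obtain ⟨g, hg⟩ := LinearMap.exists_leftInverse_of_injective Y.mulVecLin
    (LinearMap.ker_eq_bot'.2 (by simpa using h))
  refine ⟨LinearMap.toMatrix' g, ?_⟩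
  have : LinearMap.toMatrix' (g ∘ₗ Y.mulVecLin) = 1 := by rw [hg, LinearMap.toMatrix'_id]
  rw [LinearMap.toMatrix'_comp] at this
  rwa [← Matrix.toLin'_apply', LinearMap.toMatrix'_toLin'] at this

theorem exists_submatrix_det_ne_zero [IsDomain R] {m s : Type*} [Fintype m] [Fintype s]
    [DecidableEq s] (Y : Matrix m s R) (h : ∀ v, Y.mulVec v = 0 → v = 0) :
    ∃ J : s → m, (Y.submatrix J id).det ≠ 0 := by
  classical
  let F := FractionRing R
  have h' : ∀ v : s → F, (Y.map (algebraMap R F)).mulVec v = 0 → v = 0 := by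
    intro v hv
    obtain ⟨b, hb⟩ := IsLocalization.exist_integer_multiples_of_finite (nonZeroDivisors R) v
    choose u hu using hb
    have hb0 : algebraMap R F b ≠ 0 :=
      IsFractionRing.to_map_ne_zero_of_mem_nonZeroDivisors b.2
    have : Y.mulVec u = 0 := by
      ext i
      apply IsFractionRing.injective R F
      have := congrFun hv i
      simp only [Matrix.mulVec, dotProduct, Matrix.map_apply, Pi.zero_apply, map_sum, map_mul,
        map_zero] at this ⊢
      simp only [hu, Algebra.smul_def]
      calc _ = algebraMap R F b * ∑ j, algebraMap R F (Y i j) * v j := by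
            rw [Finset.mul_sum]; exact Finset.sum_congr rfl fun _ _ => by ring
        _ = 0 := by rw [this, mul_zero]
    have hu0 := h u this
    ext i
    have := hu i
    rw [hu0] at this
    simp only [Pi.zero_apply, map_zero, Algebra.smul_def] at this
    simpa [hb0] using this.symm
  obtain ⟨Z, hZ⟩ := exists_mul_eq_one_of_mulVec _ h'
  obtain ⟨J, hJ⟩ := exists_submatrix_det_ne_zero_of_mul_eq_one hZ
  refine ⟨J, fun h0 => hJ ?_⟩
  have := (algebraMap R F).map_det (Y.submatrix J id)
  rw [h0, map_zero] at this
  rw [this]; rfl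

end Minors

section Functional

theorem exists_bounded_functional {K S ι : Type*} [Field K] [CommRing S] [IsDomain S] [Algebra K S]
    [Finite ι] (ψ : K[X] →+* S) (hψ : Function.Injective ψ) (hC : ∀ a, ψ (C a) = algebraMap K S a)
    (φ : ι → S) :
    ∃ c : ℕ, ∀ β ∈ Submodule.span K (Set.range φ), β ≠ 0 → ∃ l : S → K[X], l β ≠ 0 ∧
      (∀ ξ ∈ Submodule.span K (Set.range φ), (l ξ).natDegree ≤ c) ∧
      ∀ p q, ∀ ξ ∈ Submodule.span K (Set.range φ), ∀ ζ ∈ Submodule.span K (Set.range φ),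
        ψ p * ξ = ψ q * ζ → p * l ξ = q * l ζ := by
  classical
  let _ : Algebra K[X] S := ψ.toAlgebra
  have hsm : ∀ (p : K[X]) (x : S), p • x = ψ p * x := fun p x => rfl
  have : IsScalarTower K K[X] S := IsScalarTower.of_algebraMap_eq fun a => (hC a).symm
  have : FaithfulSMul K[X] S := (faithfulSMul_iff_algebraMap_injective K[X] S).2 hψ
  let M : Submodule K[X] S := Submodule.span K[X] (Set.range φ)
  have : Module.Finite K[X] M := Module.Finite.span_of_finite _ (Set.finite_range φ)
  have : Module.Free K[X] M := Module.free_of_finite_type_torsion_free'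
  have hle : ∀ x ∈ Submodule.span K (Set.range φ), x ∈ M := fun x hx =>
    Submodule.span_subset_span K K[X] _ hx
  let b := Module.Free.chooseBasis K[X] M
  have hφ : ∀ i, φ i ∈ M := fun i => Submodule.subset_span ⟨i, rfl⟩
  have := Fintype.ofFinite ι
  let c : ℕ := Finset.univ.sup fun i : ι => Finset.univ.sup fun k =>
    (b.repr ⟨φ i, hφ i⟩ k).natDegree
  refine ⟨c, fun β hβ hβ0 => ?_⟩
  obtain ⟨k, hk⟩ : ∃ k, b.repr ⟨β, hle β hβ⟩ k ≠ 0 := by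
    by_contra! h
    apply hβ0
    have : (⟨β, hle β hβ⟩ : M) = 0 := b.repr.injective (by ext1 k; simp [h k])
    simpa using this
  refine ⟨fun x => if h : x ∈ M then b.repr ⟨x, h⟩ k else 0, ?_, ?_, ?_⟩
  · simpa [hle β hβ] using hk
  · intro ξ hξ
    induction hξ using Submodule.span_induction with
    | mem x hx =>
      obtain ⟨i, rfl⟩ := hx
      simp only [hφ i, dite_true]
      exact (Finset.le_sup (f := fun k => (b.repr ⟨φ i, hφ i⟩ k).natDegree)
        (Finset.mem_univ k)).trans (Finset.le_sup (f := fun i : ι => Finset.univ.sup fun k =>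
          (b.repr ⟨φ i, hφ i⟩ k).natDegree) (Finset.mem_univ i))
    | zero => simp [show (⟨0, M.zero_mem⟩ : M) = 0 from rfl]
    | add x y hx hy h1 h2 =>
      have hx' := hle x hx
      have hy' := hle y hy
      simp only [hx', hy', M.add_mem hx' hy', dite_true] at h1 h2 ⊢
      rw [show (⟨x + y, M.add_mem hx' hy'⟩ : M) = ⟨x, hx'⟩ + ⟨y, hy'⟩ from rfl, map_add]
      exact (natDegree_add_le _ _).trans (max_le h1 h2)
    | smul a x hx h1 =>
      have hx' := hle x hx
      have hax : a • x ∈ M := hle _ (Submodule.smul_mem _ a hx)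
      simp only [hx', hax, dite_true] at h1 ⊢
      have : (⟨a • x, hax⟩ : M) = (C a : K[X]) • ⟨x, hx'⟩ := by
        ext; simp [hsm, hC, Algebra.smul_def]
      rw [this, map_smul]
      simp only [Finsupp.smul_apply, smul_eq_mul]
      exact (natDegree_C_mul_le _ _).trans h1
  · intro p q ξ hξ ζ hζ h
    have h1 := hle ξ hξ
    have h2 := hle ζ hζ
    simp only [h1, h2, dite_true]
    have : p • (⟨ξ, h1⟩ : M) = q • ⟨ζ, h2⟩ := by ext; simpa [hsm] using h
    have := congrArg (fun x => b.repr x k) this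
    simpa only [map_smul, Finsupp.smul_apply, smul_eq_mul] using this

end Functional
end SiegelShidlovskii

namespace SiegelShidlovskii
open Polynomial

variable {K : Type*} [Field K] {ι : Type*} [Fintype ι]

/-- The action of `T d/dz` on linear forms `∑ P i * y i` along solutions of `T y' = B y`. -/
def twist (T : K[X]) (B : Matrix ι ι K[X]) (P : ι → K[X]) : ι → K[X] :=
  fun j => T * derivative (P j) + ∑ i, P i * B i j

/-- The value of the linear form with polynomial coefficients `P` at the vector `y`. -/
def pair {S : Type*} [CommRing S] (ψ : K[X] →+* S) (P : ι → K[X]) (y : ι → S) : S :=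
  ∑ j, ψ (P j) * y j

/-- The derivation `t d/dz` on power series. -/
def theta (t : PowerSeries K) (H : PowerSeries K) : PowerSeries K :=
  t * PowerSeries.derivative K H

theorem pair_twist (ψ : K[X] →+* PowerSeries K)
    (hψ : ∀ p, PowerSeries.derivative K (ψ p) = ψ (derivative p)) (T : K[X]) (B : Matrix ι ι K[X])
    (y : ι → PowerSeries K)
    (hy : ∀ i, ψ T * PowerSeries.derivative K (y i) = ∑ j, ψ (B i j) * y j) (P : ι → K[X]) :
    pair ψ (twist T B P) y = theta (ψ T) (pair ψ P y) := by
  simp only [pair, twist, theta, map_sum, Derivation.leibniz, smul_eq_mul, hψ, map_add, map_mul,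
    add_mul, Finset.sum_mul, Finset.sum_add_distrib, Finset.mul_sum, mul_add]
  rw [add_comm]
  congr 1
  · rw [Finset.sum_comm]
    refine Finset.sum_congr rfl fun i _ => ?_
    calc _ = ψ (P i) * ∑ j, ψ (B i j) * y j := by
          rw [Finset.mul_sum]; exact Finset.sum_congr rfl fun _ _ => by ring
      _ = _ := by rw [← hy]; ring
  · exact Finset.sum_congr rfl fun _ _ => by ring

theorem pair_iterate_twist (ψ : K[X] →+* PowerSeries K)
    (hψ : ∀ p, PowerSeries.derivative K (ψ p) = ψ (derivative p)) (T : K[X]) (B : Matrix ι ι K[X])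
    (y : ι → PowerSeries K)
    (hy : ∀ i, ψ T * PowerSeries.derivative K (y i) = ∑ j, ψ (B i j) * y j) (P : ι → K[X]) (k : ℕ) :
    pair ψ ((twist T B)^[k] P) y = (theta (ψ T))^[k] (pair ψ P y) := by
  induction k with
  | zero => rfl
  | succ k ih => rw [Function.iterate_succ_apply', Function.iterate_succ_apply',
      pair_twist ψ hψ T B y hy, ih]

theorem X_pow_dvd_theta (t H : PowerSeries K) {n : ℕ} (h : PowerSeries.X ^ (n + 1) ∣ H) :
    PowerSeries.X ^ n ∣ theta t H := by
  obtain ⟨G, rfl⟩ := h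
  rw [theta, Derivation.leibniz, PowerSeries.derivative_pow]
  refine Dvd.dvd.mul_left ?_ _
  simp only [smul_eq_mul]
  refine dvd_add ((pow_dvd_pow _ (Nat.le_succ n)).mul_right _) (Dvd.dvd.mul_left ?_ _)
  simp only [Nat.add_sub_cancel]
  exact (Dvd.intro_left _ rfl).mul_right _

theorem X_pow_dvd_iterate_theta (t : PowerSeries K) (k : ℕ) (H : PowerSeries K) {n : ℕ}
    (h : PowerSeries.X ^ (n + k) ∣ H) : PowerSeries.X ^ n ∣ (theta t)^[k] H := by
  induction k generalizing H with
  | zero => simpa using h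
  | succ k ih =>
    rw [Function.iterate_succ_apply]
    exact ih _ (X_pow_dvd_theta t H (by rwa [← add_assoc] at h))

theorem X_pow_dvd_of_constantCoeff_theta [CharZero K] (t : PowerSeries K)
    (ht : PowerSeries.constantCoeff t ≠ 0) (n : ℕ) (H : PowerSeries K)
    (h : ∀ k < n, PowerSeries.constantCoeff ((theta t)^[k] H) = 0) :
    PowerSeries.X ^ n ∣ H := by
  induction n generalizing H with
  | zero => simp
  | succ n ih =>
    have h1 := ih (theta t H) fun k hk => by
      have := h (k + 1) (by omega)
      rwa [Function.iterate_succ_apply] at this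
    have hu : IsUnit t := PowerSeries.isUnit_iff_constantCoeff.2 (isUnit_iff_ne_zero.2 ht)
    have h2 : PowerSeries.X ^ n ∣ PowerSeries.derivative K H :=
      (hu.dvd_mul_left).1 h1
    rw [PowerSeries.X_pow_dvd_iff] at h2 ⊢
    intro m hm
    rcases m with _ | m
    · simpa using h 0 (by omega)
    · have := h2 m (by omega)
      rw [PowerSeries.coeff_derivative] at this
      have h3 : (m : K) + 1 ≠ 0 := by exact_mod_cast Nat.succ_ne_zero m
      exact (mul_eq_zero.1 this).resolve_right h3

theorem eq_zero_of_constantCoeff_theta [CharZero K] (t : PowerSeries K)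
    (ht : PowerSeries.constantCoeff t ≠ 0) (H : PowerSeries K)
    (h : ∀ k, PowerSeries.constantCoeff ((theta t)^[k] H) = 0) : H = 0 := by
  ext m
  exact (PowerSeries.X_pow_dvd_iff.1
    (X_pow_dvd_of_constantCoeff_theta t ht (m + 1) H fun k _ => h k)) m (by omega)

theorem iterate_theta_zero (t : PowerSeries K) (k : ℕ) : (theta t)^[k] 0 = 0 := by
  induction k with
  | zero => rfl
  | succ k ih => rw [Function.iterate_succ_apply', ih]; simp [theta]

theorem theta_sum_C_mul (t : PowerSeries K) {κ : Type*} (s : Finset κ) (c : κ → K)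
    (r : κ → PowerSeries K) (k : ℕ) :
    (theta t)^[k] (∑ j ∈ s, PowerSeries.C (c j) * r j) =
      ∑ j ∈ s, PowerSeries.C (c j) * (theta t)^[k] (r j) := by
  induction k with
  | zero => rfl
  | succ k ih =>
    rw [Function.iterate_succ_apply', ih]
    simp only [Function.iterate_succ_apply', theta, map_sum, Derivation.leibniz, smul_eq_mul,
      PowerSeries.derivative_C, Finset.mul_sum]
    exact Finset.sum_congr rfl fun _ _ => by ring

/-- A relation over `K⟦x⟧` between power series and all their derivatives specializes to
relations over the constants. -/
theorem sum_coeff_mul_eq_zero [CharZero K] (t : PowerSeries K)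
    (ht : PowerSeries.constantCoeff t ≠ 0) (r : ι → PowerSeries K) (n : ℕ) (w : ι → PowerSeries K)
    (h : ∀ k, ∑ j, w j * (theta t)^[k] (r j) = 0) :
    ∑ j, PowerSeries.C (PowerSeries.coeff n (w j)) * r j = 0 := by
  have key : ∀ w : ι → PowerSeries K, (∀ k, ∑ j, w j * (theta t)^[k] (r j) = 0) →
      ∀ k, ∑ j, PowerSeries.C (PowerSeries.constantCoeff (w j)) * (theta t)^[k] (r j) = 0 := by
    intro w h
    have h0 : ∑ j, PowerSeries.C (PowerSeries.constantCoeff (w j)) * r j = 0 := by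
      apply eq_zero_of_constantCoeff_theta t ht
      intro k
      rw [theta_sum_C_mul]
      simpa using congrArg PowerSeries.constantCoeff (h k)
    intro k
    rw [← theta_sum_C_mul, h0, iterate_theta_zero]
  induction n generalizing w with
  | zero => simpa using key w h 0
  | succ n ih =>
    let w' : ι → PowerSeries K := fun j => PowerSeries.mk fun i => PowerSeries.coeff (i + 1) (w j)
    have hw : ∀ j, w j = w' j * PowerSeries.X + PowerSeries.C (PowerSeries.constantCoeff (w j)) :=
      fun j => PowerSeries.eq_shift_mul_X_add_const (w j)
    have := ih w' fun k => by
      have h1 := h k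
      have h2 := key w h k
      have h3 : (∑ j, w' j * (theta t)^[k] (r j)) * PowerSeries.X = 0 := by
        rw [← sub_eq_zero_of_eq (h1.trans h2.symm), ← Finset.sum_sub_distrib, Finset.sum_mul]
        refine Finset.sum_congr rfl fun j _ => ?_
        conv_rhs => rw [hw j]
        simp [w']
        ring
      exact (mul_eq_zero.1 h3).resolve_right PowerSeries.X_ne_zero
    simpa [w'] using this

/-- The coefficients of the fundamental matrix of `Φ' = A Φ`, `Φ(0) = 1`. -/
def solutionCoeff [DecidableEq ι] (A : ℕ → Matrix ι ι K) : ℕ → Matrix ι ι K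
  | 0 => 1
  | n + 1 => ((n : K) + 1)⁻¹ • ∑ k : Fin (n + 1), A (n - k) * solutionCoeff A k

theorem exists_fundamental_matrix [CharZero K] [DecidableEq ι] (t : PowerSeries K)
    (ht : PowerSeries.constantCoeff t ≠ 0) (B : Matrix ι ι (PowerSeries K)) :
    ∃ Φ : Matrix ι ι (PowerSeries K), IsUnit Φ.det ∧
      (∀ i j, PowerSeries.constantCoeff (Φ i j) = (1 : Matrix ι ι K) i j) ∧
      ∀ i j, t * PowerSeries.derivative K (Φ i j) = ∑ k, B i k * Φ k j := by
  let A : Matrix ι ι (PowerSeries K) := fun i j => t⁻¹ * B i j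
  let a : ℕ → Matrix ι ι K := fun n => fun i j => PowerSeries.coeff n (A i j)
  let Φ : Matrix ι ι (PowerSeries K) := fun i j => PowerSeries.mk fun n => solutionCoeff a n i j
  have h1 : ∀ i j, PowerSeries.constantCoeff (Φ i j) = (1 : Matrix ι ι K) i j := by
    intro i j
    simp [Φ, ← PowerSeries.coeff_zero_eq_constantCoeff_apply, solutionCoeff]
  refine ⟨Φ, ?_, h1, ?_⟩
  · rw [PowerSeries.isUnit_iff_constantCoeff, RingHom.map_det]
    have : (PowerSeries.constantCoeff (R := K)).mapMatrix Φ = 1 := by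
      ext i j; exact h1 i j
    rw [this, Matrix.det_one]
    exact isUnit_one
  · intro i j
    have h2 : PowerSeries.derivative K (Φ i j) = ∑ k, A i k * Φ k j := by
      ext n
      have hn : (n : K) + 1 ≠ 0 := by exact_mod_cast Nat.succ_ne_zero n
      rw [PowerSeries.coeff_derivative, map_sum]
      simp only [Φ, PowerSeries.coeff_mk, PowerSeries.coeff_mul, solutionCoeff, Matrix.smul_apply,
        Matrix.sum_apply, smul_eq_mul, Matrix.mul_apply]
      rw [mul_comm, mul_inv_cancel_left₀ hn, Finset.sum_comm]
      refine Finset.sum_congr rfl fun k _ => ?_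
      rw [Finset.Nat.antidiagonal_eq_map', Finset.sum_map,
        Finset.sum_range fun m => _]
      rfl
    rw [h2, Finset.mul_sum]
    refine Finset.sum_congr rfl fun k _ => ?_
    simp only [A, ← mul_assoc, PowerSeries.mul_inv_cancel t ht, one_mul]

end SiegelShidlovskii

namespace SiegelShidlovskii
open Polynomial

section Krylov
variable {K : Type*} [Field K] {ι : Type*} [Fintype ι]

/-- The span of the linear forms obtained from `P` by fewer than `n` differentiations. -/
def twistSpan (T : K[X]) (B : Matrix ι ι K[X]) (P : ι → K[X]) (n : ℕ) : Submodule K[X] (ι → K[X]) :=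
  Submodule.span K[X] ((fun k => (twist T B)^[k] P) '' Set.Iio n)

theorem iterate_twist_mem_twistSpan (T : K[X]) (B : Matrix ι ι K[X]) (P : ι → K[X]) {k n : ℕ}
    (h : k < n) : (twist T B)^[k] P ∈ twistSpan T B P n :=
  Submodule.subset_span ⟨k, h, rfl⟩

theorem twistSpan_mono (T : K[X]) (B : Matrix ι ι K[X]) (P : ι → K[X]) {k n : ℕ}
    (h : k ≤ n) : twistSpan T B P k ≤ twistSpan T B P n :=
  Submodule.span_mono (Set.image_mono (Set.Iio_subset_Iio h))

theorem twist_smul (T : K[X]) (B : Matrix ι ι K[X]) (p : K[X]) (P : ι → K[X]) :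
    twist T B (p • P) = (T * derivative p) • P + p • twist T B P := by
  ext1 j
  simp only [twist, Pi.smul_apply, Pi.add_apply, smul_eq_mul, derivative_mul, mul_add,
    Finset.mul_sum, add_assoc, mul_assoc]
  ring

theorem twist_add (T : K[X]) (B : Matrix ι ι K[X]) (P Q : ι → K[X]) :
    twist T B (P + Q) = twist T B P + twist T B Q := by
  ext1 j
  simp only [twist, Pi.add_apply, derivative_add, mul_add, add_mul, Finset.sum_add_distrib]
  ring

theorem twist_mem_twistSpan (T : K[X]) (B : Matrix ι ι K[X]) (P : ι → K[X]) {n : ℕ}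
    {v : ι → K[X]} (hv : v ∈ twistSpan T B P n) : twist T B v ∈ twistSpan T B P (n + 1) := by
  induction hv using Submodule.span_induction with
  | mem x hx =>
    obtain ⟨k, hk, rfl⟩ := hx
    have := iterate_twist_mem_twistSpan T B P (Nat.succ_lt_succ hk)
    rwa [Function.iterate_succ_apply'] at this
  | zero =>
    have : twist T B 0 = 0 := by ext1 j; simp [twist]
    rw [this]; exact Submodule.zero_mem _
  | add x y _ _ h1 h2 => rw [twist_add]; exact Submodule.add_mem _ h1 h2
  | smul a x hx h1 =>
    rw [twist_smul]
    exact Submodule.add_mem _ (Submodule.smul_mem _ _ (twistSpan_mono T B P (Nat.le_succ n) hx))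
      (Submodule.smul_mem _ _ h1)

theorem exists_smul_iterate_twist_mem (T : K[X]) (B : Matrix ι ι K[X]) (P : ι → K[X]) (n : ℕ) :
    ∃ q : K[X], q ≠ 0 ∧ q • (twist T B)^[n] P ∈ twistSpan T B P (Fintype.card ι) := by
  classical
  set m := Fintype.card ι
  obtain ⟨j, hj, q, hq, hqj⟩ : ∃ j ≤ m, ∃ q : K[X], q ≠ 0 ∧
      q • (twist T B)^[j] P ∈ twistSpan T B P j := by
    have hdep : ¬ LinearIndependent K[X] (fun k : Fin (m + 1) => (twist T B)^[k] P) := by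
      intro h
      have := h.fintype_card_le_finrank
      simp [m] at this
    rw [Fintype.linearIndependent_iff] at hdep
    push Not at hdep
    obtain ⟨c, hc, i, hi⟩ := hdep
    obtain ⟨j, hj0, hj⟩ := Finset.exists_max_image (Finset.univ.filter fun i => c i ≠ 0) id
      ⟨i, by simpa using hi⟩
    refine ⟨j, by omega, c j, by simpa using hj0, ?_⟩
    rw [← Finset.add_sum_erase _ _ (Finset.mem_univ j)] at hc
    rw [eq_neg_of_add_eq_zero_left hc]
    refine Submodule.neg_mem _ (Submodule.sum_mem _ fun k hk => ?_)
    by_cases h0 : c k = 0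
    · simp [h0]
    · refine Submodule.smul_mem _ _ (iterate_twist_mem_twistSpan T B P ?_)
      have h1 := hj k (by simpa using h0)
      have h2 : k ≠ j := (Finset.mem_erase.1 hk).1
      exact lt_of_le_of_ne h1 fun h => h2 (Fin.ext h)
  have hsucc : ∀ v ∈ twistSpan T B P (j + 1), q • v ∈ twistSpan T B P j := by
    intro v hv
    induction hv using Submodule.span_induction with
    | mem x hx =>
      obtain ⟨k, hk, rfl⟩ := hx
      rcases Nat.lt_succ_iff_lt_or_eq.1 hk with h | rfl
      · exact Submodule.smul_mem _ _ (iterate_twist_mem_twistSpan T B P h)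
      · exact hqj
    | zero => simp
    | add x y _ _ h1 h2 => rw [smul_add]; exact Submodule.add_mem _ h1 h2
    | smul a x _ h1 => rw [smul_comm]; exact Submodule.smul_mem _ _ h1
  rcases lt_or_ge n j with h | h
  · exact ⟨1, one_ne_zero, by
      rw [one_smul]; exact iterate_twist_mem_twistSpan T B P (h.trans_le hj)⟩
  suffices h : ∃ p : K[X], p ≠ 0 ∧ p • (twist T B)^[n] P ∈ twistSpan T B P j by
    obtain ⟨p, hp, h⟩ := h
    exact ⟨p, hp, twistSpan_mono T B P hj h⟩
  induction n, h using Nat.le_induction with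
  | base => exact ⟨q, hq, hqj⟩
  | succ n hn ih =>
    obtain ⟨p, hp, hpn⟩ := ih
    refine ⟨q * (p * p), mul_ne_zero hq (mul_ne_zero hp hp), ?_⟩
    have h1 := twist_mem_twistSpan T B P hpn
    rw [twist_smul] at h1
    have h2 := Submodule.smul_mem _ p h1
    have h3 : p • (T * derivative p) • (twist T B)^[n] P ∈ twistSpan T B P (j + 1) := by
      rw [smul_comm]
      exact Submodule.smul_mem _ _ (twistSpan_mono T B P (Nat.le_succ j) hpn)
    rw [smul_add] at h2
    have h4 := hsucc _ ((Submodule.add_mem_iff_right _ h3).1 h2)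
    rwa [← Function.iterate_succ_apply' (f := twist T B), smul_smul, smul_smul, mul_assoc] at h4

theorem pair_add {S : Type*} [CommRing S] (ψ : K[X] →+* S) (P Q : ι → K[X]) (y : ι → S) :
    pair ψ (P + Q) y = pair ψ P y + pair ψ Q y := by
  simp [pair, add_mul, Finset.sum_add_distrib]

theorem pair_smul {S : Type*} [CommRing S] (ψ : K[X] →+* S) (p : K[X]) (P : ι → K[X]) (y : ι → S) :
    pair ψ (p • P) y = ψ p * pair ψ P y := by
  simp [pair, Finset.mul_sum, mul_assoc]

theorem dvd_pair_of_mem_twistSpan {S : Type*} [CommRing S] (ψ : K[X] →+* S) (T : K[X])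
    (B : Matrix ι ι K[X]) (P : ι → K[X]) (y : ι → S) {n : ℕ} (d : S)
    (h : ∀ k < n, d ∣ pair ψ ((twist T B)^[k] P) y) {v : ι → K[X]} (hv : v ∈ twistSpan T B P n) :
    d ∣ pair ψ v y := by
  induction hv using Submodule.span_induction with
  | mem x hx => obtain ⟨k, hk, rfl⟩ := hx; exact h k hk
  | zero => simp [pair]
  | add x y _ _ h1 h2 => rw [pair_add]; exact dvd_add h1 h2
  | smul a x _ h1 => rw [pair_smul]; exact h1.mul_left _

theorem pair_iterate_twist_eq_zero {S : Type*} [CommRing S] [IsDomain S] (ψ : K[X] →+* S)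
    (hψ : Function.Injective ψ) (T : K[X]) (B : Matrix ι ι K[X]) (P : ι → K[X]) (y : ι → S)
    (h : ∀ k < Fintype.card ι, pair ψ ((twist T B)^[k] P) y = 0) (n : ℕ) :
    pair ψ ((twist T B)^[n] P) y = 0 := by
  obtain ⟨q, hq, hmem⟩ := exists_smul_iterate_twist_mem T B P n
  have := dvd_pair_of_mem_twistSpan ψ T B P y 0 (fun k hk => by rw [h k hk]) hmem
  rw [zero_dvd_iff, pair_smul] at this
  exact (mul_eq_zero.1 this).resolve_left ((map_ne_zero_iff ψ hψ).2 hq)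

end Krylov

section Degrees
variable {K : Type*} [Field K] {ι : Type*} [Fintype ι]

theorem natDegree_iterate_twist_le {T : K[X]} {B : Matrix ι ι K[X]} {q : ℕ} (hT : T.natDegree ≤ q)
    (hB : ∀ i j, (B i j).natDegree ≤ q) {P : ι → K[X]} {t : ℕ} (hP : ∀ i, (P i).natDegree ≤ t)
    (k : ℕ) (i : ι) : ((twist T B)^[k] P i).natDegree ≤ t + k * q := by
  induction k generalizing i with
  | zero => simpa using hP i
  | succ k ih =>
    rw [Function.iterate_succ_apply', twist]
    refine (natDegree_add_le _ _).trans (max_le ?_ ?_)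
    · refine natDegree_mul_le.trans ?_
      have h1 := (natDegree_derivative_le ((twist T B)^[k] P i))
      have h2 := ih i
      rw [add_mul, one_mul]
      omega
    · refine natDegree_sum_le_of_forall_le _ _ fun j _ => natDegree_mul_le.trans ?_
      rw [add_mul, one_mul, ← add_assoc]
      exact add_le_add (ih j) (hB j i)

theorem natDegree_det_le_of_forall_le {s : Type*} [Fintype s] [DecidableEq s]
    (M : Matrix s s K[X]) {d : ℕ}
    (h : ∀ i j, (M i j).natDegree ≤ d) : M.det.natDegree ≤ Fintype.card s * d := by
  rw [Matrix.det_apply]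
  refine natDegree_sum_le_of_forall_le _ _ fun σ _ => ?_
  refine (natDegree_smul_le _ _).trans ((natDegree_prod_le _ _).trans ?_)
  exact (Finset.sum_le_sum fun i _ => h _ _).trans (by simp)

end Degrees
end SiegelShidlovskii

namespace SiegelShidlovskii
open Polynomial

section Taylor
variable {K : Type*} [Field K]

/-- Expansion of a polynomial around the point `a`, as a power series. -/
def taylorSeries (a : K) : K[X] →+* PowerSeries K :=
  Polynomial.coeToPowerSeries.ringHom.comp (taylorAlgHom a : K[X] →ₐ[K] K[X]).toRingHom

theorem taylorSeries_apply (a : K) (p : K[X]) : taylorSeries a p = (taylor a p : K[X]) := rfl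

theorem taylorSeries_injective (a : K) : Function.Injective (taylorSeries a) := fun _ _ h =>
  taylor_injective a (Polynomial.coe_injective _ h)

theorem constantCoeff_taylorSeries (a : K) (p : K[X]) :
    PowerSeries.constantCoeff (taylorSeries a p) = p.eval a := by
  rw [taylorSeries_apply, ← PowerSeries.coeff_zero_eq_constantCoeff_apply, Polynomial.coeff_coe,
    taylor_coeff_zero]

theorem taylorSeries_C (a b : K) : taylorSeries a (C b) = PowerSeries.C b := by
  rw [taylorSeries_apply, taylor_C, Polynomial.coe_C]

theorem derivative_taylorSeries (a : K) (p : K[X]) :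
    PowerSeries.derivative K (taylorSeries a p) = taylorSeries a (derivative p) := by
  rw [taylorSeries_apply, taylorSeries_apply, PowerSeries.derivative_coe, taylor_apply,
    taylor_apply, derivative_comp]
  simp

end Taylor

section Solutions
variable {K : Type*} [Field K] [CharZero K] {m : ℕ}

/-- The local solutions annihilated by the linear form `P`, together with a nonvanishing maximal
minor. -/
theorem exists_annihilated_solutions (T : K[X]) (B : Matrix (Fin m) (Fin m) K[X]) (a : K)
    (ha : T.eval a ≠ 0) (Φ : Matrix (Fin m) (Fin m) (PowerSeries K)) (hdet : IsUnit Φ.det)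
    (hΦ : ∀ i j, taylorSeries a T * PowerSeries.derivative K (Φ i j) =
      ∑ k, taylorSeries a (B i k) * Φ k j) (P : Fin m → K[X]) :
    ∃ (s : ℕ) (c : Matrix (Fin m) (Fin s) K) (J : Fin s → Fin m),
      s ≤ m ∧ Function.Injective J ∧
      ((Φ * c.map PowerSeries.C).submatrix J id).det ≠ 0 ∧
      (∀ k b, ∑ i, taylorSeries a ((twist T B)^[k] P i) * (Φ * c.map PowerSeries.C) i b = 0) ∧
      ∀ y, (∀ k < m, pair (taylorSeries a) ((twist T B)^[k] P) y = 0) →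
        ∃ b, y = (Φ * c.map PowerSeries.C).mulVec b := by
  set τ := taylorSeries a
  have ht : PowerSeries.constantCoeff (τ T) ≠ 0 := by rwa [constantCoeff_taylorSeries]
  have hD := derivative_taylorSeries a
  let r : Fin m → PowerSeries K := fun j => pair τ P (fun i => Φ i j)
  have hr : ∀ k j, pair τ ((twist T B)^[k] P) (fun i => Φ i j) = (theta (τ T))^[k] (r j) :=
    fun k j => pair_iterate_twist τ hD T B _ (fun i => hΦ i j) P k
  let E : Submodule K (Fin m → K) :=
    { carrier := {c | ∑ j, PowerSeries.C (c j) * r j = 0}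
      add_mem' := fun {x y} hx hy => by
        simp only [Set.mem_ofPred_eq, Pi.add_apply, map_add, add_mul, Finset.sum_add_distrib] at *
        rw [hx, hy, add_zero]
      zero_mem' := by simp
      smul_mem' := fun x c hc => by
        simp only [Set.mem_ofPred_eq, Pi.smul_apply, smul_eq_mul, map_mul, mul_assoc] at *
        rw [← Finset.mul_sum, hc, mul_zero] }
  let bas := Module.finBasis K E
  let c : Matrix (Fin m) (Fin (Module.finrank K E)) K := fun i b => (bas b : Fin m → K) i
  have hcE : ∀ b, ∑ j, PowerSeries.C (c j b) * r j = 0 := fun b => (bas b).2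
  have hc0 : ∀ v, c.mulVec v = 0 → v = 0 := by
    intro v hv
    have h1 : ∑ b, v b • bas b = 0 := by
      ext i
      have := congrFun hv i
      simpa [Matrix.mulVec, dotProduct, c, mul_comm] using this
    ext b
    exact Fintype.linearIndependent_iff.1 bas.linearIndependent v h1 b
  obtain ⟨c', hc'⟩ := exists_mul_eq_one_of_mulVec c hc0
  have hproj : ∀ e ∈ E, c.mulVec (c'.mulVec e) = e := by
    intro e he
    have : e = c.mulVec (bas.repr ⟨e, he⟩) := by
      have h1 := bas.sum_repr ⟨e, he⟩
      have h2 := congrArg Subtype.val h1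
      ext i
      have h3 := congrFun h2 i
      simp only [Submodule.coe_sum, Submodule.coe_smul, Finset.sum_apply, Pi.smul_apply,
        smul_eq_mul] at h3
      rw [← h3]
      simp [Matrix.mulVec, dotProduct, c, mul_comm]
    rw [this, Matrix.mulVec_mulVec, Matrix.mulVec_mulVec, Matrix.mul_assoc, hc', Matrix.mul_one]
  set Y := Φ * c.map PowerSeries.C with hY
  have hZ : (c'.map PowerSeries.C * Φ⁻¹) * Y = 1 := by
    rw [hY, Matrix.mul_assoc, ← Matrix.mul_assoc Φ⁻¹, Matrix.nonsing_inv_mul _ hdet,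
      Matrix.one_mul, ← Matrix.map_mul, hc']
    simp
  obtain ⟨J, hJ⟩ := exists_submatrix_det_ne_zero_of_mul_eq_one hZ
  refine ⟨_, c, J, ?_, ?_, hJ, ?_, ?_⟩
  · simpa using Submodule.finrank_le E
  · intro x y hxy
    by_contra hne
    exact hJ (Matrix.det_zero_of_row_eq hne (by ext b; simp [hxy]))
  · intro k b
    have h1 : ∑ i, τ ((twist T B)^[k] P i) * Y i b =
        ∑ j, PowerSeries.C (c j b) * pair τ ((twist T B)^[k] P) (fun i => Φ i j) := by
      simp only [hY, Matrix.mul_apply, Matrix.map_apply, pair, Finset.mul_sum]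
      rw [Finset.sum_comm]
      exact Finset.sum_congr rfl fun _ _ => Finset.sum_congr rfl fun _ _ => by ring
    rw [h1]
    simp only [hr]
    rw [← theta_sum_C_mul, hcE, iterate_theta_zero]
  · intro y hy
    have hall := pair_iterate_twist_eq_zero τ (taylorSeries_injective a) T B P y (by simpa using hy)
    let w := Φ⁻¹.mulVec y
    have hw : Φ.mulVec w = y := by
      rw [Matrix.mulVec_mulVec, Matrix.mul_nonsing_inv _ hdet, Matrix.one_mulVec]
    have hcoef : ∀ n, (fun j => PowerSeries.coeff n (w j)) ∈ E := fun n =>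
      sum_coeff_mul_eq_zero (τ T) ht r n w fun k => by
        rw [← hall k, ← hw]
        simp only [← hr, pair, Matrix.mulVec, dotProduct, Finset.mul_sum]
        rw [Finset.sum_comm]
        exact Finset.sum_congr rfl fun _ _ => Finset.sum_congr rfl fun _ _ => by ring
    refine ⟨(c'.map PowerSeries.C).mulVec w, ?_⟩
    rw [← Matrix.mulVec_mulVec]
    conv_lhs => rw [← hw]
    congr 1
    ext i n
    have := congrFun (hproj _ (hcoef n)) i
    rw [← this]
    simp [Matrix.mulVec, dotProduct]

end Solutions

section Minors
variable {K : Type*} [Field K] {m : ℕ}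

theorem submatrix_det_mem_span {s : ℕ} (Φ : Matrix (Fin m) (Fin m) (PowerSeries K))
    (c : Matrix (Fin m) (Fin s) K) (J : Fin s → Fin m) :
    ((Φ * c.map PowerSeries.C).submatrix J id).det ∈ Submodule.span K
      (Set.range fun p : (Fin s → Fin m) × (Fin s → Fin m) => (Φ.submatrix p.1 p.2).det) := by
  have h : ((Φ * c.map PowerSeries.C).submatrix J id) =
      ((c.transpose.map PowerSeries.C) * (Φ.submatrix J id).transpose).transpose := by
    ext i j
    simp [Matrix.mul_apply, mul_comm]
  rw [h, Matrix.det_transpose, det_mul_eq_sum]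
  refine Submodule.sum_mem _ fun τ _ => ?_
  have h2 : (∏ x, c.transpose.map (PowerSeries.C (R := K)) x (τ x)) =
      algebraMap K (PowerSeries K) (∏ x, c (τ x) x) := by
    rw [map_prod]; rfl
  rw [h2, ← Algebra.smul_def]
  refine Submodule.smul_mem _ _ (Submodule.subset_span ⟨(J, τ), ?_⟩)
  rw [← Matrix.det_transpose]
  rfl

theorem det_mul_eq_neg_sum {R : Type*} [CommRing R] {s : ℕ} (Y : Matrix (Fin m) (Fin s) R)
    (J : Fin s → Fin m) (hJ : Function.Injective J) (p : Fin m → R)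
    (hp : ∀ b, ∑ i, p i * Y i b = 0) (b : Fin s) :
    (Y.submatrix J id).det * p (J b) =
      - ∑ i : {i // i ∉ Set.range J}, p i * (Y.submatrix (Function.update J b i) id).det := by
  classical
  have hcr : ∀ i, (Y.submatrix (Function.update J b i) id).det =
      ∑ e, Y i e * (Y.submatrix J id).adjugate e b := by
    intro i
    have h1 : (Y.submatrix (Function.update J b i) id) = (Y.submatrix J id).updateRow b (Y i) := by
      ext x y
      by_cases h : x = b
      · subst h; simp
      · simp [Function.update_of_ne h, Matrix.updateRow_ne h]
    rw [h1, ← Matrix.cramer_transpose_apply, Matrix.cramer_eq_adjugate_mulVec,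
      ← Matrix.adjugate_transpose]
    simp only [Matrix.mulVec, dotProduct, Matrix.transpose_apply, mul_comm]
  have hsum : ∑ i, p i * (Y.submatrix (Function.update J b i) id).det = 0 := by
    simp only [hcr, Finset.mul_sum]
    rw [Finset.sum_comm]
    refine Finset.sum_eq_zero fun e _ => ?_
    simp only [← mul_assoc, ← Finset.sum_mul, hp, zero_mul]
  rw [← Fintype.sum_subtype_add_sum_subtype (fun i => i ∈ Set.range J)] at hsum
  rw [eq_neg_iff_add_eq_zero, ← hsum]
  congr 1
  let e : Fin s ≃ {x // x ∈ Set.range J} := Equiv.ofInjective J hJ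
  refine Eq.trans ?_ (Finset.sum_equiv (s := Finset.univ) e (by simp)
    (f := fun a => p (J a) * (Y.submatrix (Function.update J b (J a)) id).det) fun _ _ => rfl)
  rw [Finset.sum_eq_single b]
  · rw [Function.update_eq_self, mul_comm]
  · intro a _ hab
    rw [Matrix.det_zero_of_row_eq hab.symm, mul_zero]
    ext x
    simp [Function.update_of_ne hab]
  · simp

end Minors
end SiegelShidlovskii

namespace SiegelShidlovskii
open Polynomial

section Shidlovskii
variable {K : Type*} [Field K] {m : ℕ}

/-- If the first `m` derivatives of a linear form are linearly dependent, they generate a multiple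
of a linear form of bounded degree. -/
theorem exists_bounded_form [CharZero K] (T : K[X]) (B : Matrix (Fin m) (Fin m) K[X]) (a : K)
    (ha : T.eval a ≠ 0) {q : ℕ} (hTq : T.natDegree ≤ q) (hBq : ∀ i j, (B i j).natDegree ≤ q) :
    ∃ c : ℕ, ∀ (t : ℕ) (P : Fin m → K[X]), P ≠ 0 → (∀ i, (P i).natDegree ≤ t) →
      (Matrix.of fun k : Fin m => (twist T B)^[k] P).det = 0 →
      ∃ (δ : K[X]) (w : Fin m → K[X]), δ ≠ 0 ∧ δ.natDegree ≤ (m - 1) * (t + m * q) ∧ w ≠ 0 ∧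
        (∀ i, (w i).natDegree ≤ c) ∧ δ • w ∈ twistSpan T B P m := by
  classical
  set τ := taylorSeries a with hτ
  have hτinj := taylorSeries_injective a
  obtain ⟨Φ, hdet, -, hΦ⟩ := exists_fundamental_matrix (τ T) (by rwa [constantCoeff_taylorSeries])
    (B.map τ)
  have hfun := fun s : ℕ => exists_bounded_functional τ hτinj (fun b => taylorSeries_C a b)
    (fun p : (Fin s → Fin m) × (Fin s → Fin m) => (Φ.submatrix p.1 p.2).det)
  choose c hc using hfun
  refine ⟨(Finset.range (m + 1)).sup c, fun t P hP0 hPt hdet0 => ?_⟩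
  obtain ⟨s, cm, J, hsm, hJinj, hJdet, hkill, hcomp⟩ :=
    exists_annihilated_solutions T B a ha Φ hdet hΦ P
  set Y := Φ * cm.map PowerSeries.C with hY
  set β := (Y.submatrix J id).det with hβ
  let η : Fin m → Fin s → PowerSeries K := fun i b => (Y.submatrix (Function.update J b i) id).det
  have hspanβ := submatrix_det_mem_span Φ cm J
  have hspanη := fun i b => submatrix_det_mem_span Φ cm (Function.update J b i)
  rw [← hY, ← hβ] at hspanβ
  rw [← hY] at hspanη
  let I := {i : Fin m // i ∉ Set.range J}
  have hrel : ∀ v ∈ twistSpan T B P m, ∀ b, β * τ (v (J b)) = - ∑ i : I, τ (v i) * η i b := by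
    intro v hv b
    refine det_mul_eq_neg_sum Y J hJinj (fun i => τ (v i)) (fun b => ?_) b
    exact zero_dvd_iff.1 (dvd_pair_of_mem_twistSpan τ T B P (fun i => Y i b) 0
      (fun k _ => dvd_of_eq (hkill k b).symm) hv)
  -- there are annihilated solutions
  have hs0 : s ≠ 0 := by
    rintro rfl
    have h1 : ((Matrix.of fun k : Fin m => (twist T B)^[k] P).map τ).det = 0 := by
      rw [← RingHom.mapMatrix_apply, ← RingHom.map_det, hdet0, map_zero]
    obtain ⟨y, hy0, hy⟩ := Matrix.exists_mulVec_eq_zero_iff.2 h1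
    obtain ⟨b, hb⟩ := hcomp y fun k hk => congrFun hy ⟨k, hk⟩
    apply hy0
    rw [hb]
    ext1 i
    simp [Matrix.mulVec, dotProduct]
  have hcard : Fintype.card I ≤ m - 1 := by
    have h1 : Fintype.card I = m - s := by
      rw [Fintype.card_subtype_compl]
      have : Fintype.card {i // i ∈ Set.range J} = s := by
        have e : Fin s ≃ {x // x ∈ Set.range J} := Equiv.ofInjective J hJinj
        rw [← Fintype.card_congr e, Fintype.card_fin]
      rw [this, Fintype.card_fin]
    omega
  have hm0 : m ≠ 0 := by
    rintro rfl
    exact hP0 (Subsingleton.elim _ _)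
  have hPmem : P ∈ twistSpan T B P m :=
    iterate_twist_mem_twistSpan T B P (k := 0) (Nat.pos_of_ne_zero hm0)
  obtain ⟨i0⟩ : Nonempty I := by
    by_contra hI
    rw [not_nonempty_iff] at hI
    apply hP0
    ext1 i
    by_cases hi : i ∈ Set.range J
    · obtain ⟨b, rfl⟩ := hi
      have := hrel P hPmem b
      rw [Finset.univ_eq_empty, Finset.sum_empty, neg_zero] at this
      exact (map_eq_zero_iff τ hτinj).1 ((mul_eq_zero.1 this).resolve_left hJdet)
    · exact hI.elim ⟨i, hi⟩
  let N : Matrix (Fin m) I K[X] := fun k i => (twist T B)^[k] P i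
  have hN : ∀ v, N.mulVec v = 0 → v = 0 := by
    intro v hv
    let y : Fin m → PowerSeries K := fun i => if h : i ∈ Set.range J then 0 else τ (v ⟨i, h⟩)
    have hyJ : ∀ b, y (J b) = 0 := fun b => dif_pos ⟨b, rfl⟩
    have hyI : ∀ i : I, y i = τ (v i) := fun i => dif_neg i.2
    obtain ⟨b, hb⟩ := hcomp y fun k hk => by
      have h1 := congrArg τ (congrFun hv ⟨k, hk⟩)
      rw [pair, ← Fintype.sum_subtype_add_sum_subtype (fun i => i ∈ Set.range J)]
      rw [Finset.sum_eq_zero (by rintro ⟨_, b, rfl⟩ _; simp [hyJ]), zero_add]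
      simp only [Matrix.mulVec, dotProduct, N, map_sum, map_mul, Pi.zero_apply, map_zero] at h1
      rw [← h1]
      exact Finset.sum_congr rfl fun i _ => by rw [hyI]
    have hb0 : b = 0 := by
      refine Matrix.eq_zero_of_mulVec_eq_zero hJdet ?_
      ext1 e
      have := congrFun hb (J e)
      rw [hyJ] at this
      exact this.symm
    ext1 i
    apply hτinj
    rw [← hyI, hb, hb0]
    simp
  obtain ⟨κ, hκ⟩ := exists_submatrix_det_ne_zero N hN
  set Q := N.submatrix κ id with hQ
  let wt : Fin m → K[X] := ∑ e, Q.adjugate i0 e • (twist T B)^[κ e] P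
  have hwt : wt ∈ twistSpan T B P m := Submodule.sum_mem _ fun e _ =>
    Submodule.smul_mem _ _ (iterate_twist_mem_twistSpan T B P (κ e).2)
  have hwtI : ∀ i : I, wt i = Q.det * (1 : Matrix I I K[X]) i0 i := by
    intro i
    have := congrFun (congrFun Q.adjugate_mul i0) i
    rw [Matrix.smul_apply, smul_eq_mul] at this
    rw [← this, Matrix.mul_apply]
    simp only [wt, Finset.sum_apply, Pi.smul_apply, smul_eq_mul]
    rfl
  obtain ⟨l, hl0, hldeg, hleq⟩ := hc s β hspanβ hJdet
  have hcoord : ∀ i, ∃ w : K[X], w.natDegree ≤ c s ∧ l β * wt i = Q.det * w := by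
    intro i
    by_cases hi : i ∈ Set.range J
    · obtain ⟨b, rfl⟩ := hi
      have h1 := hrel wt hwt b
      rw [Finset.sum_eq_single i0 (fun i _ hi => by
        rw [hwtI, Matrix.one_apply_ne hi.symm, mul_zero, map_zero, zero_mul]) (by simp),
        hwtI, Matrix.one_apply_eq, mul_one, ← mul_neg, mul_comm] at h1
      have h2 := Submodule.neg_mem _ (hspanη i0 b)
      exact ⟨l (-η i0 b), hldeg _ h2, by rw [← hleq _ _ _ hspanβ _ h2 h1, mul_comm]⟩
    · refine ⟨l β * (1 : Matrix I I K[X]) i0 ⟨i, hi⟩, ?_, ?_⟩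
      · by_cases h : i0 = ⟨i, hi⟩
        · rw [← h, Matrix.one_apply_eq, mul_one]
          exact hldeg _ hspanβ
        · rw [Matrix.one_apply_ne h]; simp
      · rw [hwtI ⟨i, hi⟩]; ring
  choose w hwdeg hw using hcoord
  refine ⟨Q.det, w, hκ, ?_, ?_, ?_, ?_⟩
  · refine (natDegree_det_le_of_forall_le Q (d := t + m * q) fun i j => ?_).trans
      (Nat.mul_le_mul_right _ hcard)
    refine (natDegree_iterate_twist_le hTq hBq hPt _ _).trans ?_
    exact Nat.add_le_add_left (Nat.mul_le_mul_right _ (κ i).2.le) _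
  · intro h
    have := hw i0
    rw [hwtI, Matrix.one_apply_eq, mul_one, h] at this
    simp [hl0, hκ] at this
  · exact fun i => (hwdeg i).trans (Finset.le_sup (f := c) (Finset.mem_range.2 (by omega)))
  · have : Q.det • w = l β • wt := by
      ext1 i
      exact (hw i).symm
    rw [this]
    exact Submodule.smul_mem _ _ hwt

theorem exists_order_bound (g : Fin m → PowerSeries K)
    (hg : ∀ P, pair Polynomial.coeToPowerSeries.ringHom P g = 0 → P = 0) (d : ℕ) :
    ∃ c, ∀ w : Fin m → K[X], w ≠ 0 → (∀ i, (w i).natDegree ≤ d) →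
      ∃ j ≤ c, PowerSeries.coeff j (pair Polynomial.coeToPowerSeries.ringHom w g) ≠ 0 := by
  let L : ℕ → (Fin m → degreeLT K (d + 1)) →ₗ[K] K := fun n =>
    { toFun := fun v => PowerSeries.coeff n (pair Polynomial.coeToPowerSeries.ringHom
        (fun i => (v i : K[X])) g)
      map_add' := fun x y => by simp [pair, add_mul, Finset.sum_add_distrib]
      map_smul' := fun x y => by
        simp [pair, Finset.mul_sum, Polynomial.smul_eq_C_mul, mul_assoc] }
  let W : ℕ → Submodule K (Fin m → degreeLT K (d + 1)) := fun n =>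
    ⨅ j ∈ Finset.range (n + 1), LinearMap.ker (L j)
  have hW : ∀ n v, v ∈ W n ↔ ∀ j ≤ n, L j v = 0 := fun n v => by
    simp [W, Submodule.mem_iInf]
  let N : ℕ →o (Submodule K (Fin m → degreeLT K (d + 1)))ᵒᵈ :=
    { toFun := fun n => OrderDual.toDual (W n)
      monotone' := fun a b hab => OrderDual.toDual_le_toDual.2 fun v hv =>
        (hW _ _).2 fun j hj => (hW _ _).1 hv j (hj.trans hab) }
  obtain ⟨n, hn⟩ := IsArtinian.monotone_stabilizes N
  refine ⟨n, fun w hw0 hwd => ?_⟩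
  by_contra! h
  apply hw0
  apply hg
  let v : Fin m → degreeLT K (d + 1) := fun i =>
    ⟨w i, mem_degreeLT.2 ((degree_le_of_natDegree_le (hwd i)).trans_lt
      (by exact_mod_cast Nat.lt_succ_self d))⟩
  have hv : v ∈ W n := (hW _ _).2 h
  ext k
  have h1 : v ∈ W (max n k) := by
    have h2 : W n = W (max n k) := congrArg OrderDual.ofDual (hn _ (le_max_left n k))
    rwa [← h2]
  exact (hW _ _).1 h1 k (le_max_right n k)

theorem X_pow_dvd_iff_le_order {h : PowerSeries K} {n : ℕ} :
    PowerSeries.X ^ n ∣ h ↔ (n : ℕ∞) ≤ h.order := by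
  rw [PowerSeries.X_pow_dvd_iff]
  exact ⟨PowerSeries.nat_le_order h n, fun hn m hm =>
    PowerSeries.coeff_of_lt_order _ ((Nat.cast_lt.2 hm).trans_le hn)⟩

theorem le_of_X_pow_dvd_mul {p : K[X]} (hp : p ≠ 0) {h : PowerSeries K} {n j : ℕ}
    (hn : PowerSeries.X ^ n ∣ (p : PowerSeries K) * h) (hj : PowerSeries.coeff j h ≠ 0) :
    n ≤ p.natDegree + j := by
  have h1 := X_pow_dvd_iff_le_order.1 hn
  rw [PowerSeries.order_mul] at h1
  have h2 : (p : PowerSeries K).order ≤ p.natDegree := by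
    apply PowerSeries.order_le
    rw [Polynomial.coeff_coe]
    exact leadingCoeff_ne_zero.2 hp
  have h3 := PowerSeries.order_le j hj
  exact_mod_cast h1.trans (add_le_add h2 h3)

variable {T : K[X]} {B : Matrix (Fin m) (Fin m) K[X]} {g : Fin m → PowerSeries K}

theorem coe_derivative_eq (p : K[X]) :
    PowerSeries.derivative K (Polynomial.coeToPowerSeries.ringHom p) =
      Polynomial.coeToPowerSeries.ringHom (derivative p) := PowerSeries.derivative_coe p

theorem X_pow_dvd_pair_iterate_twist
    (hsys : ∀ i, (T : PowerSeries K) * PowerSeries.derivative K (g i) =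
      ∑ j, (B i j : PowerSeries K) * g j) {P : Fin m → K[X]} {n k : ℕ}
    (hP : PowerSeries.X ^ (n + k) ∣ pair Polynomial.coeToPowerSeries.ringHom P g) :
    PowerSeries.X ^ n ∣ pair Polynomial.coeToPowerSeries.ringHom ((twist T B)^[k] P) g := by
  rw [pair_iterate_twist _ coe_derivative_eq T B g hsys]
  exact X_pow_dvd_iterate_theta _ _ _ hP

/-- **Shidlovskii's lemma.** -/
theorem exists_det_ne_zero_of_X_pow_dvd [CharZero K]
    (hsys : ∀ i, (T : PowerSeries K) * PowerSeries.derivative K (g i) =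
      ∑ j, (B i j : PowerSeries K) * g j)
    (hg : ∀ P, pair Polynomial.coeToPowerSeries.ringHom P g = 0 → P = 0)
    (a : K) (ha : T.eval a ≠ 0) {q : ℕ} (hTq : T.natDegree ≤ q)
    (hBq : ∀ i j, (B i j).natDegree ≤ q) :
    ∃ c : ℕ, ∀ (t : ℕ) (P : Fin m → K[X]), P ≠ 0 → (∀ i, (P i).natDegree ≤ t) →
      PowerSeries.X ^ ((m - 1) * t + c) ∣ pair Polynomial.coeToPowerSeries.ringHom P g →
      (Matrix.of fun k : Fin m => (twist T B)^[k] P).det ≠ 0 := by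
  obtain ⟨c1, hc1⟩ := exists_bounded_form T B a ha hTq hBq
  obtain ⟨c2, hc2⟩ := exists_order_bound g hg c1
  refine ⟨(m - 1) * (m * q) + c2 + 1 + m, fun t P hP0 hPt hX h0 => ?_⟩
  obtain ⟨δ, w, hδ0, hδ, hw0, hw, hmem⟩ := hc1 t P hP0 hPt h0
  obtain ⟨j, hj, hcoeff⟩ := hc2 w hw0 hw
  have h1 : PowerSeries.X ^ ((m - 1) * t + ((m - 1) * (m * q) + c2 + 1)) ∣
      pair Polynomial.coeToPowerSeries.ringHom (δ • w) g := by
    refine dvd_pair_of_mem_twistSpan _ T B P g _ (fun k hk => ?_) hmem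
    refine X_pow_dvd_pair_iterate_twist hsys ((pow_dvd_pow _ ?_).trans hX)
    omega
  rw [pair_smul] at h1
  have h2 := le_of_X_pow_dvd_mul hδ0 h1 hcoeff
  rw [mul_add] at hδ
  omega

/-- Zero estimate: the forms obtained from `P` by differentiation have full rank at `a`. -/
theorem exists_sum_eval_ne_zero [CharZero K]
    (hsys : ∀ i, (T : PowerSeries K) * PowerSeries.derivative K (g i) =
      ∑ j, (B i j : PowerSeries K) * g j)
    (hg : ∀ P, pair Polynomial.coeToPowerSeries.ringHom P g = 0 → P = 0)
    (a : K) (ha0 : a ≠ 0) (ha : T.eval a ≠ 0) :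
    ∃ c : ℕ, ∀ (t : ℕ) (P : Fin m → K[X]), P ≠ 0 → (∀ i, (P i).natDegree ≤ t) →
      PowerSeries.X ^ ((m - 1) * t + c) ∣ pair Polynomial.coeToPowerSeries.ringHom P g →
      ∀ e : Fin m → K, e ≠ 0 → ∃ k ≤ t + c, ∑ i, ((twist T B)^[k] P i).eval a * e i ≠ 0 := by
  classical
  obtain ⟨q, hTq, hBq⟩ : ∃ q, T.natDegree ≤ q ∧ ∀ i j, (B i j).natDegree ≤ q :=
    ⟨T.natDegree + ∑ i, ∑ j, (B i j).natDegree, Nat.le_add_right _ _, fun i j =>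
      ((Finset.single_le_sum (f := fun j => (B i j).natDegree) (fun _ _ => Nat.zero_le _)
        (Finset.mem_univ j)).trans (Finset.single_le_sum (f := fun i => ∑ j, (B i j).natDegree)
        (fun _ _ => Nat.zero_le _) (Finset.mem_univ i))).trans (Nat.le_add_left _ _)⟩
  obtain ⟨c1, hc1⟩ := exists_det_ne_zero_of_X_pow_dvd hsys hg a ha hTq hBq
  rcases Nat.eq_zero_or_pos m with rfl | hm
  · exact ⟨0, fun t P hP => (hP (Subsingleton.elim _ _)).elim⟩
  obtain ⟨o, ho⟩ : ∃ o, PowerSeries.coeff o (g ⟨0, hm⟩) ≠ 0 := by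
    by_contra! h
    have h1 : g ⟨0, hm⟩ = 0 := by ext n; simpa using h n
    have h2 := congrFun (hg (Pi.single ⟨0, hm⟩ 1) (by
      rw [pair, Finset.sum_eq_single ⟨0, hm⟩] <;> simp +contextual [h1])) ⟨0, hm⟩
    simp at h2
  set τ := taylorSeries a with hτ
  obtain ⟨Φ, hdet, hΦ0, hΦ⟩ := exists_fundamental_matrix (τ T)
    (by rwa [constantCoeff_taylorSeries]) (B.map τ)
  refine ⟨c1 + m * (m * q) + 2 * m + o, fun t P hP0 hPt hX e he => ?_⟩
  by_contra! hall
  have hΔ := hc1 t P hP0 hPt ((pow_dvd_pow _ (by omega)).trans hX)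
  set D := Matrix.of fun k : Fin m => (twist T B)^[k] P with hD
  have hcr : ∀ (S : Type _) [CommRing S] (ψ : K[X] →+* S) (y : Fin m → S) (i : Fin m),
      ψ D.det * y i = ∑ k : Fin m, ψ (D.adjugate i k) * pair ψ ((twist T B)^[k] P) y := by
    intro S _ ψ y i
    have h1 : (D.map ψ).adjugate.mulVec ((D.map ψ).mulVec y) = (D.map ψ).det • y := by
      rw [Matrix.mulVec_mulVec, Matrix.adjugate_mul, Matrix.smul_mulVec, Matrix.one_mulVec]
    have h2 := congrFun h1 i
    rw [← RingHom.mapMatrix_apply, ← RingHom.map_det, ← RingHom.map_adjugate] at h2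
    exact h2.symm
  -- order at the origin
  have h0 : PowerSeries.X ^ ((m - 1) * t + (c1 + m * (m * q) + m + o)) ∣
      (D.det : PowerSeries K) * g ⟨0, hm⟩ := by
    have := hcr _ Polynomial.coeToPowerSeries.ringHom g ⟨0, hm⟩
    rw [Polynomial.coeToPowerSeries.ringHom_apply] at this
    rw [this]
    refine Finset.dvd_sum fun k _ => Dvd.dvd.mul_left ?_ _
    refine X_pow_dvd_pair_iterate_twist hsys ((pow_dvd_pow _ ?_).trans hX)
    have := k.2
    omega
  have h0' : (X : K[X]) ^ ((m - 1) * t + (c1 + m * (m * q) + m)) ∣ D.det := by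
    have h1 := X_pow_dvd_iff_le_order.1 h0
    rw [PowerSeries.order_mul] at h1
    have h2 := PowerSeries.order_le o ho
    have h3 : (((m - 1) * t + (c1 + m * (m * q) + m) : ℕ) : ℕ∞) ≤
        (D.det : PowerSeries K).order := by
      have h4 := h1.trans (add_le_add le_rfl h2)
      rw [← add_assoc ((m - 1) * t), Nat.cast_add] at h4
      exact (ENat.add_le_add_iff_right (ENat.natCast_ne_top o)).1 h4
    rw [X_pow_dvd_iff]
    intro d hd
    rw [← Polynomial.coeff_coe]
    exact PowerSeries.X_pow_dvd_iff.1 (X_pow_dvd_iff_le_order.2 h3) d hd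
  -- the order at `a`
  let y : Fin m → PowerSeries K := fun i => ∑ j, Φ i j * PowerSeries.C (e j)
  have hy : ∀ i, τ T * PowerSeries.derivative K (y i) = ∑ j, τ (B i j) * y j := by
    intro i
    simp only [y, map_sum, Derivation.leibniz, PowerSeries.derivative_C, smul_eq_mul,
      Finset.mul_sum]
    rw [Finset.sum_comm]
    refine Finset.sum_congr rfl fun j _ => ?_
    have h1 := hΦ i j
    simp only [Matrix.map_apply] at h1
    rw [mul_zero, zero_add, mul_left_comm, h1, Finset.mul_sum]
    exact Finset.sum_congr rfl fun k _ => by ring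
  have hyc : ∀ i, PowerSeries.constantCoeff (y i) = e i := by
    intro i
    simp [y, hΦ0, Matrix.one_apply]
  have hord : PowerSeries.X ^ (t + m * (m * q) + 1 + m) ∣ pair τ P y := by
    refine X_pow_dvd_of_constantCoeff_theta (τ T) (by rwa [constantCoeff_taylorSeries]) _ _ ?_
    intro k hk
    rw [← pair_iterate_twist τ (derivative_taylorSeries a) T B y hy]
    simp only [pair, map_sum, map_mul, hyc, hτ, constantCoeff_taylorSeries]
    exact hall k (by omega)
  obtain ⟨i, hi⟩ : ∃ i, e i ≠ 0 := by
    by_contra! h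
    exact he (funext h)
  have h1 : PowerSeries.X ^ (t + m * (m * q) + 1) ∣ τ D.det * y i := by
    rw [hcr]
    refine Finset.dvd_sum fun k _ => Dvd.dvd.mul_left ?_ _
    rw [pair_iterate_twist τ (derivative_taylorSeries a) T B y hy]
    exact X_pow_dvd_iterate_theta _ _ _ ((pow_dvd_pow _ (by omega)).trans hord)
  have hu : IsUnit (y i) := PowerSeries.isUnit_iff_constantCoeff.2 (by
    rw [hyc]; exact isUnit_iff_ne_zero.2 hi)
  have h2 : (X : K[X]) ^ (t + m * (m * q) + 1) ∣ D.det.comp (X + C a) := by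
    have h3 := (hu.dvd_mul_right).1 h1
    rw [← taylor_apply, X_pow_dvd_iff]
    intro d hd
    rw [← Polynomial.coeff_coe]
    exact PowerSeries.X_pow_dvd_iff.1 h3 d hd
  rw [← X_sub_C_pow_dvd_iff] at h2
  have hcop : IsCoprime ((X : K[X]) ^ ((m - 1) * t + (c1 + m * (m * q) + m)))
      ((X - C a) ^ (t + m * (m * q) + 1)) := by
    refine IsCoprime.pow ?_
    have := isCoprime_X_sub_C_of_isUnit_sub (R := K) (a := 0) (b := a)
      (by simpa using ha0)
    simpa using this
  have h3 := natDegree_le_of_dvd (hcop.mul_dvd h0' h2) hΔ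
  have h4 : D.det.natDegree ≤ m * (t + m * q) := by
    refine (natDegree_det_le_of_forall_le D (d := t + m * q) fun i j => ?_).trans (by simp)
    refine (natDegree_iterate_twist_le hTq hBq hPt _ _).trans ?_
    exact Nat.add_le_add_left (Nat.mul_le_mul_right _ i.2.le) _
  rw [natDegree_mul (pow_ne_zero _ X_ne_zero) (pow_ne_zero _ (X_sub_C_ne_zero a)),
    natDegree_pow, natDegree_X, natDegree_pow, natDegree_X_sub_C] at h3
  have h5 : m * t = (m - 1) * t + t := by
    obtain ⟨n, rfl⟩ : ∃ n, m = n + 1 := ⟨m - 1, by omega⟩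
    simp [add_mul]
  rw [mul_add, h5] at h4
  omega

end Shidlovskii
end SiegelShidlovskii

namespace SiegelShidlovskii
open Polynomial

section Hilbert
variable {A E ι : Type*} [CommRing A] [CommRing E] [Algebra A E]

/-- The span of the values at `x` of polynomials of degree at most one. -/
def linForms (A : Type*) [CommRing A] {E ι : Type*} [CommRing E] [Algebra A E] (x : ι → E)
    (s : Set ι) : Submodule A E :=
  Submodule.span A (insert 1 (x '' s))

theorem one_le_linForms (x : ι → E) (s : Set ι) : 1 ≤ linForms A x s := by
  rw [Submodule.one_eq_span]
  exact Submodule.span_mono (by simp)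

theorem linForms_pow_mono (x : ι → E) (s : Set ι) {N M : ℕ} (h : N ≤ M) :
    linForms A x s ^ N ≤ linForms A x s ^ M :=
  pow_le_pow_right₀ (one_le_linForms x s) h

theorem mem_linForms (x : ι → E) {s : Set ι} {i : ι} (hi : i ∈ s) : x i ∈ linForms A x s :=
  Submodule.subset_span (Set.mem_insert_of_mem _ ⟨i, hi, rfl⟩)

theorem finite_linForms_pow [Finite ι] (x : ι → E) (s : Set ι) (N : ℕ) :
    Module.Finite A (linForms A x s ^ N : Submodule A E) := by
  have h : (linForms A x s).FG :=
    Submodule.fg_span (((Set.toFinite s).image x).insert 1)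
  exact Module.Finite.iff_fg.2 (h.pow N)

theorem exists_mem_linForms_pow_of_mem_adjoin (x : ι → E) (s : Set ι) {r : E}
    (hr : r ∈ Algebra.adjoin A (x '' s)) : ∃ q, r ∈ linForms A x s ^ q := by
  induction hr using Algebra.adjoin_induction with
  | mem r hr =>
    obtain ⟨i, hi, rfl⟩ := hr
    exact ⟨1, by rw [pow_one]; exact mem_linForms x hi⟩
  | algebraMap a =>
    exact ⟨0, by rw [pow_zero]; exact Submodule.algebraMap_mem a⟩
  | add a b _ _ ha hb =>
    obtain ⟨p, hp⟩ := ha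
    obtain ⟨q, hq⟩ := hb
    exact ⟨max p q, Submodule.add_mem _ (linForms_pow_mono x s (le_max_left p q) hp)
      (linForms_pow_mono x s (le_max_right p q) hq)⟩
  | mul a b _ _ ha hb =>
    obtain ⟨p, hp⟩ := ha
    obtain ⟨q, hq⟩ := hb
    exact ⟨p + q, by rw [pow_add]; exact Submodule.mul_mem_mul hp hq⟩

theorem prod_mem_submodule_prod {κ : Type*} (s : Finset κ) (M : κ → Submodule A E) (v : κ → E)
    (h : ∀ i, v i ∈ M i) : ∏ i ∈ s, v i ∈ ∏ i ∈ s, M i := by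
  classical
  induction s using Finset.induction_on with
  | empty => simpa using Submodule.one_le.1 (le_refl (1 : Submodule A E))
  | insert i s hi ih =>
    rw [Finset.prod_insert hi, Finset.prod_insert hi]
    exact Submodule.mul_mem_mul (h i) ih

theorem pow_le_finrank_linForms_pow [Nontrivial A] [Fintype ι] [DecidableEq ι] (x : ι → E)
    (S : Finset ι) (hS : AlgebraicIndepOn A x (S : Set ι)) (N : ℕ) :
    (N + 1) ^ S.card ≤ Module.finrank A (linForms A x Set.univ ^ (S.card * N) : Submodule A E) := by
  let mon : (↥(S : Set ι) → Fin (N + 1)) → (↥(S : Set ι) →₀ ℕ) := fun ν =>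
    Finsupp.equivFunOnFinite.symm fun i => (ν i : ℕ)
  have hmon : Function.Injective mon := fun ν μ h => by
    have := Finsupp.equivFunOnFinite.symm.injective h
    funext i
    exact Fin.ext (congrFun this i)
  let v : (↥(S : Set ι) → Fin (N + 1)) → E := fun ν => ∏ i : ↥(S : Set ι), x (i : ι) ^ (ν i : ℕ)
  have hv : LinearIndependent A v := by
    have h1 := ((MvPolynomial.basisMonomials ↥(S : Set ι) A).linearIndependent.map'
      (MvPolynomial.aeval (R := A) fun i : ↥(S : Set ι) => x i).toLinearMap
      (LinearMap.ker_eq_bot.2 hS)).comp mon hmon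
    convert! h1 using 1
    funext ν
    simp [v, mon, MvPolynomial.aeval_monomial, Finsupp.prod_fintype]
  have hmem : ∀ ν, v ν ∈ linForms A x Set.univ ^ (S.card * N) := by
    intro ν
    have h1 : v ν ∈ ∏ i : ↥(S : Set ι), linForms A x Set.univ ^ (ν i : ℕ) :=
      prod_mem_submodule_prod _ _ _ fun i =>
        Submodule.pow_mem_pow _ (mem_linForms x (Set.mem_univ _)) _
    rw [Finset.prod_pow_eq_pow_sum] at h1
    refine linForms_pow_mono x _ ?_ h1
    calc ∑ i, (ν i : ℕ) ≤ ∑ _i : ↥(S : Set ι), N := Finset.sum_le_sum fun i _ => by omega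
      _ = S.card * N := by simp
  have := finite_linForms_pow (A := A) x Set.univ (S.card * N)
  have h2 : LinearIndependent A fun ν => (⟨v ν, hmem ν⟩ :
      (linForms A x Set.univ ^ (S.card * N) : Submodule A E)) :=
    LinearIndependent.of_comp (Submodule.subtype _) hv
  simpa using h2.fintype_card_le_finrank

theorem linForms_pow_le_span [Fintype ι] [DecidableEq ι] (x : ι → E) (S : Finset ι) (L : ℕ) :
    linForms A x (S : Set ι) ^ L ≤ Submodule.span A
      (Set.range fun ν : ↥S → Fin (L + 1) => ∏ i : ↥S, x (i : ι) ^ (ν i : ℕ)) := by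
  induction L with
  | zero =>
    rw [pow_zero, Submodule.one_eq_span, Submodule.span_le, Set.singleton_subset_iff]
    exact Submodule.subset_span ⟨fun _ => 0, by simp⟩
  | succ L ih =>
    rw [pow_succ]
    refine (mul_le_mul' ih le_rfl).trans ?_
    rw [linForms, Submodule.span_mul_span, Submodule.span_le]
    rintro _ ⟨_, ⟨ν, rfl⟩, b, hb, rfl⟩
    apply Submodule.subset_span
    rcases hb with rfl | ⟨i, hi, rfl⟩
    · exact ⟨fun i => (ν i).castSucc, by simp⟩
    · refine ⟨Function.update (fun i => (ν i).castSucc) ⟨i, hi⟩ (ν ⟨i, hi⟩).succ, ?_⟩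
      dsimp only
      rw [← Finset.mul_prod_erase _ _ (Finset.mem_univ (⟨i, hi⟩ : S)),
        ← Finset.mul_prod_erase Finset.univ (fun j : S => x j ^ (ν j : ℕ))
          (Finset.mem_univ (⟨i, hi⟩ : S))]
      rw [Function.update_self, Fin.val_succ, pow_succ, mul_right_comm]
      have h : ∏ j ∈ Finset.univ.erase (⟨i, hi⟩ : S), x j ^
          (Function.update (fun i => (ν i).castSucc) ⟨i, hi⟩ (ν ⟨i, hi⟩).succ j : ℕ) =
          ∏ j ∈ Finset.univ.erase (⟨i, hi⟩ : S), x j ^ (ν j : ℕ) :=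
        Finset.prod_congr rfl fun j hj => by
          rw [Function.update_of_ne (Finset.ne_of_mem_erase hj), Fin.val_castSucc]
      rw [h]

/-- Multiplication by an algebraic element on a finitely generated module. -/
theorem exists_mul_le_of_isAlgebraic [IsDomain E] (x : ι → E) (s : Set ι) {y : E}
    (hy : IsAlgebraic (Algebra.adjoin A (x '' s)) y) :
    ∃ (W : Submodule A E) (δ : E) (q : ℕ), W.FG ∧ 1 ≤ W ∧ δ ≠ 0 ∧ δ ∈ linForms A x s ^ q ∧
      ∀ w ∈ W, δ * (y * w) ∈ linForms A x s ^ q * W := by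
  obtain ⟨p, hp0, hp⟩ := hy
  have hcoef := fun j => exists_mem_linForms_pow_of_mem_adjoin x s (p.coeff j).2
  choose d hd using hcoef
  set e := p.natDegree with he
  let q := (Finset.range (e + 1)).sup d
  have hq : ∀ j ≤ e, (p.coeff j : E) ∈ linForms A x s ^ q := fun j hj =>
    linForms_pow_mono x s (Finset.le_sup (f := d) (Finset.mem_range.2 (Nat.lt_succ_of_le hj)))
      (hd j)
  have hlead : (p.coeff e : E) ≠ 0 := by
    simpa [he] using hp0
  rw [Polynomial.aeval_eq_sum_range, ← he, Finset.sum_range_succ] at hp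
  simp only [Algebra.smul_def] at hp
  have he0 : e ≠ 0 := by
    intro h0
    rw [h0] at hp hlead
    simp only [Finset.range_zero, Finset.sum_empty, zero_add, pow_zero, mul_one] at hp
    exact hlead hp
  refine ⟨Submodule.span A ((fun j => y ^ j) '' Set.Iio e), p.coeff e, q, ?_, ?_, hlead,
    hq e le_rfl, ?_⟩
  · exact Submodule.fg_span ((Set.finite_Iio e).image _)
  · rw [Submodule.one_eq_span]
    refine Submodule.span_mono ?_
    rw [Set.singleton_subset_iff]
    exact ⟨0, Nat.pos_of_ne_zero he0, pow_zero y⟩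
  · intro w hw
    induction hw using Submodule.span_induction with
    | mem w hw =>
      obtain ⟨j, hj, rfl⟩ := hw
      dsimp only
      rw [← pow_succ']
      rcases Nat.lt_or_ge (j + 1) e with h | h
      · exact Submodule.mul_mem_mul (hq e le_rfl) (Submodule.subset_span ⟨j + 1, h, rfl⟩)
      · have hje : j + 1 = e := le_antisymm hj h
        rw [hje]
        have : (p.coeff e : E) * y ^ e = - ∑ j ∈ Finset.range e, (p.coeff j : E) * y ^ j :=
          eq_neg_of_add_eq_zero_right hp
        rw [this]
        refine Submodule.neg_mem _ (Submodule.sum_mem _ fun i hi => ?_)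
        have hi := Finset.mem_range.1 hi
        exact Submodule.mul_mem_mul (hq i hi.le) (Submodule.subset_span ⟨i, hi, rfl⟩)
    | zero => simp
    | add a b _ _ ha hb => rw [mul_add, mul_add]; exact Submodule.add_mem _ ha hb
    | smul a b _ hb => rw [mul_smul_comm, mul_smul_comm]; exact Submodule.smul_mem _ _ hb

theorem exists_finrank_linForms_pow_le [IsDomain A] [IsDomain E] [FaithfulSMul A E] [Fintype ι]
    [DecidableEq ι] (x : ι → E) {k : ℕ}
    (hk : ∀ S : Finset ι, S.card = k + 1 → ¬ AlgebraicIndepOn A x (S : Set ι)) :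
    ∃ C : ℕ, ∀ N, Module.finrank A (linForms A x Set.univ ^ N : Submodule A E) ≤
      C * (N + 1) ^ k := by
  obtain ⟨S, hScard, hS, hmax⟩ : ∃ S : Finset ι, S.card ≤ k ∧ AlgebraicIndepOn A x (S : Set ι) ∧
      ∀ i, i ∉ S → ¬ AlgebraicIndepOn A x (insert i S : Finset ι) := by
    classical
    obtain ⟨S, hS, hmax⟩ := Finset.exists_max_image
      (Finset.univ.filter fun S : Finset ι => AlgebraicIndepOn A x (S : Set ι)) Finset.card
      ⟨∅, by
        rw [Finset.mem_filter]
        refine ⟨Finset.mem_univ _, ?_⟩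
        rw [Finset.coe_empty]
        exact (algebraicIndependent_empty_type_iff (R := A) (A := E)).2
          (FaithfulSMul.algebraMap_injective A E)⟩
    rw [Finset.mem_filter] at hS
    refine ⟨S, ?_, hS.2, fun i hi h => ?_⟩
    · by_contra! h
      obtain ⟨S', hS', hcard⟩ := Finset.exists_subset_card_eq (Nat.succ_le_of_lt h)
      exact hk S' hcard (hS.2.mono (Finset.coe_subset.2 hS'))
    · have := hmax _ (Finset.mem_filter.2 ⟨Finset.mem_univ _, h⟩)
      rw [Finset.card_insert_of_notMem hi] at this
      omega
  have halg : ∀ i, IsAlgebraic (Algebra.adjoin A (x '' (S : Set ι))) (x i) := by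
    intro i
    by_cases hi : i ∈ S
    · exact isAlgebraic_algebraMap
        (⟨x i, Algebra.subset_adjoin ⟨i, hi, rfl⟩⟩ : Algebra.adjoin A (x '' (S : Set ι)))
    · by_contra h
      have := AlgebraicIndepOn.insert hS h
      rw [← Finset.coe_insert] at this
      exact hmax i hi this
  choose W δ q hWfg hW1 hδ0 hδ hmul using fun i =>
    exists_mul_le_of_isAlgebraic x (S : Set ι) (halg i)
  set Z := linForms A x (S : Set ι)
  let V := linForms A x Set.univ
  let D : E := ∏ i, δ i
  let Q : ℕ := ∑ i, q i
  let WW : Submodule A E := ∏ i, W i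
  have hD0 : D ≠ 0 := Finset.prod_ne_zero_iff.2 fun i _ => hδ0 i
  have hWW1 : 1 ≤ WW := Finset.one_le_prod' fun i _ => hW1 i
  have hWWfg : WW.FG := by
    refine Finset.prod_induction _ Submodule.FG (fun _ _ => Submodule.FG.mul) ?_ fun i _ => hWfg i
    rw [Submodule.one_eq_span]
    exact Submodule.fg_span_singleton 1
  have hDZ : D ∈ Z ^ Q := by
    rw [← Finset.prod_pow_eq_pow_sum]
    exact prod_mem_submodule_prod _ _ _ fun i => hδ i
  have hi : ∀ i, ∀ w ∈ WW, D * (x i * w) ∈ Z ^ Q * WW := by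
    intro i w hw
    have h1 : WW = W i * ∏ j ∈ Finset.univ.erase i, W j :=
      (Finset.mul_prod_erase _ _ (Finset.mem_univ i)).symm
    have h2 : D = δ i * ∏ j ∈ Finset.univ.erase i, δ j :=
      (Finset.mul_prod_erase _ _ (Finset.mem_univ i)).symm
    have h3 : Z ^ Q = Z ^ q i * ∏ j ∈ Finset.univ.erase i, Z ^ q j := by
      rw [← Finset.prod_pow_eq_pow_sum]
      exact (Finset.mul_prod_erase _ _ (Finset.mem_univ i)).symm
    rw [h1] at hw ⊢
    rw [h2, h3, mul_mul_mul_comm]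
    induction hw using Submodule.mul_induction_on' with
    | mem_mul_mem a ha b hb =>
      have h4 : δ i * (∏ j ∈ Finset.univ.erase i, δ j) * (x i * (a * b)) =
          δ i * (x i * a) * ((∏ j ∈ Finset.univ.erase i, δ j) * b) := by ring
      rw [h4, mul_mul_mul_comm, mul_mul_mul_comm (Z ^ q i)]
      exact Submodule.mul_mem_mul (hmul i a ha) (Submodule.mul_mem_mul
        (prod_mem_submodule_prod _ _ _ fun j => hδ j) hb)
    | add a _ b _ ha hb => rw [mul_add, mul_add]; exact Submodule.add_mem _ ha hb
  have hV : ∀ v ∈ V, ∀ w ∈ WW, D * (v * w) ∈ Z ^ Q * WW := by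
    intro v hv w hw
    induction hv using Submodule.span_induction with
    | mem v hv =>
      rcases hv with rfl | ⟨i, -, rfl⟩
      · rw [one_mul]
        exact Submodule.mul_mem_mul hDZ hw
      · exact hi i w hw
    | zero => simp
    | add a b _ _ ha hb => rw [add_mul, mul_add]; exact Submodule.add_mem _ ha hb
    | smul a b _ hb => rw [smul_mul_assoc, mul_smul_comm]; exact Submodule.smul_mem _ _ hb
  have hpow : ∀ N, ∀ v ∈ V ^ N, ∀ w ∈ WW, D ^ N * (v * w) ∈ Z ^ (Q * N) * WW := by
    intro N
    induction N with
    | zero =>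
      intro v hv w hw
      simp only [pow_zero, mul_zero, one_mul] at hv ⊢
      obtain ⟨a, rfl⟩ := Submodule.mem_one.1 hv
      rw [← Algebra.smul_def]
      exact Submodule.smul_mem _ _ hw
    | succ N ih =>
      intro v hv w hw
      rw [pow_succ] at hv
      induction hv using Submodule.mul_induction_on' with
      | mem_mul_mem a ha b hb =>
        have h1 := hV b hb w hw
        have h2 : ∀ u ∈ Z ^ Q * WW, D ^ N * (a * u) ∈ Z ^ (Q * (N + 1)) * WW := by
          intro u hu
          induction hu using Submodule.mul_induction_on' with
          | mem_mul_mem z hz w hw =>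
            have h3 := Submodule.mul_mem_mul hz (ih a ha w hw)
            rw [← mul_assoc, ← pow_add, ← add_comm, ← Nat.mul_succ] at h3
            convert h3 using 1
            ring
          | add u _ v _ hu hv =>
            rw [mul_add a, mul_add (D ^ N)]
            exact Submodule.add_mem _ hu hv
        convert h2 _ h1 using 1
        ring
      | add a _ b _ ha hb =>
        rw [add_mul a, mul_add (D ^ (N + 1))]
        exact Submodule.add_mem _ ha hb
  obtain ⟨G, hG⟩ := hWWfg
  refine ⟨(Q + 1) ^ k * G.card, fun N => ?_⟩
  have hle : Z ^ (Q * N) * WW ≤ Submodule.span A (Set.range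
      fun p : (↥S → Fin (Q * N + 1)) × G => (∏ i : ↥S, x (i : ι) ^ (p.1 i : ℕ)) * p.2) := by
    refine (mul_le_mul' (linForms_pow_le_span x S (Q * N)) le_rfl).trans ?_
    rw [← hG, Submodule.span_mul_span]
    refine Submodule.span_mono ?_
    rintro _ ⟨_, ⟨ν, rfl⟩, b, hb, rfl⟩
    exact ⟨(ν, ⟨b, hb⟩), rfl⟩
  set U := Submodule.span A (Set.range
      fun p : (↥S → Fin (Q * N + 1)) × G => (∏ i : ↥S, x (i : ι) ^ (p.1 i : ℕ)) * p.2)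
  have hUfin : Module.Finite A U := Module.Finite.span_of_finite _ (Set.finite_range _)
  let φ : (V ^ N : Submodule A E) →ₗ[A] U :=
    ((LinearMap.mulLeft A (D ^ N)).comp (Submodule.subtype _)).codRestrict U fun v => by
      have := hle (hpow N v v.2 1 (hWW1 (Submodule.mem_one.2 ⟨1, map_one _⟩)))
      rwa [mul_one] at this
  have hφ : Function.Injective φ := by
    intro a b hab
    have := congrArg Subtype.val hab
    exact Subtype.ext (mul_left_cancel₀ (pow_ne_zero N hD0) this)
  refine (LinearMap.finrank_le_finrank_of_injective hφ).trans ?_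
  refine (finrank_range_le_card _).trans ?_
  rw [Fintype.card_prod, Fintype.card_fun, Fintype.card_fin, Fintype.card_coe, Fintype.card_coe]
  rw [mul_right_comm]
  refine Nat.mul_le_mul_right _ ?_
  rw [← mul_pow]
  refine (Nat.pow_le_pow_right (Nat.succ_pos _) hScard).trans (Nat.pow_le_pow_left ?_ _)
  nlinarith

end Hilbert
end SiegelShidlovskii

namespace SiegelShidlovskii
open Polynomial NumberField

section EType
variable {K : Type*} [Field K] [NumberField K]

/-- The arithmetic growth conditions in the definition of `E`-functions, for the power series
`∑ (aₙ / n!) zⁿ`. -/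
structure IsETypeWith (C : ℕ) (F : PowerSeries K) : Prop where
  pos : 0 < C
  house_le : ∀ n, house (n.factorial * F.coeff n) ≤ (C : ℝ) ^ (n + 1)
  den : ∃ d : ℕ → ℕ, ∀ n, d n ≠ 0 ∧ d n ≤ C ^ (n + 1) ∧
    ∀ m ≤ n, IsIntegral ℤ ((d n : K) * (m.factorial * F.coeff m))

theorem IsETypeWith.mono {C D : ℕ} {F : PowerSeries K} (h : IsETypeWith C F) (hCD : C ≤ D) :
    IsETypeWith D F := by
  obtain ⟨d, hd⟩ := h.den
  refine ⟨h.pos.trans_le hCD, fun n => (h.house_le n).trans ?_, d, fun n => ⟨(hd n).1,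
    (hd n).2.1.trans (Nat.pow_le_pow_left hCD _), (hd n).2.2⟩⟩
  gcongr

theorem house_natCast_le (n : ℕ) : house (n : K) ≤ n := by
  have := house_intCast (K := K) (n : ℤ)
  simp only [Int.cast_natCast, Nat.abs_cast] at this
  exact this.le

theorem exists_natCast_mul_isIntegral (a : K) :
    ∃ d : ℕ, d ≠ 0 ∧ IsIntegral ℤ ((d : K) * a) := by
  obtain ⟨d, hd, h⟩ := ((IsFractionRing.isAlgebraic_iff ℤ ℚ K).2
    (Algebra.IsAlgebraic.isAlgebraic (R := ℚ) a)).exists_integral_multiple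
  refine ⟨d.natAbs, Int.natAbs_ne_zero.2 hd, ?_⟩
  rw [zsmul_eq_mul] at h
  rcases Int.natAbs_eq d with h' | h'
  · rw [h'] at h
    simpa using h
  · rw [h'] at h
    simpa using h.neg

theorem IsETypeWith.add {C D : ℕ} {F G : PowerSeries K} (hF : IsETypeWith C F)
    (hG : IsETypeWith D G) : IsETypeWith (C + D + C * D) (F + G) := by
  obtain ⟨d, hd⟩ := hF.den
  obtain ⟨e, he⟩ := hG.den
  have hC := hF.pos
  refine ⟨by omega, fun n => ?_, fun n => d n * e n, fun n => ⟨mul_ne_zero (hd n).1 (he n).1, ?_,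
    fun m hm => ?_⟩⟩
  · rw [map_add, mul_add]
    refine (house_add_le _ _).trans ((add_le_add (hF.house_le n) (hG.house_le n)).trans ?_)
    refine (pow_add_pow_le (by positivity) (by positivity) (Nat.succ_ne_zero n)).trans ?_
    push_cast
    exact pow_le_pow_left₀ (by positivity) (by nlinarith [Nat.cast_nonneg (α := ℝ) (C * D)]) _
  · refine (Nat.mul_le_mul (hd n).2.1 (he n).2.1).trans ?_
    rw [← mul_pow]
    exact Nat.pow_le_pow_left (by omega) _
  · rw [map_add, mul_add, mul_add]
    push_cast
    refine IsIntegral.add ?_ ?_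
    · rw [mul_comm (d n : K), mul_assoc]
      exact (isIntegral_natCast _).mul ((hd n).2.2 m hm)
    · rw [mul_assoc]
      exact (isIntegral_natCast _).mul ((he n).2.2 m hm)

theorem factorial_mul_coeff_mul (F G : PowerSeries K) (n : ℕ) :
    (n.factorial : K) * (F * G).coeff n = ∑ p ∈ Finset.HasAntidiagonal.antidiagonal n,
      (n.choose p.1 : K) * ((p.1.factorial * F.coeff p.1) * (p.2.factorial * G.coeff p.2)) := by
  rw [PowerSeries.coeff_mul, Finset.mul_sum]
  refine Finset.sum_congr rfl fun p hp => ?_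
  rw [Finset.HasAntidiagonal.mem_antidiagonal] at hp
  have h : (n.choose p.1 * p.1.factorial * p.2.factorial : K) = n.factorial := by
    rw [← hp]
    rw [Nat.choose_symm_add]
    exact_mod_cast Nat.add_choose_mul_factorial_mul_factorial p.1 p.2
  rw [← h]
  ring

theorem IsETypeWith.mul {C D : ℕ} {F G : PowerSeries K} (hF : IsETypeWith C F)
    (hG : IsETypeWith D G) : IsETypeWith (C + D + C * D) (F * G) := by
  obtain ⟨d, hd⟩ := hF.den
  obtain ⟨e, he⟩ := hG.den
  have hC := hF.pos
  refine ⟨by omega, fun n => ?_, fun n => d n * e n, fun n => ⟨mul_ne_zero (hd n).1 (he n).1, ?_,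
    fun m hm => ?_⟩⟩
  · rw [factorial_mul_coeff_mul]
    have h1 : ∀ p ∈ Finset.HasAntidiagonal.antidiagonal n, house ((n.choose p.1 : K) *
        ((p.1.factorial * F.coeff p.1) * (p.2.factorial * G.coeff p.2))) ≤
        (C * D : ℝ) * (n.choose p.1 * (C ^ p.1 * D ^ p.2)) := by
      intro p hp
      rw [house_nat_mul]
      calc _ ≤ (n.choose p.1 : ℝ) * ((C : ℝ) ^ (p.1 + 1) * (D : ℝ) ^ (p.2 + 1)) := by
            gcongr
            exact (house_mul_le _ _).trans (mul_le_mul (hF.house_le _) (hG.house_le _)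
              (house_nonneg _) (by positivity))
        _ = _ := by ring
    refine (house_sum_le_sum_house _ _).trans ((Finset.sum_le_sum h1).trans ?_)
    rw [← Finset.mul_sum]
    have h2 := (Commute.all (C : ℝ) (D : ℝ)).add_pow' n
    simp only [nsmul_eq_mul] at h2
    rw [← h2, pow_succ']
    push_cast
    have : (0 : ℝ) ≤ C * D := by positivity
    exact mul_le_mul (by linarith [Nat.cast_nonneg (α := ℝ) C, Nat.cast_nonneg (α := ℝ) D])
      (pow_le_pow_left₀ (by positivity) (by linarith) _) (by positivity) (by positivity)
  · refine (Nat.mul_le_mul (hd n).2.1 (he n).2.1).trans ?_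
    rw [← mul_pow]
    exact Nat.pow_le_pow_left (by omega) _
  · rw [factorial_mul_coeff_mul, Finset.mul_sum]
    refine IsIntegral.sum _ fun p hp => ?_
    rw [Finset.HasAntidiagonal.mem_antidiagonal] at hp
    have : ((d n * e n : ℕ) : K) * ((m.choose p.1 : K) *
        ((p.1.factorial * F.coeff p.1) * (p.2.factorial * G.coeff p.2))) = (m.choose p.1 : K) *
        ((d n * (p.1.factorial * F.coeff p.1)) * (e n * (p.2.factorial * G.coeff p.2))) := by
      push_cast; ring
    rw [this]
    exact (isIntegral_natCast _).mul (((hd n).2.2 _ (by omega)).mul ((he n).2.2 _ (by omega)))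

theorem exists_isETypeWith_coe (p : K[X]) : ∃ C, IsETypeWith C (p : PowerSeries K) := by
  induction p using Polynomial.induction_on' with
  | add p q hp hq =>
    obtain ⟨C, hp⟩ := hp
    obtain ⟨D, hq⟩ := hq
    rw [Polynomial.coe_add]
    exact ⟨_, hp.add hq⟩
  | monomial j a =>
    obtain ⟨d, hd0, hd⟩ := exists_natCast_mul_isIntegral (K := K) (j.factorial * a)
    let c := ⌈house ((j.factorial : K) * a)⌉₊
    have hcd : 1 ≤ d + c := by omega
    refine ⟨d + c, by omega, fun n => ?_, fun _ => d, fun n => ⟨hd0, ?_, fun m _ => ?_⟩⟩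
    · rw [Polynomial.coeff_coe, coeff_monomial]
      split_ifs with h
      · rw [← h]
        calc house ((j.factorial : K) * a) ≤ c := Nat.le_ceil _
          _ ≤ ((d + c : ℕ) : ℝ) := by push_cast; linarith [Nat.cast_nonneg (α := ℝ) d]
          _ ≤ _ := le_self_pow₀ (by exact_mod_cast hcd) (Nat.succ_ne_zero _)
      · rw [mul_zero]
        have : house (0 : K) = 0 := by simp [house]
        rw [this]
        positivity
    · exact (Nat.le_add_right d c).trans (Nat.le_self_pow (Nat.succ_ne_zero n) _)
    · rw [Polynomial.coeff_coe, coeff_monomial]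
      split_ifs with h
      · rw [← h]; exact hd
      · simp [isIntegral_zero]

/-- The algebra of power series satisfying the growth conditions of `E`-functions. -/
def eSubalgebra (K : Type*) [Field K] [NumberField K] : Subalgebra K[X] (PowerSeries K) where
  carrier := {F | ∃ C, IsETypeWith C F}
  mul_mem' := fun ⟨_, h⟩ ⟨_, h'⟩ => ⟨_, h.mul h'⟩
  add_mem' := fun ⟨_, h⟩ ⟨_, h'⟩ => ⟨_, h.add h'⟩
  algebraMap_mem' := fun p => by
    rw [PowerSeries.algebraMap_apply']
    simpa using exists_isETypeWith_coe p

theorem IsETypeWith.norm_coeff_le {C : ℕ} {F : PowerSeries K} (hF : IsETypeWith C F)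
    (φ : K →+* ℂ) (n : ℕ) : ‖φ (F.coeff n)‖ ≤ (C : ℝ) ^ (n + 1) / n.factorial := by
  rw [le_div_iff₀ (by positivity), mul_comm]
  have := (norm_embedding_le_house _ φ).trans (hF.house_le n)
  simpa using this

theorem IsETypeWith.summable {C : ℕ} {F : PowerSeries K} (hF : IsETypeWith C F)
    (φ : K →+* ℂ) (z : ℂ) : Summable fun n => ‖φ (F.coeff n) * z ^ n‖ := by
  refine Summable.of_nonneg_of_le (fun _ => norm_nonneg _) (fun n => ?_)
    ((Real.summable_pow_div_factorial (C * ‖z‖)).mul_left (C : ℝ))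
  rw [norm_mul, norm_pow]
  refine (mul_le_mul_of_nonneg_right (hF.norm_coeff_le φ n) (by positivity)).trans ?_
  apply le_of_eq
  rw [mul_pow]
  ring

/-- The value at `z` of the entire function given by the power series `F` embedded by `φ`. -/
def seriesEval (φ : K →+* ℂ) (z : ℂ) (F : PowerSeries K) : ℂ := ∑' n, φ (F.coeff n) * z ^ n

omit [NumberField K] in
theorem seriesEval_coe (φ : K →+* ℂ) (z : ℂ) (p : K[X]) :
    seriesEval φ z p = p.eval₂ φ z := by
  rw [seriesEval, eval₂_eq_sum_range, tsum_eq_sum (s := Finset.range (p.natDegree + 1))]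
  · simp
  · intro n hn
    rw [Finset.mem_range, not_lt] at hn
    rw [Polynomial.coeff_coe, coeff_eq_zero_of_natDegree_lt (by omega), map_zero, zero_mul]

theorem seriesEval_add (φ : K →+* ℂ) (z : ℂ) {F G : PowerSeries K} (hF : F ∈ eSubalgebra K)
    (hG : G ∈ eSubalgebra K) : seriesEval φ z (F + G) = seriesEval φ z F + seriesEval φ z G := by
  obtain ⟨C, hF⟩ := hF
  obtain ⟨D, hG⟩ := hG
  rw [seriesEval, seriesEval, seriesEval, ← Summable.tsum_add (hF.summable φ z).of_norm
    (hG.summable φ z).of_norm]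
  simp [add_mul]

theorem seriesEval_mul (φ : K →+* ℂ) (z : ℂ) {F G : PowerSeries K} (hF : F ∈ eSubalgebra K)
    (hG : G ∈ eSubalgebra K) : seriesEval φ z (F * G) = seriesEval φ z F * seriesEval φ z G := by
  obtain ⟨C, hF⟩ := hF
  obtain ⟨D, hG⟩ := hG
  rw [seriesEval, seriesEval, seriesEval,
    tsum_mul_tsum_eq_tsum_sum_antidiagonal_of_summable_norm (hF.summable φ z) (hG.summable φ z)]
  refine tsum_congr fun n => ?_
  rw [PowerSeries.coeff_mul, map_sum, Finset.sum_mul]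
  refine Finset.sum_congr rfl fun p hp => ?_
  rw [← Finset.HasAntidiagonal.mem_antidiagonal.1 hp, map_mul, pow_add]
  ring

/-- Evaluation at `z` as a ring homomorphism. -/
def evalHom (φ : K →+* ℂ) (z : ℂ) : eSubalgebra K →+* ℂ where
  toFun F := seriesEval φ z F
  map_one' := by
    have := seriesEval_coe φ z 1
    simpa using this
  map_mul' F G := seriesEval_mul φ z F.2 G.2
  map_zero' := by simp [seriesEval]
  map_add' F G := seriesEval_add φ z F.2 G.2

theorem evalHom_apply (φ : K →+* ℂ) (z : ℂ) (F : eSubalgebra K) :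
    evalHom φ z F = seriesEval φ z F := rfl

theorem evalHom_algebraMap (φ : K →+* ℂ) (z : ℂ) (p : K[X]) :
    evalHom φ z (algebraMap K[X] (eSubalgebra K) p) = p.eval₂ φ z := by
  rw [← seriesEval_coe, evalHom_apply, Subalgebra.coe_algebraMap, PowerSeries.algebraMap_apply']
  simp

theorem eq_of_hasSum_pow {a b : ℕ → ℂ} {f : ℂ → ℂ} (ha : ∀ z, HasSum (fun n => a n * z ^ n) (f z))
    (hb : ∀ z, HasSum (fun n => b n * z ^ n) (f z)) : a = b := by
  have key : ∀ c : ℕ → ℂ, (∀ z, HasSum (fun n => c n * z ^ n) (f z)) →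
      HasFPowerSeriesAt f (FormalMultilinearSeries.ofScalars ℂ c) 0 := by
    intro c hc
    rw [hasFPowerSeriesAt_iff]
    refine Filter.Eventually.of_forall fun z => ?_
    simpa [FormalMultilinearSeries.coeff_ofScalars, mul_comm] using hc z
  have h := (key a ha).eq_formalMultilinearSeries (key b hb)
  funext n
  simpa [FormalMultilinearSeries.coeff_ofScalars] using
    congrArg (fun p => FormalMultilinearSeries.coeff p n) h

end EType
end SiegelShidlovskii

namespace SiegelShidlovskii
open Polynomial NumberField

/-- Sequences of at most exponential growth. -/
def ExpBdd (u : ℕ → ℝ) : Prop := ∃ C : ℝ, 1 ≤ C ∧ ∀ t, 1 ≤ t → |u t| ≤ C ^ t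

namespace ExpBdd
variable {u v : ℕ → ℝ}

theorem const (a : ℝ) : ExpBdd fun _ => a := by
  refine ⟨|a| + 1, by linarith [abs_nonneg a], fun t ht => ?_⟩
  exact (by linarith : |a| ≤ |a| + 1).trans
    (le_self_pow₀ (by linarith [abs_nonneg a]) (by omega))

theorem mul (hu : ExpBdd u) (hv : ExpBdd v) : ExpBdd fun t => u t * v t := by
  obtain ⟨C, hC, h⟩ := hu
  obtain ⟨D, hD, h'⟩ := hv
  refine ⟨C * D, one_le_mul_of_one_le_of_one_le hC hD, fun t ht => ?_⟩
  rw [abs_mul, mul_pow]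
  exact mul_le_mul (h t ht) (h' t ht) (abs_nonneg _) (by positivity)

theorem add (hu : ExpBdd u) (hv : ExpBdd v) : ExpBdd fun t => u t + v t := by
  obtain ⟨C, hC, h⟩ := hu
  obtain ⟨D, hD, h'⟩ := hv
  refine ⟨C + D, by linarith, fun t ht => ?_⟩
  refine (abs_add_le _ _).trans ((add_le_add (h t ht) (h' t ht)).trans ?_)
  exact pow_add_pow_le (by linarith) (by linarith) (by omega)

theorem pow (hu : ExpBdd u) (k : ℕ) : ExpBdd fun t => u t ^ k := by
  induction k with
  | zero => simpa using const 1
  | succ k ih => simpa only [pow_succ] using ih.mul hu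

theorem natCast : ExpBdd fun t => (t : ℝ) := by
  refine ⟨2, by norm_num, fun t _ => ?_⟩
  rw [Nat.abs_cast]
  exact_mod_cast (Nat.lt_two_pow_self).le

theorem const_pow (a : ℝ) : ExpBdd fun t => a ^ t := by
  refine ⟨|a| + 1, by linarith [abs_nonneg a], fun t ht => ?_⟩
  rw [abs_pow]
  exact pow_le_pow_left₀ (abs_nonneg _) (by linarith) _

theorem const_pow_affine (a : ℝ) (k l : ℕ) : ExpBdd fun t => a ^ (k * t + l) := by
  simpa only [pow_add, pow_mul] using (const_pow (a ^ k)).mul (const (a ^ l))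

end ExpBdd

section Pade
variable {K : Type*} [Field K] [NumberField K]

theorem exists_small_kernel_vector (K : Type*) [Field K] [NumberField K] :
    ∃ c : ℝ, 0 ≤ c ∧ ∀ (p q : ℕ) (α β : Type) [Fintype α] [Fintype β]
      (a : Matrix α β (𝓞 K)) (A : ℝ) (s : ℕ), 0 < p → p < q → Fintype.card α = p →
      Fintype.card β = q → p ≤ s * (q - p) → 0 ≤ A → (∀ k l, house (a k l : K) ≤ A) →
      ∃ ξ : β → 𝓞 K, ξ ≠ 0 ∧ a.mulVec ξ = 0 ∧
        ∀ l, house (ξ l : K) ≤ (c + 1) * (c * q * A + 1) ^ s := by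
  classical
  obtain ⟨c, hc⟩ : ∃ c : ℝ, ∀ (p q : ℕ) (α β : Type) [Fintype α] [Fintype β]
      (a : Matrix α β (𝓞 K)) (A : ℝ), a ≠ 0 → 0 < p → p < q → Fintype.card α = p →
      Fintype.card β = q → (∀ k l, house (a k l : K) ≤ A) →
      ∃ ξ : β → 𝓞 K, ξ ≠ 0 ∧ a.mulVec ξ = 0 ∧
        ∀ l, house (ξ l : K) ≤ c * ((c * q * A) ^ ((p : ℝ) / (q - p))) :=
    ⟨_, fun p q α β _ _ a A ha h0p hpq hα hβ hA =>
      NumberField.house.exists_ne_zero_int_vec_house_le K a ha h0p hpq hβ hA hα⟩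
  refine ⟨|c|, abs_nonneg c, fun p q α β _ _ a A s h0p hpq hα hβ hs hA0 hA => ?_⟩
  by_cases ha : a = 0
  · have : Nonempty β := Fintype.card_pos_iff.1 (by omega)
    refine ⟨fun _ => 1, fun h => one_ne_zero (congrFun h (Classical.arbitrary β)), ?_, fun l => ?_⟩
    · rw [ha, Matrix.zero_mulVec]
    · have h1 : house ((1 : 𝓞 K) : K) ≤ 1 := by
        simpa using house_natCast_le (K := K) 1
      refine h1.trans (one_le_mul_of_one_le_of_one_le (by linarith [abs_nonneg c])
        (one_le_pow₀ ?_))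
      have : 0 ≤ |c| * q * A := by positivity
      linarith
  · obtain ⟨ξ, h1, h2, h3⟩ := hc p q α β a A ha h0p hpq hα hβ hA
    refine ⟨ξ, h1, h2, fun l => (h3 l).trans ((le_abs_self _).trans ?_)⟩
    rw [abs_mul]
    have h4 : (p : ℝ) / (q - p) ≤ s := by
      have : (p : ℝ) < q := by exact_mod_cast hpq
      rw [div_le_iff₀ (by linarith)]
      have h5 : ((q - p : ℕ) : ℝ) = q - p := Nat.cast_sub hpq.le
      rw [← h5]
      exact_mod_cast hs
    have h0 : 0 ≤ |c| * q * A := by positivity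
    have h40 : 0 ≤ (p : ℝ) / (q - p) := by
      have : (p : ℝ) < q := by exact_mod_cast hpq
      have : (0 : ℝ) ≤ q - p := by linarith
      positivity
    refine mul_le_mul (by linarith) ?_ (abs_nonneg _) (by positivity)
    refine (Real.abs_rpow_le_abs_rpow _ _).trans ?_
    rw [abs_mul, abs_mul, Nat.abs_cast, abs_of_nonneg hA0]
    calc _ ≤ (|c| * q * A + 1) ^ ((p : ℝ) / (q - p)) :=
          Real.rpow_le_rpow h0 (by linarith) h40
      _ ≤ (|c| * q * A + 1) ^ (s : ℝ) := Real.rpow_le_rpow_of_exponent_le (by linarith) h4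
      _ = _ := Real.rpow_natCast _ _

end Pade
end SiegelShidlovskii

namespace SiegelShidlovskii
open Polynomial NumberField

section Pade
variable {K : Type*} [Field K] [NumberField K] {m : ℕ}

theorem exists_uniform_bounds (g : Fin m → PowerSeries K) (hg : ∀ i, g i ∈ eSubalgebra K) :
    ∃ C : ℕ, 0 < C ∧ (∀ i n, house (n.factorial * (g i).coeff n) ≤ (C : ℝ) ^ (n + 1)) ∧
      ∃ d : ℕ → ℕ, ∀ n, d n ≠ 0 ∧ d n ≤ C ^ (n + 1) ∧
        ∀ i, ∀ l ≤ n, IsIntegral ℤ ((d n : K) * (l.factorial * (g i).coeff l)) := by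
  choose C hC using hg
  choose d hd using fun i => (hC i).den
  let D := ∏ i, C i
  have hD : ∀ i, C i ≤ D := fun i => Nat.le_of_dvd (Finset.prod_pos fun i _ => (hC i).pos)
    (Finset.dvd_prod_of_mem _ (Finset.mem_univ i))
  refine ⟨D, Finset.prod_pos fun i _ => (hC i).pos, fun i => ((hC i).mono (hD i)).house_le,
    fun n => ∏ i, d i n, fun n => ⟨Finset.prod_ne_zero_iff.2 fun i _ => (hd i n).1, ?_,
    fun i l hl => ?_⟩⟩
  · rw [← Finset.prod_pow]
    exact Finset.prod_le_prod' fun i _ => (hd i n).2.1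
  · dsimp only
    rw [← Finset.prod_erase_mul _ _ (Finset.mem_univ i)]
    push_cast
    rw [mul_assoc]
    refine IsIntegral.mul ?_ ((hd i n).2.2 l hl)
    exact_mod_cast isIntegral_natCast (R := ℤ) (B := K) (∏ j ∈ Finset.univ.erase i, d j n)

theorem factorial_mul_coeff_pair (P : Fin m → K[X]) (g : Fin m → PowerSeries K) (n : ℕ) :
    (n.factorial : K) * (pair Polynomial.coeToPowerSeries.ringHom P g).coeff n =
      ∑ i, ∑ j ∈ Finset.range (n + 1), (n.choose j : K) *
        ((j.factorial * (P i).coeff j) * ((n - j).factorial * (g i).coeff (n - j))) := by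
  rw [pair, map_sum, Finset.mul_sum]
  refine Finset.sum_congr rfl fun i _ => ?_
  rw [factorial_mul_coeff_mul, Finset.Nat.sum_antidiagonal_eq_sum_range_succ_mk]
  simp

/-- The polynomial `t! ∑ j ≤ t, ξ j z^j / j!`. -/
def factorialPoly (t : ℕ) (ξ : Fin (t + 1) → 𝓞 K) : K[X] :=
  ∑ j : Fin (t + 1), monomial j ((t.descFactorial (t - j) : K) * (ξ j : K))

theorem coeff_factorialPoly (t : ℕ) (ξ : Fin (t + 1) → 𝓞 K) (j : ℕ) :
    (factorialPoly t ξ).coeff j =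
      if h : j < t + 1 then (t.descFactorial (t - j) : K) * (ξ ⟨j, h⟩ : K) else 0 := by
  rw [factorialPoly, finsetSum_coeff]
  simp only [coeff_monomial]
  split_ifs with h
  · rw [Finset.sum_eq_single ⟨j, h⟩]
    · simp
    · intro b _ hb
      rw [if_neg]
      exact fun h' => hb (Fin.ext h')
    · simp
  · refine Finset.sum_eq_zero fun b _ => if_neg ?_
    have := b.2
    omega

theorem factorial_mul_coeff_factorialPoly (t : ℕ) (ξ : Fin (t + 1) → 𝓞 K) (j : ℕ) :
    (j.factorial : K) * (factorialPoly t ξ).coeff j =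
      (t.factorial : K) * if h : j < t + 1 then (ξ ⟨j, h⟩ : K) else 0 := by
  rw [coeff_factorialPoly]
  split_ifs with h
  · have h1 := Nat.factorial_mul_descFactorial (Nat.sub_le t j)
    rw [Nat.sub_sub_self (Nat.lt_succ_iff.1 h)] at h1
    rw [← mul_assoc, ← h1]
    push_cast
    rfl
  · simp

theorem exists_pade (g : Fin m → PowerSeries K) (hg : ∀ i, g i ∈ eSubalgebra K) (hm : 0 < m)
    (c : ℕ) (hc : 0 < c) :
    ∃ (H : ℕ → ℝ) (D : ℝ) (t₀ : ℕ), ExpBdd H ∧ 1 ≤ D ∧ ∀ t ≥ t₀, ∃ P : Fin m → K[X], P ≠ 0 ∧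
      (∀ i, (P i).natDegree ≤ t) ∧ (∀ i j, IsIntegral ℤ ((P i).coeff j)) ∧
      (∀ i j, house ((P i).coeff j) ≤ t.factorial * H t) ∧
      PowerSeries.X ^ ((m - 1) * t + c) ∣ pair Polynomial.coeToPowerSeries.ringHom P g ∧
      ∀ n : ℕ, house ((n.factorial : K) * (pair Polynomial.coeToPowerSeries.ringHom P g).coeff n) ≤
        t.factorial * H t * D ^ n := by
  obtain ⟨C, hC0, hCb, d, hd⟩ := exists_uniform_bounds g hg
  obtain ⟨s, hs0, hs⟩ := exists_small_kernel_vector K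
  let M : ℕ → ℕ := fun t => (m - 1) * t + c
  let A : ℕ → ℝ := fun t => (C : ℝ) ^ (M t + 1) * (2 ^ M t * (C : ℝ) ^ (M t + 1))
  let S : ℕ → ℝ := fun t => (s + 1) * (s * (m * (t + 1) : ℕ) * A t + 1) ^ (2 * m)
  have hA0 : ∀ t, 0 ≤ A t := fun t => by positivity
  have hS0 : ∀ t, 0 ≤ S t := fun t => by have := hA0 t; positivity
  have hSexp : ExpBdd S := by
    refine (ExpBdd.const (s + 1)).mul ((ExpBdd.add (((ExpBdd.const s).mul ?_).mul ?_)
      (ExpBdd.const 1)).pow (2 * m))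
    · push_cast
      exact (ExpBdd.const m).mul (ExpBdd.natCast.add (ExpBdd.const 1))
    · exact (ExpBdd.const_pow_affine C (m - 1) (c + 1)).mul
        ((ExpBdd.const_pow_affine 2 (m - 1) c).mul (ExpBdd.const_pow_affine C (m - 1) (c + 1)))
  have hC1 : (1 : ℝ) ≤ C := by exact_mod_cast hC0
  have hm1 : (1 : ℝ) ≤ m := by exact_mod_cast hm
  refine ⟨fun t => m * C * S t, C + 1, 2 * c, ((ExpBdd.const _).mul hSexp), by linarith,
    fun t ht => ?_⟩
  let a : Matrix (Fin (M t)) (Fin m × Fin (t + 1)) (𝓞 K) := fun n q =>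
    ⟨(n.1.choose q.2 : K) * ((d (M t) : K) *
      ((n.1 - q.2.1).factorial * (g q.1).coeff (n.1 - q.2.1))),
      (isIntegral_natCast _).mul ((hd _).2.2 _ _ (by have := n.2; omega))⟩
  have hMt : (m - 1) * t + t = m * t := by
    obtain ⟨k, rfl⟩ : ∃ k, m = k + 1 := ⟨m - 1, by omega⟩
    simp [add_mul]
  obtain ⟨ξ, hξ0, hξ, hξb⟩ := hs (M t) (m * (t + 1)) (Fin (M t)) (Fin m × Fin (t + 1)) a (A t)
    (2 * m) (Nat.add_pos_right _ hc) (by simp only [M, mul_add]; omega) (Fintype.card_fin _)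
    (by simp)
    (by
      have h1 : t ≤ 2 * (m * (t + 1) - M t) := by simp only [M, mul_add]; omega
      calc M t ≤ m * t := by simp only [M]; omega
        _ ≤ m * (2 * (m * (t + 1) - M t)) := Nat.mul_le_mul_left _ h1
        _ = _ := by ring) (hA0 t)
    (fun n q => by
      change house ((n.1.choose q.2 : K) * ((d (M t) : K) *
        ((n.1 - q.2.1).factorial * (g q.1).coeff (n.1 - q.2.1)))) ≤ A t
      rw [house_nat_mul, house_nat_mul]
      have h1 : (n.1.choose q.2 : ℝ) ≤ 2 ^ M t := by
        have h2 : (n.1.choose q.2 : ℝ) ≤ 2 ^ n.1 := by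
          exact_mod_cast (Nat.choose_le_two_pow _ _)
        exact h2.trans (pow_le_pow_right₀ (by norm_num) n.2.le)
      have h2 : (d (M t) : ℝ) ≤ (C : ℝ) ^ (M t + 1) := by exact_mod_cast (hd _).2.1
      have h3 := (hCb q.1 (n.1 - q.2.1)).trans (pow_le_pow_right₀ hC1
        (by have := n.2; omega : n.1 - q.2.1 + 1 ≤ M t + 1))
      calc _ ≤ (2 : ℝ) ^ M t * ((C : ℝ) ^ (M t + 1) * (C : ℝ) ^ (M t + 1)) := by
            gcongr
            · exact mul_nonneg (Nat.cast_nonneg _) (house_nonneg _)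
            · exact house_nonneg _
        _ = A t := by simp only [A]; ring)
  let P : Fin m → K[X] := fun i => factorialPoly t fun j => ξ (i, j)
  let Ξ : Fin m → ℕ → K := fun i j => if h : j < t + 1 then (ξ (i, ⟨j, h⟩) : K) else 0
  have hΞ : ∀ i j, house (Ξ i j) ≤ S t := by
    intro i j
    simp only [Ξ]
    split_ifs
    · exact hξb _
    · have : house (0 : K) = 0 := by simp [house]
      rw [this]
      exact hS0 t
  have hPc : ∀ i j, (j.factorial : K) * (P i).coeff j = t.factorial * Ξ i j := fun i j =>
    factorial_mul_coeff_factorialPoly t _ j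
  have hcoef : ∀ n : ℕ, (n.factorial : K) *
      (pair Polynomial.coeToPowerSeries.ringHom P g).coeff n = (t.factorial : K) *
      ∑ i, ∑ j ∈ Finset.range (n + 1), (n.choose j : K) *
        (Ξ i j * ((n - j).factorial * (g i).coeff (n - j))) := by
    intro n
    rw [factorial_mul_coeff_pair, Finset.mul_sum]
    refine Finset.sum_congr rfl fun i _ => ?_
    rw [Finset.mul_sum]
    refine Finset.sum_congr rfl fun j _ => ?_
    rw [hPc]
    ring
  refine ⟨P, fun h => hξ0 ?_, fun i => ?_, fun i j => ?_, fun i j => ?_, ?_, fun n => ?_⟩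
  · funext q
    have h1 := coeff_factorialPoly t (fun j => ξ (q.1, j)) q.2
    have h2 : factorialPoly t (fun j => ξ (q.1, j)) = 0 := congrFun h q.1
    rw [h2, dif_pos q.2.2, coeff_zero] at h1
    have h3 : (t.descFactorial (t - q.2) : K) ≠ 0 := by
      rw [Nat.cast_ne_zero, Ne, Nat.descFactorial_eq_zero_iff_lt]
      omega
    have := (mul_eq_zero.1 h1.symm).resolve_left h3
    exact RingOfIntegers.ext this
  · refine natDegree_le_iff_coeff_eq_zero.2 fun j hj => ?_
    simp only [P]
    rw [coeff_factorialPoly, dif_neg (by omega)]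
  · simp only [P]
    rw [coeff_factorialPoly]
    split_ifs
    · exact (isIntegral_natCast _).mul (ξ _).2
    · exact isIntegral_zero
  · have h1 := hPc i j
    have h2 : (j.factorial : ℝ) * house ((P i).coeff j) = t.factorial * house (Ξ i j) := by
      rw [← house_nat_mul, h1, house_nat_mul]
    have h3 : house ((P i).coeff j) ≤ j.factorial * house ((P i).coeff j) :=
      le_mul_of_one_le_left (house_nonneg _) (by exact_mod_cast Nat.factorial_pos j)
    refine h3.trans (h2.le.trans ?_)
    gcongr
    refine (hΞ i j).trans (le_mul_of_one_le_left (hS0 t) ?_)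
    exact one_le_mul_of_one_le_of_one_le hm1 hC1
  · rw [PowerSeries.X_pow_dvd_iff]
    intro n hn
    have h1 := congrFun hξ ⟨n, hn⟩
    have h2 : ∑ q : Fin m × Fin (t + 1), (n.choose q.2 : K) * ((d (M t) : K) *
        ((n - q.2.1).factorial * (g q.1).coeff (n - q.2.1))) * (ξ q : K) = 0 := by
      have := congrArg (algebraMap (𝓞 K) K) h1
      refine Eq.trans ?_ this
      simp only [Matrix.mulVec, dotProduct, map_sum, map_mul]
      rfl
    rw [Fintype.sum_prod_type] at h2
    have h3 : (d (M t) : K) * ∑ i, ∑ j ∈ Finset.range (n + 1), (n.choose j : K) *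
        (Ξ i j * ((n - j).factorial * (g i).coeff (n - j))) = 0 := by
      rw [← h2, Finset.mul_sum]
      refine Finset.sum_congr rfl fun i _ => ?_
      rw [Finset.sum_subset (Finset.range_mono (by omega : n + 1 ≤ n + t + 1)), Finset.mul_sum,
        ← Finset.sum_subset (Finset.range_mono (by omega : t + 1 ≤ n + t + 1)),
        ← Fin.sum_univ_eq_sum_range]
      · refine Finset.sum_congr rfl fun j _ => ?_
        simp only [Ξ]
        rw [dif_pos j.2]
        ring
      · intro j _ hj
        rw [Finset.mem_range] at hj
        simp only [Ξ]
        rw [dif_neg hj]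
        ring
      · intro j _ hj
        rw [Finset.mem_range] at hj
        rw [Nat.choose_eq_zero_of_lt (by omega)]
        simp
    have h4 := (mul_eq_zero.1 h3).resolve_left (Nat.cast_ne_zero.2 (hd _).1)
    have h5 := hcoef n
    rw [h4, mul_zero] at h5
    exact (mul_eq_zero.1 h5).resolve_left (Nat.cast_ne_zero.2 n.factorial_ne_zero)
  · rw [hcoef, house_nat_mul, mul_assoc]
    gcongr
    have h1 : ∀ i, ∑ j ∈ Finset.range (n + 1), house ((n.choose j : K) *
        (Ξ i j * ((n - j).factorial * (g i).coeff (n - j)))) ≤ C * S t * (C + 1 : ℝ) ^ n := by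
      intro i
      rw [add_comm (C : ℝ) 1, add_pow, Finset.mul_sum]
      refine Finset.sum_le_sum fun j _ => ?_
      rw [house_nat_mul]
      calc _ ≤ (n.choose j : ℝ) * (S t * (C : ℝ) ^ (n - j + 1)) := by
            gcongr
            exact (house_mul_le _ _).trans (mul_le_mul (hΞ i j) (hCb i _)
              (house_nonneg _) (hS0 t))
        _ = _ := by ring
    calc _ ≤ ∑ i : Fin m, C * S t * (C + 1 : ℝ) ^ n := by
          refine (house_sum_le_sum_house _ _).trans (Finset.sum_le_sum fun i _ => ?_)
          exact (house_sum_le_sum_house _ _).trans (h1 i)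
      _ = _ := by
          rw [Finset.sum_const, Finset.card_univ, Fintype.card_fin, nsmul_eq_mul]
          ring

end Pade
end SiegelShidlovskii

namespace SiegelShidlovskii
open Polynomial NumberField

section TwistBounds
variable {K : Type*} [Field K] [NumberField K] {m : ℕ}

theorem house_zero : house (0 : K) = 0 := by simp [house]

theorem house_coeff_mul_le {p r : K[X]} {q : ℕ} {b h : ℝ} (hp : p.natDegree ≤ q)
    (hpb : ∀ j, house (p.coeff j) ≤ b) (hr : ∀ j, house (r.coeff j) ≤ h) (n : ℕ) :
    house ((p * r).coeff n) ≤ (q + 1) * b * h := by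
  have hb : 0 ≤ b := (house_nonneg _).trans (hpb 0)
  have hh : 0 ≤ h := (house_nonneg _).trans (hr 0)
  rw [Polynomial.coeff_mul, Finset.Nat.sum_antidiagonal_eq_sum_range_succ_mk]
  refine (house_sum_le_sum_house _ _).trans ?_
  have h1 : ∑ j ∈ Finset.range (n + 1), house (p.coeff j * r.coeff (n - j)) ≤
      ∑ j ∈ Finset.range (n + 1), if j ∈ Finset.range (q + 1) then b * h else 0 := by
    refine Finset.sum_le_sum fun j _ => ?_
    split_ifs with hj
    · exact (house_mul_le _ _).trans (mul_le_mul (hpb _) (hr _) (house_nonneg _) hb)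
    · rw [Finset.mem_range] at hj
      rw [coeff_eq_zero_of_natDegree_lt (by omega), zero_mul, house_zero]
  refine h1.trans ?_
  rw [Finset.sum_ite_mem, Finset.sum_const, nsmul_eq_mul, mul_assoc]
  refine mul_le_mul_of_nonneg_right ?_ (by positivity)
  have := Finset.card_le_card (Finset.inter_subset_right (s₁ := Finset.range (n + 1))
    (s₂ := Finset.range (q + 1)))
  rw [Finset.card_range] at this
  exact_mod_cast this

theorem house_coeff_derivative_le {p : K[X]} {d : ℕ} {h : ℝ} (hp : p.natDegree ≤ d)
    (hpb : ∀ j, house (p.coeff j) ≤ h) (n : ℕ) : house ((derivative p).coeff n) ≤ d * h := by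
  have hh : 0 ≤ h := (house_nonneg _).trans (hpb 0)
  rw [coeff_derivative]
  by_cases hn : n + 1 ≤ d
  · rw [mul_comm, ← Nat.cast_succ, house_nat_mul]
    exact mul_le_mul (by exact_mod_cast hn) (hpb _) (house_nonneg _) (Nat.cast_nonneg _)
  · rw [coeff_eq_zero_of_natDegree_lt (by omega), zero_mul, house_zero]
    positivity

theorem house_coeff_twist_le {T : K[X]} {B : Matrix (Fin m) (Fin m) K[X]} {q d : ℕ} {b h : ℝ}
    (hT : T.natDegree ≤ q) (hB : ∀ i j, (B i j).natDegree ≤ q)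
    (hTb : ∀ n, house (T.coeff n) ≤ b) (hBb : ∀ i j n, house ((B i j).coeff n) ≤ b)
    {P : Fin m → K[X]} (hP : ∀ i, (P i).natDegree ≤ d) (hPb : ∀ i n, house ((P i).coeff n) ≤ h)
    (i : Fin m) (n : ℕ) : house ((twist T B P i).coeff n) ≤ ((q + 1) * b * (d + m)) * h := by
  rw [twist, coeff_add, finsetSum_coeff]
  have h1 := house_coeff_mul_le hT hTb (house_coeff_derivative_le (hP i) (hPb i)) n
  have h2 : house (∑ l, (P l * B l i).coeff n) ≤ ∑ _l : Fin m, (q + 1) * b * h := by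
    refine (house_sum_le_sum_house _ _).trans (Finset.sum_le_sum fun l _ => ?_)
    rw [mul_comm (P l)]
    exact house_coeff_mul_le (hB l i) (hBb l i) (hPb l) n
  rw [Finset.sum_const, Finset.card_univ, Fintype.card_fin, nsmul_eq_mul] at h2
  refine (house_add_le _ _).trans ((add_le_add h1 h2).trans (le_of_eq ?_))
  ring

theorem house_coeff_iterate_twist_le {T : K[X]} {B : Matrix (Fin m) (Fin m) K[X]} {q t n : ℕ}
    {b h : ℝ} (hT : T.natDegree ≤ q) (hB : ∀ i j, (B i j).natDegree ≤ q)
    (hTb : ∀ n, house (T.coeff n) ≤ b) (hBb : ∀ i j n, house ((B i j).coeff n) ≤ b)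
    {P : Fin m → K[X]} (hP : ∀ i, (P i).natDegree ≤ t) (hPb : ∀ i n, house ((P i).coeff n) ≤ h)
    (k : ℕ) (hk : k ≤ n) (i : Fin m) (j : ℕ) : house (((twist T B)^[k] P i).coeff j) ≤
      ((q + 1) * b * (t + n * q + m)) ^ k * h := by
  induction k generalizing i j with
  | zero => simpa using hPb i j
  | succ k ih =>
    rw [Function.iterate_succ_apply']
    have h1 := house_coeff_twist_le (d := t + n * q) hT hB hTb hBb
      (P := (twist T B)^[k] P) (fun i => (natDegree_iterate_twist_le hT hB hP k i).trans
        (Nat.add_le_add_left (Nat.mul_le_mul_right _ (by omega)) _)) (ih (by omega)) i j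
    refine h1.trans (le_of_eq ?_)
    push_cast
    ring

omit [NumberField K] in
theorem isIntegral_coeff_iterate_twist {T : K[X]} {B : Matrix (Fin m) (Fin m) K[X]}
    (hT : ∀ n, IsIntegral ℤ (T.coeff n)) (hB : ∀ i j n, IsIntegral ℤ ((B i j).coeff n))
    {P : Fin m → K[X]} (hP : ∀ i n, IsIntegral ℤ ((P i).coeff n)) (k : ℕ) (i : Fin m) (n : ℕ) :
    IsIntegral ℤ (((twist T B)^[k] P i).coeff n) := by
  induction k generalizing i n with
  | zero => exact hP i n
  | succ k ih =>
    have hmul : ∀ p r : K[X], (∀ n, IsIntegral ℤ (p.coeff n)) → (∀ n, IsIntegral ℤ (r.coeff n)) →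
        ∀ n, IsIntegral ℤ ((p * r).coeff n) := fun p r hp hr n => by
      rw [Polynomial.coeff_mul]
      exact IsIntegral.sum _ fun x _ => (hp _).mul (hr _)
    rw [Function.iterate_succ_apply', twist, coeff_add, finsetSum_coeff]
    refine IsIntegral.add (hmul _ _ hT (fun n => ?_) n)
      (IsIntegral.sum _ fun l _ => hmul _ _ (ih l) (hB l i) n)
    rw [coeff_derivative]
    exact (ih i _).mul ((isIntegral_natCast n).add isIntegral_one)

theorem house_eval_le {p : K[X]} {d : ℕ} {h : ℝ} (hp : p.natDegree ≤ d)
    (hpb : ∀ j, house (p.coeff j) ≤ h) (a : K) :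
    house (p.eval a) ≤ (d + 1) * h * (house a + 1) ^ d := by
  have hh : 0 ≤ h := (house_nonneg _).trans (hpb 0)
  have ha := house_nonneg a
  rw [eval_eq_sum_range' (Nat.lt_succ_of_le hp)]
  refine (house_sum_le_sum_house _ _).trans ?_
  have h1 : ∀ j ∈ Finset.range (d + 1), house (p.coeff j * a ^ j) ≤ h * (house a + 1) ^ d := by
    intro j hj
    refine (house_mul_le _ _).trans (mul_le_mul (hpb j) ?_ (house_nonneg _) hh)
    refine (house_pow_le _ _).trans
      ((pow_le_pow_left₀ ha (le_add_of_nonneg_right zero_le_one) _).trans ?_)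
    exact pow_le_pow_right₀ (by linarith) (by have := Finset.mem_range.1 hj; omega)
  refine (Finset.sum_le_sum h1).trans (le_of_eq ?_)
  rw [Finset.sum_const, Finset.card_range, nsmul_eq_mul]
  push_cast
  ring

omit [NumberField K] in
theorem isIntegral_pow_mul_eval {p : K[X]} {d : ℕ} (hp : p.natDegree ≤ d)
    (hpi : ∀ j, IsIntegral ℤ (p.coeff j)) {a : K} {D : ℕ} (ha : IsIntegral ℤ ((D : K) * a)) :
    IsIntegral ℤ ((D : K) ^ d * p.eval a) := by
  rw [eval_eq_sum_range' (Nat.lt_succ_of_le hp), Finset.mul_sum]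
  refine IsIntegral.sum _ fun j hj => ?_
  have hj := Finset.mem_range.1 hj
  have : (D : K) ^ d * (p.coeff j * a ^ j) = D ^ (d - j) * (p.coeff j * (D * a) ^ j) := by
    rw [← Nat.sub_add_cancel (by omega : j ≤ d), pow_add, Nat.add_sub_cancel, mul_pow]
    ring
  rw [this]
  exact ((isIntegral_natCast D).pow _).mul ((hpi j).mul (ha.pow j))

end TwistBounds

section WeightedNorm
variable {K : Type*} [Field K] (φ : K →+* ℂ)
open scoped ENNReal NNReal

/-- The weighted `ℓ¹` norm of the coefficients of a power series. -/
def wnorm (ρ : ℝ≥0) (H : PowerSeries K) : ℝ≥0∞ := ∑' n, ‖φ (H.coeff n)‖ₑ * (ρ : ℝ≥0∞) ^ n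

theorem wnorm_mono {ρ σ : ℝ≥0} (h : ρ ≤ σ) (H : PowerSeries K) : wnorm φ ρ H ≤ wnorm φ σ H :=
  ENNReal.tsum_le_tsum fun n => by gcongr

theorem wnorm_mul_le (ρ : ℝ≥0) (F G : PowerSeries K) :
    wnorm φ ρ (F * G) ≤ wnorm φ ρ F * wnorm φ ρ G := by
  rw [wnorm, wnorm, wnorm, ← ENNReal.tsum_mul_right]
  simp_rw [← ENNReal.tsum_mul_left]
  rw [← ENNReal.tsum_prod (f := fun i j => ‖φ (F.coeff i)‖ₑ * (ρ : ℝ≥0∞) ^ i *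
      (‖φ (G.coeff j)‖ₑ * (ρ : ℝ≥0∞) ^ j)),
      ← (Finset.HasAntidiagonal.sigmaAntidiagonalEquivProd (A := ℕ)).tsum_eq,
    ENNReal.tsum_sigma']
  refine ENNReal.tsum_le_tsum fun n => ?_
  rw [tsum_fintype, PowerSeries.coeff_mul, map_sum]
  simp only [Finset.HasAntidiagonal.sigmaAntidiagonalEquivProd_apply]
  rw [Finset.sum_coe_sort
    (Finset.HasAntidiagonal.antidiagonal n) (fun p : ℕ × ℕ => ‖φ (F.coeff p.1)‖ₑ *
      (ρ : ℝ≥0∞) ^ p.1 * (‖φ (G.coeff p.2)‖ₑ * (ρ : ℝ≥0∞) ^ p.2))]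
  refine (mul_le_mul_left (enorm_sum_le _ _) _).trans ?_
  rw [Finset.sum_mul]
  refine Finset.sum_le_sum fun p hp => ?_
  rw [map_mul, enorm_mul, ← Finset.HasAntidiagonal.mem_antidiagonal.1 hp, pow_add]
  apply le_of_eq
  ring

theorem mul_wnorm_derivative_le (ρ ε : ℝ≥0) (H : PowerSeries K) :
    ε * wnorm φ ρ (PowerSeries.derivative K H) ≤ wnorm φ (ρ + ε) H := by
  have key : ∀ n : ℕ, ε * ((n + 1) * ρ ^ n) ≤ (ρ + ε) ^ (n + 1) := by
    intro n
    induction n with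
    | zero => simp
    | succ n ih =>
      calc ε * (((n + 1 : ℕ) + 1) * ρ ^ (n + 1)) =
            ε * ((n + 1) * ρ ^ n) * ρ + ρ ^ (n + 1) * ε := by push_cast; ring
        _ ≤ (ρ + ε) ^ (n + 1) * ρ + (ρ + ε) ^ (n + 1) * ε := by
            gcongr
            exact le_self_add
        _ = _ := by ring
  rw [wnorm, wnorm, ← ENNReal.tsum_mul_left]
  refine le_trans ?_ (ENNReal.tsum_comp_le_tsum_of_injective Nat.succ_injective _)
  refine ENNReal.tsum_le_tsum fun n => ?_
  have h1 : ‖((n : ℂ) + 1)‖ₑ = ((n + 1 : ℝ≥0) : ℝ≥0∞) := by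
    rw [← Nat.cast_succ, ← Nat.cast_succ, enorm_eq_nnnorm]
    congr 1
    ext
    rw [coe_nnnorm, Complex.norm_natCast, NNReal.coe_natCast]
  rw [PowerSeries.coeff_derivative, map_mul, enorm_mul, map_add, map_natCast, map_one, h1]
  calc _ = ‖φ (H.coeff (n + 1))‖ₑ * ((ε * ((n + 1) * ρ ^ n) : ℝ≥0) : ℝ≥0∞) := by push_cast; ring
    _ ≤ ‖φ (H.coeff (n + 1))‖ₑ * (((ρ + ε) ^ (n + 1) : ℝ≥0) : ℝ≥0∞) := by
        gcongr
        exact key n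
    _ = _ := by push_cast; rfl

theorem pow_mul_wnorm_iterate_theta_le (t : PowerSeries K) (ρ σ ε : ℝ≥0) (k : ℕ)
    (h : ρ + k * ε ≤ σ) (H : PowerSeries K) :
    (ε : ℝ≥0∞) ^ k * wnorm φ ρ ((theta t)^[k] H) ≤ wnorm φ σ t ^ k * wnorm φ σ H := by
  induction k generalizing ρ with
  | zero => simpa using wnorm_mono φ (by simpa using h) H
  | succ k ih =>
    rw [Function.iterate_succ_apply', theta]
    have h0 : ρ ≤ σ := le_self_add.trans h
    have h1 : ρ + ε + k * ε ≤ σ := by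
      refine le_trans (le_of_eq ?_) h
      push_cast
      ring
    calc _ ≤ (ε : ℝ≥0∞) ^ (k + 1) * (wnorm φ ρ t *
          wnorm φ ρ (PowerSeries.derivative K ((theta t)^[k] H))) := by
          gcongr
          exact wnorm_mul_le φ ρ _ _
      _ = wnorm φ ρ t * (ε ^ k * (ε * wnorm φ ρ (PowerSeries.derivative K ((theta t)^[k] H)))) := by
          ring
      _ ≤ wnorm φ σ t * (ε ^ k * wnorm φ (ρ + ε) ((theta t)^[k] H)) := by
          gcongr
          · exact wnorm_mono φ h0 t
          · exact mul_wnorm_derivative_le φ ρ ε _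
      _ ≤ wnorm φ σ t * (wnorm φ σ t ^ k * wnorm φ σ H) := by
          exact mul_le_mul' le_rfl (ih _ h1)
      _ = _ := by ring

theorem enorm_seriesEval_le (z : ℂ) (H : PowerSeries K) :
    ‖seriesEval φ z H‖ₑ ≤ wnorm φ ‖z‖₊ H := by
  refine enorm_tsum_le_tsum_enorm.trans (le_of_eq ?_)
  refine tsum_congr fun n => ?_
  rw [enorm_mul, enorm_pow, enorm_eq_nnnorm z]

theorem wnorm_coe_ne_top (ρ : ℝ≥0) (p : K[X]) : wnorm φ ρ (p : PowerSeries K) ≠ ⊤ := by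
  rw [wnorm, tsum_eq_sum (s := Finset.range (p.natDegree + 1))]
  · exact ENNReal.sum_ne_top.2 fun n _ => ENNReal.mul_ne_top enorm_ne_top
      (ENNReal.pow_ne_top ENNReal.coe_ne_top)
  · intro n hn
    rw [Finset.mem_range, not_lt] at hn
    rw [Polynomial.coeff_coe, coeff_eq_zero_of_natDegree_lt (by omega), map_zero, enorm_zero,
      zero_mul]

theorem wnorm_le_of_X_pow_dvd (ρ : ℝ≥0) {H : PowerSeries K} {M : ℕ} {A D : ℝ} (hA : 0 ≤ A)
    (hD : 0 ≤ D) (hM : PowerSeries.X ^ M ∣ H)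
    (h : ∀ n, ‖φ (H.coeff n)‖ ≤ A * D ^ n / n.factorial) :
    wnorm φ ρ H ≤ ENNReal.ofReal (A * (D * ρ) ^ M / M.factorial * Real.exp (D * ρ)) := by
  rw [PowerSeries.X_pow_dvd_iff] at hM
  have hDρ : 0 ≤ D * ρ := by positivity
  have h0 : wnorm φ ρ H = ∑' l, ‖φ (H.coeff (l + M))‖ₑ * (ρ : ℝ≥0∞) ^ (l + M) := by
    rw [wnorm, ← ENNReal.summable.sum_add_tsum_nat_add' (k := M), Finset.sum_eq_zero, zero_add]
    intro n hn
    rw [hM n (Finset.mem_range.1 hn), map_zero, enorm_zero, zero_mul]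
  have hs := (Real.summable_pow_div_factorial (D * ρ)).mul_left (A * (D * ρ) ^ M / M.factorial)
  have h1 : A * (D * ρ) ^ M / M.factorial * Real.exp (D * ρ) =
      ∑' l : ℕ, A * (D * ρ) ^ M / M.factorial * ((D * ρ) ^ l / l.factorial) := by
    rw [tsum_mul_left, Real.exp_eq_exp_ℝ, NormedSpace.exp_eq_tsum_div]
  rw [h0, h1, ENNReal.ofReal_tsum_of_nonneg (fun l => by positivity) hs]
  refine ENNReal.tsum_le_tsum fun l => ?_
  have h2 : ‖φ (H.coeff (l + M))‖ₑ * (ρ : ℝ≥0∞) ^ (l + M) =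
      ENNReal.ofReal (‖φ (H.coeff (l + M))‖ * (ρ : ℝ) ^ (l + M)) := by
    rw [ENNReal.ofReal_mul (norm_nonneg _), ofReal_norm, ENNReal.ofReal_pow (by positivity),
      ENNReal.ofReal_coe_nnreal]
  rw [h2]
  refine ENNReal.ofReal_le_ofReal ?_
  have h3 : (M.factorial * l.factorial : ℝ) ≤ (l + M).factorial := by
    have := Nat.le_of_dvd (Nat.factorial_pos _) (Nat.factorial_mul_factorial_dvd_factorial_add M l)
    rw [add_comm M l] at this
    exact_mod_cast this
  calc _ ≤ A * D ^ (l + M) / (l + M).factorial * (ρ : ℝ) ^ (l + M) := by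
        gcongr
        exact h _
    _ = A * (D * ρ) ^ (l + M) / (l + M).factorial := by rw [mul_pow]; ring
    _ ≤ A * (D * ρ) ^ (l + M) / (M.factorial * l.factorial) := by gcongr
    _ = _ := by
        rw [pow_add]
        field_simp

end WeightedNorm
end SiegelShidlovskii

namespace SiegelShidlovskii
open Polynomial NumberField

section Approximation
variable {K : Type*} [Field K] [NumberField K] {m : ℕ}

theorem seriesEval_pair (φ : K →+* ℂ) (a : K) (P : Fin m → K[X]) {g : Fin m → PowerSeries K}
    (hg : ∀ i, g i ∈ eSubalgebra K) :
    seriesEval φ (φ a) (pair Polynomial.coeToPowerSeries.ringHom P g) =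
      ∑ i, φ ((P i).eval a) * seriesEval φ (φ a) (g i) := by
  have h : pair Polynomial.coeToPowerSeries.ringHom P g =
      ((∑ i, algebraMap K[X] (eSubalgebra K) (P i) * ⟨g i, hg i⟩ : eSubalgebra K) :
        PowerSeries K) := by
    rw [AddSubmonoidClass.coe_finsetSum]
    refine Finset.sum_congr rfl fun i _ => ?_
    rw [Subalgebra.coe_mul, Subalgebra.coe_algebraMap, PowerSeries.algebraMap_apply']
    simp
  rw [h, ← evalHom_apply, map_sum]
  refine Finset.sum_congr rfl fun i _ => ?_
  rw [map_mul, evalHom_algebraMap, evalHom_apply, eval₂_at_apply]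

theorem house_eval_iterate_twist_le {T : K[X]} {B : Matrix (Fin m) (Fin m) K[X]} {q t c D : ℕ}
    {b h : ℝ} (hT : T.natDegree ≤ q) (hB : ∀ i j, (B i j).natDegree ≤ q) (hb : 1 ≤ b)
    (hTb : ∀ n, house (T.coeff n) ≤ b) (hBb : ∀ i j n, house ((B i j).coeff n) ≤ b)
    (ht : 1 ≤ t) {P : Fin m → K[X]} (hP : ∀ i, (P i).natDegree ≤ t)
    (hPb : ∀ i n, house ((P i).coeff n) ≤ h) (a : K) (k : ℕ) (hk : k ≤ t + c) (i : Fin m) :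
    house ((D : K) ^ (t + (t + c) * q) * ((twist T B)^[k] P i).eval a) ≤
      (D : ℝ) ^ (t + (t + c) * q) * ((((t + (t + c) * q : ℕ) : ℝ) + 1) *
        (((q + 1) * b * (1 + (1 + c) * q + m) * t) ^ (t + c) * h) *
          (house a + 1) ^ (t + (t + c) * q)) := by
  have hh : 0 ≤ h := (house_nonneg _).trans (hPb i 0)
  have ht' : (1 : ℝ) ≤ t := by exact_mod_cast ht
  rw [← Nat.cast_pow, house_nat_mul, Nat.cast_pow]
  refine mul_le_mul_of_nonneg_left ?_ (by positivity)
  refine house_eval_le ((natDegree_iterate_twist_le hT hB hP k i).trans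
    (Nat.add_le_add_left (Nat.mul_le_mul_right _ hk) _)) (fun j => ?_) a
  refine (house_coeff_iterate_twist_le hT hB hTb hBb hP hPb k hk i j).trans ?_
  refine mul_le_mul_of_nonneg_right ?_ hh
  have hq : (0 : ℝ) ≤ q := Nat.cast_nonneg _
  have hc : (0 : ℝ) ≤ c := Nat.cast_nonneg _
  have hm : (0 : ℝ) ≤ m := Nat.cast_nonneg _
  have h1 : (1 : ℝ) ≤ (q + 1) * b * (t + (t + c : ℕ) * q + m) := by
    refine one_le_mul_of_one_le_of_one_le (one_le_mul_of_one_le_of_one_le (by linarith) hb) ?_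
    have : (0 : ℝ) ≤ (t + c : ℕ) * q := by positivity
    linarith
  have h2 : (q + 1) * b * (t + (t + c : ℕ) * q + m) ≤
      (q + 1) * b * (1 + (1 + c) * q + m) * t := by
    rw [mul_assoc ((q + 1) * b)]
    refine mul_le_mul_of_nonneg_left ?_ (by positivity)
    push_cast
    nlinarith [mul_nonneg (mul_nonneg hc hq) (sub_nonneg.2 ht'), mul_nonneg hm (sub_nonneg.2 ht')]
  exact (pow_le_pow_right₀ h1 hk).trans (pow_le_pow_left₀ (by linarith) h2 _)

open scoped NNReal ENNReal in
theorem norm_sum_eval_iterate_twist_le {T : K[X]} {B : Matrix (Fin m) (Fin m) K[X]}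
    {g : Fin m → PowerSeries K} (hg : ∀ i, g i ∈ eSubalgebra K)
    (hsys : ∀ i, (T : PowerSeries K) * PowerSeries.derivative K (g i) =
      ∑ j, (B i j : PowerSeries K) * g j) (φ : K →+* ℂ) (a : K) :
    ∃ w : ℝ, 1 ≤ w ∧ ∀ (n M : ℕ) (A D : ℝ) (P : Fin m → K[X]), 0 < n → 0 ≤ A → 0 ≤ D →
      PowerSeries.X ^ M ∣ pair Polynomial.coeToPowerSeries.ringHom P g →
      (∀ l : ℕ, ‖φ ((pair Polynomial.coeToPowerSeries.ringHom P g).coeff l)‖ ≤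
        A * D ^ l / l.factorial) →
      ∀ k ≤ n, ‖∑ i, φ (((twist T B)^[k] P i).eval a) * seriesEval φ (φ a) (g i)‖ ≤
        (n * w) ^ n * (A * (D * (‖φ a‖ + 1)) ^ M / M.factorial * Real.exp (D * (‖φ a‖ + 1))) := by
  let σ : ℝ≥0 := ‖φ a‖₊ + 1
  have hσ : (σ : ℝ) = ‖φ a‖ + 1 := rfl
  refine ⟨(wnorm φ σ T).toReal + 1, by linarith [ENNReal.toReal_nonneg (a := wnorm φ σ T)],
    fun n M A D P hn hA hD hM h k hk => ?_⟩
  have hw : 0 ≤ (wnorm φ σ T).toReal := ENNReal.toReal_nonneg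
  let w : ℝ := (wnorm φ σ T).toReal + 1
  rw [← seriesEval_pair φ a _ hg, pair_iterate_twist _ coe_derivative_eq T B g hsys]
  let E : ℝ := A * (D * σ) ^ M / M.factorial * Real.exp (D * σ)
  have hE : 0 ≤ E := by positivity
  have h1 := wnorm_le_of_X_pow_dvd φ σ hA hD hM h
  have hn0 : (n : ℝ≥0) ≠ 0 := by exact_mod_cast hn.ne'
  have h2 := pow_mul_wnorm_iterate_theta_le φ (Polynomial.coeToPowerSeries.ringHom T) ‖φ a‖₊ σ
    (n : ℝ≥0)⁻¹ k (by
      refine add_le_add le_rfl ?_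
      rw [← div_eq_mul_inv]
      exact div_le_one_of_le₀ (by exact_mod_cast hk) zero_le)
    (pair Polynomial.coeToPowerSeries.ringHom P g)
  have h3 : wnorm φ σ (Polynomial.coeToPowerSeries.ringHom T) ≤ ENNReal.ofReal w :=
    (ENNReal.le_ofReal_iff_toReal_le (wnorm_coe_ne_top φ σ T) (by positivity)).2
      (by simp only [w]; exact (lt_add_one _).le)
  have h4 : ENNReal.ofReal (((n : ℝ)⁻¹) ^ k * ‖seriesEval φ (φ a) ((theta
      (Polynomial.coeToPowerSeries.ringHom T))^[k]
        (pair Polynomial.coeToPowerSeries.ringHom P g))‖) ≤ ENNReal.ofReal (w ^ k * E) := by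
    rw [ENNReal.ofReal_mul (by positivity), ENNReal.ofReal_mul (by positivity), ofReal_norm,
      ENNReal.ofReal_pow (by positivity), ENNReal.ofReal_pow (by positivity)]
    have h5 : ENNReal.ofReal (n : ℝ)⁻¹ = (((n : ℝ≥0)⁻¹ : ℝ≥0) : ℝ≥0∞) := by
      rw [ENNReal.ofReal, Real.toNNReal_inv, Real.toNNReal_natCast]
    rw [h5]
    calc _ ≤ _ := mul_le_mul' le_rfl (enorm_seriesEval_le φ _ _)
      _ ≤ _ := h2
      _ ≤ _ := mul_le_mul' (pow_le_pow_left' h3 k) h1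
  rw [ENNReal.ofReal_le_ofReal_iff (by positivity)] at h4
  have hn' : (1 : ℝ) ≤ n := by exact_mod_cast hn
  have h6 : ‖seriesEval φ (φ a) ((theta (Polynomial.coeToPowerSeries.ringHom T))^[k]
        (pair Polynomial.coeToPowerSeries.ringHom P g))‖ ≤ (n * w) ^ k * E := by
    rw [inv_pow, inv_mul_le_iff₀ (by positivity), ← mul_assoc, ← mul_pow] at h4
    exact h4
  refine h6.trans (mul_le_mul_of_nonneg_right (pow_le_pow_right₀ ?_ hk) hE)
  exact one_le_mul_of_one_le_of_one_le hn' (by simp only [w]; linarith)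

/-- Many approximations at `a`, with integral coefficients of controlled size. -/
theorem exists_approximations {T : K[X]} {B : Matrix (Fin m) (Fin m) K[X]}
    {g : Fin m → PowerSeries K} (hTi : ∀ n, IsIntegral ℤ (T.coeff n))
    (hBi : ∀ i j n, IsIntegral ℤ ((B i j).coeff n)) (hg : ∀ i, g i ∈ eSubalgebra K)
    (hsys : ∀ i, (T : PowerSeries K) * PowerSeries.derivative K (g i) =
      ∑ j, (B i j : PowerSeries K) * g j)
    (hlin : ∀ P, pair Polynomial.coeToPowerSeries.ringHom P g = 0 → P = 0) (hm : 0 < m)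
    (φ : K →+* ℂ) (a : K) (ha0 : a ≠ 0) (ha : T.eval a ≠ 0) :
    ∃ (H : ℕ → ℝ) (c t₀ : ℕ), ExpBdd H ∧ ∀ t ≥ t₀, ∃ x : Matrix (Fin (t + c + 1)) (Fin m) K,
      (∀ k i, IsIntegral ℤ (x k i) ∧ house (x k i) ≤ H t * (t : ℝ) ^ (2 * t)) ∧
      (∀ k, ‖∑ i, φ (x k i) * seriesEval φ (φ a) (g i)‖ * (t : ℝ) ^ ((m - 1) * t) ≤
        H t * (t : ℝ) ^ (2 * t)) ∧
      ∀ e, x.mulVec e = 0 → e = 0 := by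
  classical
  obtain ⟨q, hTq, hBq⟩ : ∃ q, T.natDegree ≤ q ∧ ∀ i j, (B i j).natDegree ≤ q :=
    ⟨T.natDegree + ∑ i, ∑ j, (B i j).natDegree, Nat.le_add_right _ _, fun i j =>
      ((Finset.single_le_sum (f := fun j => (B i j).natDegree) (fun _ _ => Nat.zero_le _)
        (Finset.mem_univ j)).trans (Finset.single_le_sum (f := fun i => ∑ j, (B i j).natDegree)
          (fun _ _ => Nat.zero_le _) (Finset.mem_univ i))).trans (Nat.le_add_left _ _)⟩
  have hpoly : ∀ p : K[X], ∃ b : ℝ, 0 ≤ b ∧ ∀ n, house (p.coeff n) ≤ b := fun p => by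
    refine ⟨∑ n ∈ p.support, house (p.coeff n), Finset.sum_nonneg fun _ _ => house_nonneg _,
      fun n => ?_⟩
    by_cases hn : n ∈ p.support
    · exact Finset.single_le_sum (f := fun n => house (p.coeff n)) (fun _ _ => house_nonneg _) hn
    · rw [notMem_support_iff.1 hn, house_zero]
      exact Finset.sum_nonneg fun _ _ => house_nonneg _
  choose β hβ0 hβ using hpoly
  obtain ⟨b, hb, hTb, hBb⟩ : ∃ b : ℝ, 1 ≤ b ∧ (∀ n, house (T.coeff n) ≤ b) ∧
      ∀ i j n, house ((B i j).coeff n) ≤ b := by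
    have hs : 0 ≤ ∑ i, ∑ j, β (B i j) := Finset.sum_nonneg fun _ _ =>
      Finset.sum_nonneg fun _ _ => hβ0 _
    refine ⟨1 + β T + ∑ i, ∑ j, β (B i j), by linarith [hβ0 T], fun n => by
      linarith [hβ T n], fun i j n => ?_⟩
    have h1 := Finset.single_le_sum (f := fun j => β (B i j)) (fun _ _ => hβ0 _)
      (Finset.mem_univ j)
    have h2 := Finset.single_le_sum (f := fun i => ∑ j, β (B i j))
      (fun _ _ => Finset.sum_nonneg fun _ _ => hβ0 _) (Finset.mem_univ i)
    linarith [hβ (B i j) n, hβ0 T]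
  obtain ⟨c₀, hc₀⟩ := exists_sum_eval_ne_zero hsys hlin a ha0 ha
  obtain ⟨H₀, D₀, t₀, hH₀, hD₀, hpade⟩ := exists_pade g hg hm (c₀ + 1) (Nat.succ_pos _)
  obtain ⟨w, hw, hnorm⟩ := norm_sum_eval_iterate_twist_le hg hsys φ a
  obtain ⟨D, hD0, hDa⟩ := exists_natCast_mul_isIntegral a
  set c := c₀ + 1 with hc
  let d : ℕ → ℕ := fun t => t + (t + c) * q
  let C₁ : ℝ := (q + 1) * b * (1 + (1 + c) * q + m)
  let σ : ℝ := ‖φ a‖ + 1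
  let H₁ : ℕ → ℝ := fun t => (D : ℝ) ^ d t * (((d t : ℝ) + 1) *
    (C₁ ^ (t + c) * (t : ℝ) ^ c * H₀ t) * (house a + 1) ^ d t)
  let H₂ : ℕ → ℝ := fun t => (D : ℝ) ^ d t * (((1 + c) * w) ^ (t + c) * (t : ℝ) ^ c * H₀ t *
    ((D₀ * σ) ^ ((m - 1) * t + c) * Real.exp (D₀ * σ) * Real.exp 1 ^ t))
  have hdpow : ∀ u : ℝ, ExpBdd fun t => u ^ d t := fun u => by
    have h := ExpBdd.const_pow_affine u (1 + q) (c * q)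
    have hd : d = fun t => (1 + q) * t + c * q := by
      funext t
      simp only [d]
      ring
    rwa [hd]
  have hdlin : ExpBdd fun t => (d t : ℝ) + 1 := by
    have hd : (fun t => (d t : ℝ) + 1) = fun t : ℕ => (1 + q : ℝ) * t + (c * q + 1) := by
      funext t
      simp only [d]
      push_cast
      ring
    rw [hd]
    exact ((ExpBdd.const _).mul ExpBdd.natCast).add (ExpBdd.const _)
  have hcpow : ∀ u : ℝ, ExpBdd fun t => u ^ (t + c) := fun u => by
    simpa using ExpBdd.const_pow_affine u 1 c
  have hH₁ : ExpBdd H₁ := (hdpow _).mul ((hdlin.mul (((hcpow _).mul (ExpBdd.natCast.pow c)).mul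
    hH₀)).mul (hdpow _))
  have hH₂ : ExpBdd H₂ := (hdpow _).mul ((((hcpow _).mul (ExpBdd.natCast.pow c)).mul hH₀).mul
    (((ExpBdd.const_pow_affine _ _ _).mul (ExpBdd.const _)).mul (ExpBdd.const_pow _)))
  refine ⟨fun t => H₁ t + H₂ t, c, max t₀ 1, hH₁.add hH₂, fun t ht => ?_⟩
  have ht1 : 1 ≤ t := (le_max_right _ _).trans ht
  have ht1' : (1 : ℝ) ≤ t := by exact_mod_cast ht1
  obtain ⟨P, hP0, hPd, hPi, hPh, hPX, hPc⟩ := hpade t ((le_max_left _ _).trans ht)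
  have hfac : (0 : ℝ) < t.factorial := by positivity
  have hH0 : 0 ≤ H₀ t := by
    have := (house_nonneg _).trans (hPh ⟨0, hm⟩ 0)
    exact nonneg_of_mul_nonneg_right this hfac
  have hha := house_nonneg a
  have hC₁ : 0 ≤ C₁ := by positivity
  have hσ : 0 ≤ σ := by positivity
  have h₁ : 0 ≤ H₁ t := by positivity
  have h₂ : 0 ≤ H₂ t := by positivity
  have hfacle : (t.factorial : ℝ) ≤ (t : ℝ) ^ t := by exact_mod_cast Nat.factorial_le_pow t
  refine ⟨fun k i => (D : K) ^ d t * ((twist T B)^[k] P i).eval a, fun k i => ⟨?_, ?_⟩,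
    fun k => ?_, fun e he => ?_⟩
  · exact isIntegral_pow_mul_eval ((natDegree_iterate_twist_le hTq hBq hPd k i).trans
      (Nat.add_le_add_left (Nat.mul_le_mul_right _ (Nat.lt_succ_iff.1 k.2)) _))
      (isIntegral_coeff_iterate_twist hTi hBi hPi k i) hDa
  · refine (house_eval_iterate_twist_le hTq hBq hb hTb hBb ht1 hPd hPh a k
      (Nat.lt_succ_iff.1 k.2) i).trans ?_
    calc _ ≤ (D : ℝ) ^ d t * (((d t : ℝ) + 1) * ((C₁ * t) ^ (t + c) * ((t : ℝ) ^ t * H₀ t)) *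
          (house a + 1) ^ d t) := by
          simp only [d]
          gcongr
      _ = H₁ t * (t : ℝ) ^ (2 * t) := by
          simp only [H₁]
          rw [mul_pow, pow_add (t : ℝ) t c, two_mul, pow_add (t : ℝ) t t]
          ring
      _ ≤ _ := mul_le_mul_of_nonneg_right (by linarith) (by positivity)
  · have hR : ∀ l : ℕ, ‖φ ((pair Polynomial.coeToPowerSeries.ringHom P g).coeff l)‖ ≤
        t.factorial * H₀ t * D₀ ^ l / l.factorial := fun l => by
      rw [le_div_iff₀ (by positivity), mul_comm]
      have := (norm_embedding_le_house _ φ).trans (hPc l)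
      rwa [map_mul, norm_mul, map_natCast, Complex.norm_natCast] at this
    have hk := hnorm (t + c) ((m - 1) * t + c) _ D₀ P (by omega)
      (mul_nonneg hfac.le hH0) (by linarith) hPX hR k (Nat.lt_succ_iff.1 k.2)
    have hsum : ∑ i, φ ((D : K) ^ d t * ((twist T B)^[k] P i).eval a) *
        seriesEval φ (φ a) (g i) = (D : ℂ) ^ d t * ∑ i, φ (((twist T B)^[k] P i).eval a) *
          seriesEval φ (φ a) (g i) := by
      rw [Finset.mul_sum]
      refine Finset.sum_congr rfl fun i _ => ?_
      rw [map_mul, map_pow, map_natCast, mul_assoc]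
    rw [hsum, norm_mul, norm_pow, Complex.norm_natCast]
    have hexp : (t : ℝ) ^ ((m - 1) * t) / ((m - 1) * t + c).factorial ≤ Real.exp 1 ^ t := by
      rw [← Real.exp_nat_mul, mul_one]
      refine le_trans ?_ (Real.pow_div_factorial_le_exp (t : ℝ) (by positivity) ((m - 1) * t + c))
      gcongr
      omega
    have htc : ((t + c : ℕ) : ℝ) ≤ (1 + c) * t := by
      push_cast
      nlinarith [mul_nonneg (Nat.cast_nonneg (α := ℝ) c) (sub_nonneg.2 ht1')]
    calc _ ≤ (D : ℝ) ^ d t * (((t + c : ℕ) * w) ^ (t + c) * (t.factorial * H₀ t *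
          (D₀ * σ) ^ ((m - 1) * t + c) / ((m - 1) * t + c).factorial *
            Real.exp (D₀ * σ))) * (t : ℝ) ^ ((m - 1) * t) := by
          gcongr
      _ = (D : ℝ) ^ d t * (((t + c : ℕ) * w) ^ (t + c) * (t.factorial * H₀ t *
          (D₀ * σ) ^ ((m - 1) * t + c) * Real.exp (D₀ * σ))) *
            ((t : ℝ) ^ ((m - 1) * t) / ((m - 1) * t + c).factorial) := by ring
      _ ≤ (D : ℝ) ^ d t * (((1 + c) * t * w) ^ (t + c) * ((t : ℝ) ^ t * H₀ t *
          (D₀ * σ) ^ ((m - 1) * t + c) * Real.exp (D₀ * σ))) * Real.exp 1 ^ t := by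
          gcongr
      _ = H₂ t * (t : ℝ) ^ (2 * t) := by
          simp only [H₂]
          rw [mul_right_comm (1 + c : ℝ), mul_pow ((1 + c : ℝ) * w), pow_add (t : ℝ) t c, two_mul,
            pow_add (t : ℝ) t t]
          ring
      _ ≤ _ := mul_le_mul_of_nonneg_right (by linarith) (by positivity)
  · by_contra he0
    obtain ⟨k, hk, hne⟩ := hc₀ t P hP0 hPd ((pow_dvd_pow _ (by omega)).trans hPX) e he0
    have := congrFun he ⟨k, by omega⟩
    simp only [Matrix.mulVec, dotProduct, mul_assoc, ← Finset.mul_sum, Pi.zero_apply] at this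
    exact hne ((mul_eq_zero.1 this).resolve_left (pow_ne_zero _ (Nat.cast_ne_zero.2 hD0)))

end Approximation
end SiegelShidlovskii

namespace SiegelShidlovskii
open Polynomial NumberField

section Determinant
variable {K : Type*} [Field K] [NumberField K] {m : ℕ}

omit [NumberField K] in
theorem norm_embedding_det_le (φ : K →+* ℂ) {r : ℕ} {A : Matrix (Fin r) (Fin r) K} {X : ℝ}
    (h : ∀ i j, ‖φ (A i j)‖ ≤ X) : ‖φ A.det‖ ≤ r.factorial * X ^ r := by
  have := Matrix.det_le (abv := ((NormedField.toAbsoluteValue ℂ).comp φ.injective)) h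
  rwa [Fintype.card_fin, nsmul_eq_mul] at this

theorem house_det_le {r : ℕ} {A : Matrix (Fin r) (Fin r) K} {X : ℝ}
    (h : ∀ i j, house (A i j) ≤ X) : house A.det ≤ r.factorial * X ^ r := by
  have h1 : ∀ σ : K →+* ℂ, ‖σ A.det‖ ≤ r.factorial * X ^ r := fun σ =>
    norm_embedding_det_le σ fun i j => (norm_embedding_le_house _ σ).trans (h i j)
  rw [house_eq_sup']
  obtain ⟨σ, -, hσ⟩ := Finset.exists_mem_eq_sup' (Finset.univ_nonempty (α := K →+* ℂ))
    (fun σ => ‖σ A.det‖₊)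
  rw [hσ]
  exact h1 σ

theorem one_le_norm_mul_house_pow (φ : K →+* ℂ) {a : K} (ha : IsIntegral ℤ a) (ha0 : a ≠ 0) :
    1 ≤ ‖φ a‖ * house a ^ (Module.finrank ℚ K - 1) := by
  refine le_trans ?_ (norm_norm_le_norm_mul_house_pow a φ)
  obtain ⟨n, hn⟩ := IsIntegrallyClosed.isIntegral_iff.1 (Algebra.isIntegral_norm ℚ ha)
  have hn0 : n ≠ 0 := by
    rintro rfl
    rw [map_zero, eq_comm, Algebra.norm_eq_zero_iff] at hn
    exact ha0 hn
  rw [← hn, eq_intCast, ← Rat.norm_cast_real, Rat.cast_intCast, Real.norm_eq_abs]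
  exact_mod_cast Int.one_le_abs hn0

theorem norm_le_of_det_ne_zero (φ : K →+* ℂ) {r : ℕ} {A : Matrix (Fin r) (Fin r) K}
    (hA : A.det ≠ 0) (hAi : ∀ i j, IsIntegral ℤ (A i j)) {X δ : ℝ} (hX : 1 ≤ X)
    (hAX : ∀ i j, house (A i j) ≤ X) (ω : Fin r → ℂ)
    (hδ : ∀ k, ‖∑ j, φ (A k j) * ω j‖ ≤ δ) (j : Fin r) :
    ‖ω j‖ ≤ r * (r.factorial * X ^ r * δ) *
      (r.factorial * X ^ r) ^ (Module.finrank ℚ K - 1) := by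
  have h1 := one_le_norm_mul_house_pow φ (IsIntegral.det hAi) hA
  have hδ0 : 0 ≤ δ := (norm_nonneg _).trans (hδ j)
  have h2 : φ A.det * ω j = ∑ k, φ (A.adjugate j k) * ∑ l, φ (A k l) * ω l := by
    have h3 := congrFun (congrArg (fun M : Matrix (Fin r) (Fin r) ℂ => M.mulVec ω)
      (Matrix.adjugate_mul (A.map φ))) j
    simp only [← Matrix.mulVec_mulVec, Matrix.smul_mulVec, Matrix.one_mulVec, Pi.smul_apply,
      smul_eq_mul] at h3
    rw [RingHom.map_det, RingHom.mapMatrix_apply, ← h3, Matrix.mulVec, dotProduct]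
    refine Finset.sum_congr rfl fun k _ => ?_
    rw [← RingHom.mapMatrix_apply, ← RingHom.map_adjugate]
    rfl
  have h4 : ∀ k, ‖φ (A.adjugate j k)‖ ≤ r.factorial * X ^ r := fun k => by
    rw [Matrix.adjugate_apply]
    refine norm_embedding_det_le φ fun i l => ?_
    rw [Matrix.updateRow_apply]
    split_ifs with hi
    · rw [Pi.single_apply]
      split_ifs <;> simp <;> linarith
    · exact (norm_embedding_le_house _ φ).trans (hAX _ _)
  have h5 : ‖φ A.det‖ * ‖ω j‖ ≤ r * (r.factorial * X ^ r * δ) := by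
    rw [← norm_mul, h2]
    refine (norm_sum_le _ _).trans ?_
    refine (Finset.sum_le_card_nsmul _ _ (r.factorial * X ^ r * δ) fun k _ => ?_).trans ?_
    · rw [norm_mul]
      exact mul_le_mul (h4 k) (hδ k) (norm_nonneg _) (by positivity)
    · rw [Finset.card_univ, Fintype.card_fin, nsmul_eq_mul]
  calc ‖ω j‖ ≤ ‖φ A.det‖ * house A.det ^ (Module.finrank ℚ K - 1) * ‖ω j‖ :=
        le_mul_of_one_le_left (norm_nonneg _) h1
    _ = ‖φ A.det‖ * ‖ω j‖ * house A.det ^ (Module.finrank ℚ K - 1) := by ring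
    _ ≤ _ := by
        have := house_nonneg A.det
        have := house_det_le hAX
        gcongr

theorem le_of_approximations (φ : K →+* ℂ) {r : ℕ} {y : Fin m → ℂ} (hy : y ≠ 0)
    {γ : Matrix (Fin m) (Fin r) K} (hγ : ∀ v, γ.mulVec v = 0 → v = 0)
    (hγi : ∀ i j, IsIntegral ℤ (γ i j)) {ω : Fin r → ℂ} (hω : ∀ i, y i = ∑ j, φ (γ i j) * ω j)
    {H : ℕ → ℝ} {c t₀ : ℕ} (hH : ExpBdd H)
    (h : ∀ t ≥ t₀, ∃ x : Matrix (Fin (t + c + 1)) (Fin m) K,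
      (∀ k i, IsIntegral ℤ (x k i) ∧ house (x k i) ≤ H t * (t : ℝ) ^ (2 * t)) ∧
      (∀ k, ‖∑ i, φ (x k i) * y i‖ * (t : ℝ) ^ ((m - 1) * t) ≤ H t * (t : ℝ) ^ (2 * t)) ∧
      ∀ e, x.mulVec e = 0 → e = 0) :
    m ≤ 2 * (r + 1 + r * (Module.finrank ℚ K - 1)) + 1 := by
  set d := Module.finrank ℚ K
  obtain ⟨j, hj⟩ : ∃ j, ω j ≠ 0 := by
    by_contra! h0
    exact hy (funext fun i => by rw [hω]; simp [h0])
  have hG0 : 0 ≤ ∑ i, ∑ j, house (γ i j) :=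
    Finset.sum_nonneg fun _ _ => Finset.sum_nonneg fun _ _ => house_nonneg _
  set G := ∑ i, ∑ j, house (γ i j)
  have hG : ∀ i j, house (γ i j) ≤ G := fun i j =>
    (Finset.single_le_sum (f := fun j => house (γ i j)) (fun _ _ => house_nonneg _)
      (Finset.mem_univ j)).trans (Finset.single_le_sum (f := fun i => ∑ j, house (γ i j))
        (fun _ _ => Finset.sum_nonneg fun _ _ => house_nonneg _) (Finset.mem_univ i))
  let H' : ℕ → ℝ := fun t => 1 + (m * G + 1) * |H t|
  have hH' : ExpBdd H' := (ExpBdd.const 1).add ((ExpBdd.const _).mul (by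
    obtain ⟨C, hC, hCH⟩ := hH
    exact ⟨C, hC, fun t ht => by simpa using hCH t ht⟩))
  set s := r + 1 + r * (d - 1) with hs
  obtain ⟨E, hE, hEb⟩ := (ExpBdd.const (r * r.factorial * (r.factorial : ℝ) ^ (d - 1) /
    ‖ω j‖)).mul (hH'.pow s)
  by_contra! hm
  obtain ⟨N, hN⟩ := exists_nat_gt E
  let t := max (max t₀ 1) N
  have ht0 : t₀ ≤ t := (le_max_left _ _).trans (le_max_left _ _)
  have ht1 : 1 ≤ t := (le_max_right _ _).trans (le_max_left _ _)
  have htE : E < t := hN.trans_le (by exact_mod_cast le_max_right _ _)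
  have ht1' : (1 : ℝ) ≤ t := by exact_mod_cast ht1
  obtain ⟨x, hx, hxy, hxk⟩ := h t ht0
  let X : ℝ := H' t * (t : ℝ) ^ (2 * t)
  have hpow : (1 : ℝ) ≤ (t : ℝ) ^ (2 * t) := one_le_pow₀ ht1'
  have hmG : 0 ≤ (m : ℝ) * G := by positivity
  have habs := abs_nonneg (H t)
  have hH1 : 1 ≤ H' t := by
    simp only [H']
    nlinarith [mul_nonneg hmG habs]
  have hX : 1 ≤ X := one_le_mul_of_one_le_of_one_le hH1 hpow
  have hHX : H t * (t : ℝ) ^ (2 * t) ≤ X := by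
    refine mul_le_mul_of_nonneg_right ?_ (by positivity)
    simp only [H']
    nlinarith [mul_nonneg hmG habs, le_abs_self (H t)]
  have hYX : ∀ k j, house ((x * γ) k j) ≤ X := fun k j => by
    rw [Matrix.mul_apply]
    refine (house_sum_le_sum_house _ _).trans ((Finset.sum_le_card_nsmul _ _
      (|H t| * (t : ℝ) ^ (2 * t) * G) fun i _ => ?_).trans ?_)
    · refine (house_mul_le _ _).trans (mul_le_mul ((hx k i).2.trans ?_) (hG i j)
        (house_nonneg _) (by positivity))
      exact mul_le_mul_of_nonneg_right (le_abs_self _) (by positivity)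
    · rw [Finset.card_univ, Fintype.card_fin, nsmul_eq_mul]
      calc _ = (m * G * |H t|) * (t : ℝ) ^ (2 * t) := by ring
        _ ≤ _ := mul_le_mul_of_nonneg_right (by simp only [H']; linarith) (by positivity)
  obtain ⟨J, hJ⟩ := exists_submatrix_det_ne_zero (x * γ) fun v hv => hγ v (hxk _ (by
    rw [Matrix.mulVec_mulVec, hv]))
  have hpos : (0 : ℝ) < (t : ℝ) ^ ((m - 1) * t) := by positivity
  have key := norm_le_of_det_ne_zero φ hJ (fun i j => by
    rw [Matrix.submatrix_apply, Matrix.mul_apply]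
    exact IsIntegral.sum _ fun l _ => (hx _ l).1.mul (hγi l _)) hX (fun i j => hYX _ _) ω
    (δ := X / (t : ℝ) ^ ((m - 1) * t)) (fun k => by
      rw [le_div_iff₀ hpos]
      refine le_trans (le_of_eq ?_) ((hxy (J k)).trans hHX)
      congr 2
      simp only [hω, Finset.mul_sum, Matrix.submatrix_apply, Matrix.mul_apply, id_eq, map_sum,
        map_mul, Finset.sum_mul]
      rw [Finset.sum_comm]
      simp only [mul_assoc]) j
  have hωj : 0 < ‖ω j‖ := norm_pos_iff.2 hj
  have h2 : (t : ℝ) ^ ((m - 1) * t) ≤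
      (r * r.factorial * (r.factorial : ℝ) ^ (d - 1) / ‖ω j‖) * X ^ s := by
    have h3 : ∀ u v : ℝ, (r : ℝ) * (r.factorial * u ^ r * (u / v)) *
        (r.factorial * u ^ r) ^ (d - 1) =
        r * r.factorial * (r.factorial : ℝ) ^ (d - 1) * u ^ s / v := fun u v => by
      rw [hs, pow_add, pow_succ, pow_mul, mul_pow]
      ring
    rw [h3, le_div_iff₀ hpos] at key
    rw [div_mul_eq_mul_div, le_div_iff₀ hωj, mul_comm]
    exact key
  have h4 : (t : ℝ) ^ ((m - 1) * t) ≤ E ^ t * (t : ℝ) ^ (2 * t * s) := by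
    refine h2.trans ?_
    unfold X
    rw [mul_pow, ← mul_assoc, ← pow_mul]
    exact mul_le_mul_of_nonneg_right ((le_abs_self _).trans (hEb t ht1)) (by positivity)
  have h5 : (t : ℝ) ^ (t + 2 * t * s) ≤ (t : ℝ) ^ ((m - 1) * t) := by
    refine pow_le_pow_right₀ ht1' ?_
    have : 2 * s + 1 ≤ m - 1 := by omega
    calc t + 2 * t * s = (2 * s + 1) * t := by ring
      _ ≤ _ := Nat.mul_le_mul_right _ this
  have h6 : (t : ℝ) ^ t ≤ E ^ t := by
    have := h5.trans h4
    rw [pow_add] at this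
    exact le_of_mul_le_mul_right this (by positivity)
  exact absurd h6 (not_le.2 (pow_lt_pow_left₀ htE (by linarith) (by omega)))

end Determinant
end SiegelShidlovskii

namespace SiegelShidlovskii
open Polynomial NumberField

section LinearIndependence
variable {K : Type*} [Field K] [NumberField K] {m : ℕ}

theorem exists_natCast_mul_isIntegral_family {ι : Type*} (s : Finset ι) (u : ι → K) :
    ∃ D : ℕ, D ≠ 0 ∧ ∀ i ∈ s, IsIntegral ℤ ((D : K) * u i) := by
  choose d hd0 hd using fun i => exists_natCast_mul_isIntegral (u i)
  refine ⟨∏ i ∈ s, d i, Finset.prod_ne_zero_iff.2 fun i _ => hd0 i, fun i hi => ?_⟩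
  obtain ⟨e, he⟩ := Finset.dvd_prod_of_mem d hi
  rw [he, mul_comm (d i), Nat.cast_mul, mul_assoc]
  exact (isIntegral_natCast (R := ℤ) (B := K) e).mul (hd i)

theorem exists_natCast_mul_coeff_isIntegral {ι : Type*} [Fintype ι] (p : ι → K[X]) :
    ∃ D : ℕ, D ≠ 0 ∧ ∀ i n, IsIntegral ℤ ((D : K) * (p i).coeff n) := by
  classical
  obtain ⟨D, hD0, hD⟩ := exists_natCast_mul_isIntegral_family
    (Finset.univ.sigma fun i => (p i).support) (fun x : Σ _ : ι, ℕ => (p x.1).coeff x.2)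
  refine ⟨D, hD0, fun i n => ?_⟩
  by_cases hn : n ∈ (p i).support
  · exact hD ⟨i, n⟩ (Finset.mem_sigma.2 ⟨Finset.mem_univ _, hn⟩)
  · rw [notMem_support_iff.1 hn, mul_zero]
    exact isIntegral_zero

/-- A family of complex numbers factors through a basis of its `K`-span. -/
theorem exists_factorization_span [Algebra K ℂ] (y : Fin m → ℂ) :
    ∃ (γ : Matrix (Fin m) (Fin (Module.finrank K (Submodule.span K (Set.range y)))) K)
      (ω : Fin (Module.finrank K (Submodule.span K (Set.range y))) → ℂ),
      (∀ v, γ.mulVec v = 0 → v = 0) ∧ (∀ i j, IsIntegral ℤ (γ i j)) ∧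
        ∀ i, y i = ∑ j, algebraMap K ℂ (γ i j) * ω j := by
  let V := Submodule.span K (Set.range y)
  have : Module.Finite K V := Module.Finite.span_of_finite K (Set.finite_range y)
  let b := Module.finBasis K V
  let y' : Fin m → V := fun i => ⟨y i, Submodule.subset_span ⟨i, rfl⟩⟩
  obtain ⟨D, hD0, hD⟩ := exists_natCast_mul_isIntegral_family Finset.univ
    (fun x : Fin m × Fin (Module.finrank K V) => b.repr (y' x.1) x.2)
  have hD0' : (D : K) ≠ 0 := Nat.cast_ne_zero.2 hD0
  have hD0'' : (D : ℂ) ≠ 0 := Nat.cast_ne_zero.2 hD0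
  refine ⟨fun i j => D * b.repr (y' i) j, fun j => (D : ℂ)⁻¹ * b j, fun v hv => ?_,
    fun i j => hD (i, j) (Finset.mem_univ _), fun i => ?_⟩
  · let f : V →ₗ[K] K := b.constr K v
    have hf : f = 0 := by
      have htop : Submodule.span K (Set.range y') = ⊤ := by
        refine Submodule.map_injective_of_injective V.injective_subtype ?_
        rw [Submodule.map_span, Submodule.map_subtype_top, ← Set.range_comp]
        rfl
      refine LinearMap.ext_on_range htop fun i => ?_
      have := congrFun hv i
      simp only [Matrix.mulVec, dotProduct, mul_assoc, ← Finset.mul_sum, Pi.zero_apply] at this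
      have h0 := (mul_eq_zero.1 this).resolve_left hD0'
      rw [Module.Basis.constr_apply_fintype, LinearMap.zero_apply, ← h0]
      rfl
    funext j
    have := LinearMap.congr_fun hf (b j)
    rwa [Module.Basis.constr_basis] at this
  · have h := congrArg (Subtype.val) (b.sum_repr (y' i))
    simp only [AddSubmonoidClass.coe_finsetSum, Submodule.coe_smul] at h
    rw [show y i = (y' i : ℂ) from rfl, ← h]
    refine Finset.sum_congr rfl fun j _ => ?_
    rw [Algebra.smul_def, map_mul, map_natCast]
    field_simp

/-- Linearly independent E-functions take values spanning a space of comparable dimension. -/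
theorem le_finrank_span_seriesEval [Algebra K ℂ] {T : K[X]} {B : Matrix (Fin m) (Fin m) K[X]}
    {g : Fin m → PowerSeries K} (hg : ∀ i, g i ∈ eSubalgebra K)
    (hsys : ∀ i, (T : PowerSeries K) * PowerSeries.derivative K (g i) =
      ∑ j, (B i j : PowerSeries K) * g j)
    (hlin : ∀ P, pair Polynomial.coeToPowerSeries.ringHom P g = 0 → P = 0)
    (a : K) (ha0 : a ≠ 0) (ha : T.eval a ≠ 0)
    (hy : (fun i => seriesEval (algebraMap K ℂ) (algebraMap K ℂ a) (g i)) ≠ 0) :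
    m ≤ 3 * Module.finrank ℚ K * (Module.finrank K (Submodule.span K (Set.range fun i =>
      seriesEval (algebraMap K ℂ) (algebraMap K ℂ a) (g i))) + 1) := by
  have hm : 0 < m := by
    rcases Nat.eq_zero_or_pos m with rfl | hm
    · exact absurd (Subsingleton.elim _ _) hy
    · exact hm
  obtain ⟨D, hD0, hD⟩ := exists_natCast_mul_coeff_isIntegral
    (fun x : Option (Fin m × Fin m) => x.elim T fun x => B x.1 x.2)
  have hD0' : (D : K) ≠ 0 := Nat.cast_ne_zero.2 hD0
  obtain ⟨H, c, t₀, hH, h⟩ := exists_approximations (T := C (D : K) * T)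
    (B := fun i j => C (D : K) * B i j) (fun n => by rw [coeff_C_mul]; exact hD none n)
    (fun i j n => by rw [coeff_C_mul]; exact hD (some (i, j)) n) hg
    (fun i => by
      simp only [Polynomial.coe_mul, mul_assoc, hsys i, Finset.mul_sum]) hlin hm
    (algebraMap K ℂ) a ha0 (by
      rw [eval_mul, eval_C]
      exact mul_ne_zero hD0' ha)
  obtain ⟨γ, ω, hγ, hγi, hω⟩ := exists_factorization_span (K := K)
    (fun i => seriesEval (algebraMap K ℂ) (algebraMap K ℂ a) (g i))
  refine (le_of_approximations (algebraMap K ℂ) hy hγ hγi hω hH h).trans ?_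
  generalize Module.finrank K (Submodule.span K (Set.range fun i =>
      seriesEval (algebraMap K ℂ) (algebraMap K ℂ a) (g i))) = r
  obtain ⟨e, he⟩ := Nat.exists_eq_succ_of_ne_zero (Module.finrank_pos (R := ℚ) (M := K)).ne'
  rw [he, Nat.succ_sub_one]
  nlinarith [Nat.zero_le (r * e)]

end LinearIndependence
end SiegelShidlovskii

namespace SiegelShidlovskii
open Polynomial NumberField

section PowerForms

theorem linForms_pow_induction {A E ι : Type*} [CommRing A] [CommRing E] [Algebra A E] (x : ι → E)
    {C : ℕ → E → Prop} (hone : ∀ N, C N 1) (hx : ∀ i, C 1 (x i))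
    (hadd : ∀ N u v, C N u → C N v → C N (u + v)) (hsmul : ∀ N (c : A) u, C N u → C N (c • u))
    (hmul : ∀ N, ∀ u ∈ linForms A x Set.univ ^ N, ∀ v ∈ linForms A x Set.univ,
      C N u → C 1 v → C (N + 1) (u * v))
    {N : ℕ} {u : E} (hu : u ∈ linForms A x Set.univ ^ N) : C N u := by
  have h1 : ∀ v ∈ linForms A x Set.univ, C 1 v := by
    intro v hv
    induction hv using Submodule.span_induction with
    | mem v hv =>
      rcases hv with rfl | ⟨i, -, rfl⟩
      · exact hone 1
      · exact hx i
    | zero => simpa using hsmul 1 0 1 (hone 1)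
    | add u v _ _ hu hv => exact hadd 1 u v hu hv
    | smul c u _ hu => exact hsmul 1 c u hu
  induction N generalizing u with
  | zero =>
    rw [pow_zero, Submodule.mem_one] at hu
    obtain ⟨c, rfl⟩ := hu
    rw [Algebra.algebraMap_eq_smul_one]
    exact hsmul 0 c 1 (hone 0)
  | succ N ih =>
    rw [pow_succ] at hu
    induction hu using Submodule.mul_induction_on' with
    | mem_mul_mem u hu v hv => exact hmul N u hu v hv (ih hu) (h1 v hv)
    | add u _ v _ hu hv => exact hadd (N + 1) u v hu hv

variable {K : Type*} [Field K] [NumberField K] {ι : Type*}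

omit [NumberField K] in
theorem mul_derivative_mem_linForms_pow [Fintype ι] {T : K[X]} {B : Matrix ι ι K[X]}
    {F : ι → PowerSeries K} (hsys : ∀ i, (T : PowerSeries K) * PowerSeries.derivative K (F i) =
      ∑ j, (B i j : PowerSeries K) * F j) {N : ℕ} {u : PowerSeries K}
    (hu : u ∈ linForms K[X] F Set.univ ^ N) :
    (T : PowerSeries K) * PowerSeries.derivative K u ∈ linForms K[X] F Set.univ ^ N := by
  have hcoe : ∀ (p : K[X]) (v : PowerSeries K), (p : PowerSeries K) * v = p • v := fun p v => by
    rw [Algebra.smul_def, PowerSeries.algebraMap_apply']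
    simp
  refine (linForms_pow_induction (A := K[X]) F
    (C := fun N u => u ∈ linForms K[X] F Set.univ ^ N ∧
      (T : PowerSeries K) * PowerSeries.derivative K u ∈ linForms K[X] F Set.univ ^ N)
    (fun N => ⟨Submodule.one_le.1 (one_le_pow₀ (one_le_linForms _ _)), ?_⟩)
    (fun i => ⟨by rw [pow_one]; exact mem_linForms _ (Set.mem_univ i), ?_⟩)
    (fun N u v hu hv => ⟨add_mem hu.1 hv.1, ?_⟩)
    (fun N c u hu => ⟨Submodule.smul_mem _ c hu.1, ?_⟩)
    (fun N u _ v hv' hu hv => ⟨pow_succ (linForms K[X] F Set.univ) N ▸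
      Submodule.mul_mem_mul hu.1 hv', ?_⟩) hu).2
  · rw [Derivation.map_one_eq_zero, mul_zero]
    exact zero_mem _
  · rw [pow_one, hsys]
    exact Submodule.sum_mem _ fun j _ => by
      rw [hcoe]
      exact Submodule.smul_mem _ _ (mem_linForms _ (Set.mem_univ j))
  · rw [map_add, mul_add]
    exact add_mem hu.2 hv.2
  · have h : (T : PowerSeries K) * PowerSeries.derivative K (c • u) =
        c • ((T : PowerSeries K) * PowerSeries.derivative K u) + (T * derivative c) • u := by
      rw [← hcoe, ← hcoe, ← hcoe, Derivation.leibniz, PowerSeries.derivative_coe,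
        Polynomial.coe_mul, smul_eq_mul, smul_eq_mul]
      ring
    rw [h]
    exact add_mem (Submodule.smul_mem _ _ hu.2) (Submodule.smul_mem _ _ hu.1)
  · have h : (T : PowerSeries K) * PowerSeries.derivative K (u * v) =
        (T : PowerSeries K) * PowerSeries.derivative K u * v +
          u * ((T : PowerSeries K) * PowerSeries.derivative K v) := by
      rw [Derivation.leibniz, smul_eq_mul, smul_eq_mul]
      ring
    rw [h, pow_succ]
    exact add_mem (Submodule.mul_mem_mul hu.2 hv')
      (Submodule.mul_mem_mul hu.1 (by simpa using hv.2))

theorem mem_eSubalgebra_of_mem_linForms_pow {F : ι → PowerSeries K}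
    (hF : ∀ i, F i ∈ eSubalgebra K) {N : ℕ} {u : PowerSeries K}
    (hu : u ∈ linForms K[X] F Set.univ ^ N) : u ∈ eSubalgebra K :=
  linForms_pow_induction (A := K[X]) F (C := fun _ u => u ∈ eSubalgebra K)
    (fun _ => one_mem _) hF (fun _ _ _ => add_mem) (fun _ c _ h => Subalgebra.smul_mem _ h c)
    (fun _ _ _ _ _ => mul_mem) hu

theorem seriesEval_smul (φ : K →+* ℂ) (a : K) (p : K[X]) {u : PowerSeries K}
    (hu : u ∈ eSubalgebra K) :
    seriesEval φ (φ a) (p • u) = φ (p.eval a) * seriesEval φ (φ a) u := by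
  rw [← eval₂_at_apply, ← evalHom_algebraMap, ← evalHom_apply φ _ ⟨u, hu⟩, ← map_mul,
    ← Algebra.smul_def]
  rfl

theorem seriesEval_one (φ : K →+* ℂ) (z : ℂ) : seriesEval φ z 1 = 1 := map_one (evalHom φ z)

theorem seriesEval_mem_linForms_pow [Algebra K ℂ] {F : ι → PowerSeries K}
    (hF : ∀ i, F i ∈ eSubalgebra K) (a : K) {N : ℕ} {u : PowerSeries K}
    (hu : u ∈ linForms K[X] F Set.univ ^ N) :
    seriesEval (algebraMap K ℂ) (algebraMap K ℂ a) u ∈ linForms K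
      (fun i => seriesEval (algebraMap K ℂ) (algebraMap K ℂ a) (F i)) Set.univ ^ N := by
  refine (linForms_pow_induction (A := K[X]) F (C := fun N u => u ∈ eSubalgebra K ∧
    seriesEval (algebraMap K ℂ) (algebraMap K ℂ a) u ∈ linForms K
      (fun i => seriesEval (algebraMap K ℂ) (algebraMap K ℂ a) (F i)) Set.univ ^ N)
    (fun N => ⟨one_mem _, ?_⟩) (fun i => ⟨hF i, ?_⟩) (fun N u v hu hv => ⟨add_mem hu.1 hv.1, ?_⟩)
    (fun N c u hu => ⟨Subalgebra.smul_mem _ hu.1 c, ?_⟩)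
    (fun N u _ v _ hu hv => ⟨mul_mem hu.1 hv.1, ?_⟩) hu).2
  · rw [seriesEval_one]
    exact Submodule.one_le.1 (one_le_pow₀ (one_le_linForms _ _))
  · rw [pow_one]
    exact mem_linForms _ (Set.mem_univ i)
  · rw [seriesEval_add _ _ hu.1 hv.1]
    exact add_mem hu.2 hv.2
  · rw [seriesEval_smul _ _ _ hu.1, ← Algebra.smul_def]
    exact Submodule.smul_mem _ _ hu.2
  · rw [seriesEval_mul _ _ hu.1 hv.1, pow_succ]
    exact Submodule.mul_mem_mul hu.2 (by simpa using hv.2)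

theorem exists_seriesEval_eq_of_mem_linForms_pow [Algebra K ℂ] {F : ι → PowerSeries K}
    (hF : ∀ i, F i ∈ eSubalgebra K) (a : K) {N : ℕ} {v : ℂ}
    (hv : v ∈ linForms K
      (fun i => seriesEval (algebraMap K ℂ) (algebraMap K ℂ a) (F i)) Set.univ ^ N) :
    ∃ u ∈ linForms K[X] F Set.univ ^ N,
      seriesEval (algebraMap K ℂ) (algebraMap K ℂ a) u = v := by
  have hE := fun (N : ℕ) (u : PowerSeries K) (hu : u ∈ linForms K[X] F Set.univ ^ N) =>
    mem_eSubalgebra_of_mem_linForms_pow hF hu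
  refine linForms_pow_induction (A := K) _ (C := fun N v => ∃ u ∈ linForms K[X] F Set.univ ^ N,
      seriesEval (algebraMap K ℂ) (algebraMap K ℂ a) u = v)
    (fun N => ⟨1, Submodule.one_le.1 (one_le_pow₀ (one_le_linForms _ _)), seriesEval_one _ _⟩)
    (fun i => ⟨F i, by rw [pow_one]; exact mem_linForms _ (Set.mem_univ i), rfl⟩) ?_ ?_ ?_ hv
  · rintro N _ _ ⟨u, hu, rfl⟩ ⟨u', hu', rfl⟩
    exact ⟨u + u', add_mem hu hu', seriesEval_add _ _ (hE _ _ hu) (hE _ _ hu')⟩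
  · rintro N c _ ⟨u, hu, rfl⟩
    refine ⟨(C c : K[X]) • u, Submodule.smul_mem _ _ hu, ?_⟩
    rw [seriesEval_smul _ _ _ (hE _ _ hu), eval_C, Algebra.smul_def]
  · rintro N _ _ _ _ ⟨u, hu, rfl⟩ ⟨u', hu', rfl⟩
    refine ⟨u * u', ?_, seriesEval_mul _ _ (hE _ _ hu) (hE _ _ hu')⟩
    rw [pow_succ]
    exact Submodule.mul_mem_mul hu (by simpa using hu')

end PowerForms
end SiegelShidlovskii

namespace SiegelShidlovskii
open Polynomial NumberField

theorem faithfulSMul_polynomial_powerSeries (K : Type*) [Field K] :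
    FaithfulSMul K[X] (PowerSeries K) := by
  refine (faithfulSMul_iff_algebraMap_injective _ _).2 fun p q h => ?_
  rw [PowerSeries.algebraMap_apply', PowerSeries.algebraMap_apply'] at h
  exact Polynomial.coe_injective K (by simpa using h)

section Comparison
variable {K : Type*} [Field K] [NumberField K] [Algebra K ℂ] {n : ℕ}

/-- Hilbert functions of the functions and of their values are comparable. -/
theorem finrank_linForms_pow_compare {T : K[X]} {B : Matrix (Fin n) (Fin n) K[X]}
    {F : Fin n → PowerSeries K} (hF : ∀ i, F i ∈ eSubalgebra K)
    (hsys : ∀ i, (T : PowerSeries K) * PowerSeries.derivative K (F i) =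
      ∑ j, (B i j : PowerSeries K) * F j)
    (a : K) (ha0 : a ≠ 0) (ha : T.eval a ≠ 0) (N : ℕ) :
    Module.finrank K (linForms K (fun i => seriesEval (algebraMap K ℂ) (algebraMap K ℂ a) (F i))
      Set.univ ^ N : Submodule K ℂ) ≤
        Module.finrank K[X] (linForms K[X] F Set.univ ^ N : Submodule K[X] (PowerSeries K)) ∧
    Module.finrank K[X] (linForms K[X] F Set.univ ^ N : Submodule K[X] (PowerSeries K)) ≤
      3 * Module.finrank ℚ K * (Module.finrank K (linForms K (fun i =>
        seriesEval (algebraMap K ℂ) (algebraMap K ℂ a) (F i)) Set.univ ^ N : Submodule K ℂ) +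
          1) := by
  set M : Submodule K[X] (PowerSeries K) := linForms K[X] F Set.univ ^ N with hM
  set V : Submodule K ℂ := linForms K (fun i => seriesEval (algebraMap K ℂ) (algebraMap K ℂ a)
    (F i)) Set.univ ^ N with hV
  have hfin : Module.Finite K[X] M := finite_linForms_pow F Set.univ N
  have := faithfulSMul_polynomial_powerSeries K
  have : Module.IsTorsionFree K[X] (PowerSeries K) := inferInstance
  have hfree : Module.Free K[X] M := Module.free_of_finite_type_torsion_free'
  let b := Module.finBasis K[X] M
  let g : Fin (Module.finrank K[X] M) → PowerSeries K := fun i => b i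
  have hgE : ∀ i, g i ∈ eSubalgebra K := fun i =>
    mem_eSubalgebra_of_mem_linForms_pow hF (b i).2
  have hcoe : ∀ (p : K[X]) (v : PowerSeries K), (p : PowerSeries K) * v = p • v := fun p v => by
    rw [Algebra.smul_def, PowerSeries.algebraMap_apply']
    simp
  have hrepr : ∀ u : M, (u : PowerSeries K) = ∑ j, (b.repr u j : PowerSeries K) * g j :=
    fun u => by
      have := congrArg Subtype.val (b.sum_repr u)
      simp only [AddSubmonoidClass.coe_finsetSum, Submodule.coe_smul] at this
      rw [← this]
      simp only [hcoe]
      rfl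
  have hspan : V = Submodule.span K (Set.range fun i =>
      seriesEval (algebraMap K ℂ) (algebraMap K ℂ a) (g i)) := by
    refine le_antisymm (fun v hv => ?_) (Submodule.span_le.2 ?_)
    · obtain ⟨u, hu, rfl⟩ := exists_seriesEval_eq_of_mem_linForms_pow hF a hv
      have h := seriesEval_pair (algebraMap K ℂ) a (fun j => b.repr ⟨u, hu⟩ j) hgE
      have h' : pair Polynomial.coeToPowerSeries.ringHom (fun j => b.repr ⟨u, hu⟩ j) g = u :=
        (hrepr ⟨u, hu⟩).symm
      rw [h'] at h
      rw [h]
      refine Submodule.sum_mem _ fun j _ => ?_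
      rw [← Algebra.smul_def]
      exact Submodule.smul_mem _ _ (Submodule.subset_span ⟨j, rfl⟩)
    · rintro _ ⟨i, rfl⟩
      exact seriesEval_mem_linForms_pow hF a (b i).2
  have h1 : (1 : ℂ) ∈ V := Submodule.one_le.1 (one_le_pow₀ (one_le_linForms _ _))
  rw [hspan] at h1 ⊢
  refine ⟨(finrank_range_le_card _).trans (Fintype.card_fin _).le, ?_⟩
  refine le_finrank_span_seriesEval (T := T)
    (B := fun i j => b.repr ⟨_, mul_derivative_mem_linForms_pow hsys (b i).2⟩ j) hgE
    (fun i => hrepr ⟨_, mul_derivative_mem_linForms_pow hsys (b i).2⟩) (fun P hP => ?_) a ha0 ha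
    (fun h0 => ?_)
  · have hli := Fintype.linearIndependent_iff.1 b.linearIndependent P (by
      refine Subtype.ext ?_
      rw [AddSubmonoidClass.coe_finsetSum, ZeroMemClass.coe_zero, ← hP]
      refine Finset.sum_congr rfl fun j _ => ?_
      rw [Submodule.coe_smul, ← hcoe]
      rfl)
    exact funext hli
  · have : Set.range (fun i => seriesEval (algebraMap K ℂ) (algebraMap K ℂ a) (g i)) ⊆ {0} := by
      rintro _ ⟨i, rfl⟩
      exact congrFun h0 i
    have h2 := Submodule.span_mono (R := K) this h1
    rw [Submodule.span_zero_singleton, Submodule.mem_bot] at h2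
    exact one_ne_zero h2

theorem not_forall_pow_succ_le (C k : ℕ) :
    ¬ ∀ N, (N + 1) ^ (k + 1) ≤ C * ((k + 1) * N + 1) ^ k := by
  intro h
  have h1 := h (C * (k + 1) ^ k)
  have h2 : ((k + 1) * (C * (k + 1) ^ k) + 1) ^ k ≤ (k + 1) ^ k * (C * (k + 1) ^ k + 1) ^ k := by
    rw [← mul_pow]
    exact Nat.pow_le_pow_left (by nlinarith) k
  have h3 : (C * (k + 1) ^ k + 1) ^ (k + 1) ≤
      C * (k + 1) ^ k * (C * (k + 1) ^ k + 1) ^ k := by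
    calc _ ≤ _ := h1
      _ ≤ C * ((k + 1) ^ k * (C * (k + 1) ^ k + 1) ^ k) := Nat.mul_le_mul_left _ h2
      _ = _ := by ring
  rw [pow_succ, mul_comm] at h3
  have := Nat.le_of_mul_le_mul_right h3 (by positivity)
  omega

/-- The theorem over a number field, in terms of power series. -/
theorem exists_algebraicIndepOn_iff {T : K[X]} {B : Matrix (Fin n) (Fin n) K[X]}
    {F : Fin n → PowerSeries K} (hF : ∀ i, F i ∈ eSubalgebra K)
    (hsys : ∀ i, (T : PowerSeries K) * PowerSeries.derivative K (F i) =
      ∑ j, (B i j : PowerSeries K) * F j)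
    (a : K) (ha0 : a ≠ 0) (ha : T.eval a ≠ 0) (k : ℕ) :
    (∃ S : Finset (Fin n), S.card = k ∧ AlgebraicIndepOn K
      (fun i => seriesEval (algebraMap K ℂ) (algebraMap K ℂ a) (F i)) (S : Set (Fin n))) ↔
    (∃ S : Finset (Fin n), S.card = k ∧ AlgebraicIndepOn K[X] F (S : Set (Fin n))) := by
  have := faithfulSMul_polynomial_powerSeries K
  have hcomp := finrank_linForms_pow_compare hF hsys a ha0 ha
  rcases k with _ | k
  · constructor <;> rintro -
    · refine ⟨∅, rfl, ?_⟩
      have : IsEmpty ((∅ : Finset (Fin n)) : Set (Fin n)) := by simp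
      exact algebraicIndependent_empty_type_iff.2 (FaithfulSMul.algebraMap_injective _ _)
    · refine ⟨∅, rfl, ?_⟩
      have : IsEmpty ((∅ : Finset (Fin n)) : Set (Fin n)) := by simp
      exact algebraicIndependent_empty_type_iff.2 (FaithfulSMul.algebraMap_injective _ _)
  · constructor
    · rintro ⟨S, hS, hSi⟩
      by_contra! hcon
      obtain ⟨C, hC⟩ := exists_finrank_linForms_pow_le (A := K[X]) F hcon
      refine not_forall_pow_succ_le C k fun N => ?_
      have := pow_le_finrank_linForms_pow _ S hSi N
      rw [hS] at this
      exact this.trans ((hcomp _).1.trans (hC _))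
    · rintro ⟨S, hS, hSi⟩
      by_contra! hcon
      obtain ⟨C, hC⟩ := exists_finrank_linForms_pow_le (A := K) _ hcon
      refine not_forall_pow_succ_le (3 * Module.finrank ℚ K * (C + 1)) k fun N => ?_
      have := pow_le_finrank_linForms_pow _ S hSi N
      rw [hS] at this
      refine this.trans ((hcomp _).2.trans ?_)
      rw [mul_assoc _ (C + 1)]
      refine Nat.mul_le_mul_left _ ((Nat.add_le_add_right (hC _) 1).trans ?_)
      rw [add_mul C 1, one_mul]
      exact Nat.add_le_add_left (Nat.one_le_pow _ _ (Nat.succ_pos _)) _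

end Comparison
end SiegelShidlovskii

namespace SiegelShidlovskii
open Polynomial

section EntireSeries

/-- `F` is the power series expansion at the origin of the entire function `f`. -/
def HasSeries (F : PowerSeries ℂ) (f : ℂ → ℂ) : Prop :=
  ∀ z, HasSum (fun n => F.coeff n * z ^ n) (f z)

variable {F G : PowerSeries ℂ} {f g : ℂ → ℂ}

theorem HasSeries.unique (hF : HasSeries F f) (hG : HasSeries G f) : F = G := by
  ext n
  exact congrFun (eq_of_hasSum_pow hF hG) n

theorem HasSeries.mul (hF : HasSeries F f) (hG : HasSeries G g) :
    HasSeries (F * G) (fun z => f z * g z) := by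
  intro z
  have h1 := (hF z).summable.norm
  have h2 := (hG z).summable.norm
  have h3 := (summable_norm_sum_mul_antidiagonal_of_summable_norm h1 h2).of_norm.hasSum
  rw [← tsum_mul_tsum_eq_tsum_sum_antidiagonal_of_summable_norm h1 h2, (hF z).tsum_eq,
    (hG z).tsum_eq] at h3
  refine h3.congr_fun fun n => ?_
  rw [PowerSeries.coeff_mul, Finset.sum_mul]
  refine Finset.sum_congr rfl fun p hp => ?_
  rw [← Finset.HasAntidiagonal.mem_antidiagonal.1 hp, pow_add]
  ring

theorem hasSeries_coe (p : ℂ[X]) : HasSeries p (fun z => p.eval z) := by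
  intro z
  have h : HasSum (fun n => (p : PowerSeries ℂ).coeff n * z ^ n)
      (∑ n ∈ Finset.range (p.natDegree + 1), (p : PowerSeries ℂ).coeff n * z ^ n) :=
    hasSum_sum_of_ne_finset_zero fun n hn => by
      rw [Finset.mem_range, not_lt] at hn
      rw [Polynomial.coeff_coe, coeff_eq_zero_of_natDegree_lt (by omega), zero_mul]
  simpa only [Polynomial.coeff_coe, ← eval_eq_sum_range] using h

theorem HasSeries.sum {ι : Type*} {s : Finset ι} {F : ι → PowerSeries ℂ} {f : ι → ℂ → ℂ}
    (h : ∀ i ∈ s, HasSeries (F i) (f i)) : HasSeries (∑ i ∈ s, F i) (fun z => ∑ i ∈ s, f i z) := by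
  intro z
  refine (hasSum_sum fun i hi => h i hi z).congr_fun fun n => ?_
  rw [map_sum, Finset.sum_mul]

theorem HasSeries.differentiable (hF : HasSeries F f) : Differentiable ℂ f := by
  have hr : (FormalMultilinearSeries.ofScalars ℂ (fun n => F.coeff n) :
      FormalMultilinearSeries ℂ ℂ ℂ).radius = ⊤ := by
    refine ENNReal.eq_top_of_forall_nnreal_le fun r => ?_
    refine FormalMultilinearSeries.le_radius_of_tendsto (l := 0) _ ?_
    have := (hF (r : ℂ)).summable.tendsto_atTop_zero.norm
    simpa [FormalMultilinearSeries.ofScalars_norm] using this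
  have h := (FormalMultilinearSeries.hasFPowerSeriesOnBall
    (FormalMultilinearSeries.ofScalars ℂ (fun n => F.coeff n) : FormalMultilinearSeries ℂ ℂ ℂ)
    (by rw [hr]; exact ENNReal.zero_lt_top)).differentiableOn
  rw [hr, Metric.eball_top, differentiableOn_univ] at h
  suffices hfs : f = FormalMultilinearSeries.sum (FormalMultilinearSeries.ofScalars ℂ
      (fun n => F.coeff n) : FormalMultilinearSeries ℂ ℂ ℂ) by
    rw [hfs]
    exact h
  funext z
  rw [← (hF z).tsum_eq]
  refine tsum_congr fun n => ?_
  simp [mul_comm]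

theorem Differentiable.hasSeries (hf : Differentiable ℂ f) :
    HasSeries (PowerSeries.mk fun n => (n.factorial : ℂ)⁻¹ * iteratedDeriv n f 0) f := by
  intro z
  have := Complex.hasSum_taylorSeries_of_entire hf 0 z
  refine this.congr_fun fun n => ?_
  simp only [PowerSeries.coeff_mk, sub_zero, smul_eq_mul]
  ring

theorem HasSeries.derivative (hF : HasSeries F f) :
    HasSeries (PowerSeries.derivative ℂ F) (deriv f) := by
  have h := Differentiable.hasSeries hF.differentiable.deriv
  rw [hF.unique (Differentiable.hasSeries hF.differentiable)]
  convert h using 1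
  ext n
  rw [PowerSeries.coeff_derivative, PowerSeries.coeff_mk, PowerSeries.coeff_mk,
    iteratedDeriv_succ', Nat.factorial_succ]
  have h1 : ((n : ℂ) + 1) ≠ 0 := Nat.cast_add_one_ne_zero n
  have h2 : (n.factorial : ℂ) ≠ 0 := Nat.cast_ne_zero.2 n.factorial_ne_zero
  push_cast
  field_simp

theorem HasSeries.iteratedDeriv (hF : HasSeries F f) (j : ℕ) :
    HasSeries ((PowerSeries.derivative ℂ)^[j] F) (iteratedDeriv j f) := by
  induction j generalizing F f with
  | zero => simpa using hF
  | succ j ih =>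
    rw [Function.iterate_succ_apply, iteratedDeriv_succ']
    exact ih hF.derivative

theorem coeff_iterate_derivative_mk (a : ℕ → ℂ) (j l : ℕ) :
    ((PowerSeries.derivative ℂ)^[j] (PowerSeries.mk fun n => a n / n.factorial)).coeff l =
      a (l + j) / l.factorial := by
  induction j generalizing a with
  | zero => simp
  | succ j ih =>
    have : PowerSeries.derivative ℂ (PowerSeries.mk fun n => a n / n.factorial) =
        PowerSeries.mk fun n => a (n + 1) / n.factorial := by
      ext n
      rw [PowerSeries.coeff_derivative, PowerSeries.coeff_mk, PowerSeries.coeff_mk,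
        Nat.factorial_succ]
      have h1 : ((n : ℂ) + 1) ≠ 0 := Nat.cast_add_one_ne_zero n
      push_cast
      field_simp
    rw [Function.iterate_succ_apply, this, ih (fun n => a (n + 1)), add_assoc]

/-- The recurrence satisfied by the coefficients of a power series solution of a linear
differential equation. -/
theorem sum_descFactorial_eq_zero {r d : ℕ} {p : Fin (r + 1) → ℂ[X]} {a : ℕ → ℂ}
    (hd : ∀ j, (p j).natDegree ≤ d)
    (h : ∑ j, (p j : PowerSeries ℂ) *
      (PowerSeries.derivative ℂ)^[j] (PowerSeries.mk fun n => a n / n.factorial) = 0) (m : ℕ) :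
    ∑ j : Fin (r + 1), ∑ i ∈ Finset.range (d + 1),
      (p j).coeff i * (m + d).descFactorial i * a (m + (j + d - i)) = 0 := by
  have h1 := congrArg (fun F => ((m + d).factorial : ℂ) * PowerSeries.coeff (m + d) F) h
  simp only [map_sum, map_zero, mul_zero, PowerSeries.coeff_mul, coeff_iterate_derivative_mk,
    Polynomial.coeff_coe] at h1
  rw [Finset.mul_sum] at h1
  rw [← h1]
  refine Finset.sum_congr rfl fun j _ => ?_
  rw [Finset.Nat.sum_antidiagonal_eq_sum_range_succ
    (fun i l => (p j).coeff i * (a (l + j) / l.factorial)), Finset.mul_sum]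
  rw [← Finset.sum_subset (Finset.range_mono (show d + 1 ≤ (m + d).succ by omega))]
  · refine Finset.sum_congr rfl fun i hi => ?_
    rw [Finset.mem_range] at hi
    rw [show m + d - i + j = m + (j + d - i) by omega]
    have h2 : ((m + d - i).factorial : ℂ) * (m + d).descFactorial i = (m + d).factorial := by
      exact_mod_cast Nat.factorial_mul_descFactorial (show i ≤ m + d by omega)
    have h3 : ((m + d - i).factorial : ℂ) ≠ 0 := Nat.cast_ne_zero.2 (Nat.factorial_ne_zero _)
    rw [← h2]
    field_simp
  · intro i _ hi
    rw [Finset.mem_range, not_lt] at hi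
    rw [coeff_eq_zero_of_natDegree_lt ((hd j).trans_lt (by omega))]
    ring

theorem exists_forall_mem_of_recurrence {r d : ℕ} {p : Fin (r + 1) → ℂ[X]} {a : ℕ → ℂ}
    (hd : ∀ j, (p j).natDegree ≤ d) (hp : ∃ j, p j ≠ 0)
    (h : ∀ m, ∑ j : Fin (r + 1), ∑ i ∈ Finset.range (d + 1),
      (p j).coeff i * (m + d).descFactorial i * a (m + (j + d - i)) = 0) :
    ∃ N, ∀ K : IntermediateField ℚ ℂ, (∀ j i, (p j).coeff i ∈ K) → (∀ n < N, a n ∈ K) →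
      ∀ n, a n ∈ K := by
  classical
  let I : Finset (Fin (r + 1) × ℕ) :=
    (Finset.univ ×ˢ Finset.range (d + 1)).filter fun x => (p x.1).coeff x.2 ≠ 0
  have hI : ∀ x, x ∈ I ↔ x.2 < d + 1 ∧ (p x.1).coeff x.2 ≠ 0 := fun x => by
    simp [I]
  let t : Fin (r + 1) × ℕ → ℕ := fun x => x.1 + d - x.2
  have h' : ∀ m, ∑ x ∈ I, (p x.1).coeff x.2 * (m + d).descFactorial x.2 * a (m + t x) = 0 := by
    intro m
    rw [← h m, ← Finset.sum_product', Finset.sum_filter_of_ne]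
    intro x _ hx h0
    exact hx (by rw [h0]; ring)
  have hne : I.Nonempty := by
    obtain ⟨j, hj⟩ := hp
    exact ⟨(j, (p j).natDegree), (hI _).2 ⟨Nat.lt_succ_of_le (hd j), leadingCoeff_ne_zero.2 hj⟩⟩
  obtain ⟨x₀, hx₀, hmax⟩ := I.exists_max_image t hne
  let J := I.filter fun x => t x = t x₀
  obtain ⟨x₁, hx₁, hmin⟩ := J.exists_min_image (fun x => x.2) ⟨x₀, by simp [J, hx₀]⟩
  have hJ : ∀ x, x ∈ J ↔ x ∈ I ∧ t x = t x₀ := fun x => Finset.mem_filter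
  let Q : ℂ[X] := ∑ x ∈ J, C ((p x.1).coeff x.2) * descPochhammer ℂ x.2
  have hQ : ∀ m : ℕ, Q.eval (m : ℂ) = ∑ x ∈ J, (p x.1).coeff x.2 * m.descFactorial x.2 := by
    intro m
    simp only [Q, eval_finsetSum, eval_mul, eval_C, descPochhammer_eval_eq_descFactorial]
  have hQ0 : Q ≠ 0 := by
    intro h0
    have h1 := hQ x₁.2
    rw [h0, eval_zero, Finset.sum_eq_single_of_mem x₁ hx₁] at h1
    · refine mul_ne_zero ((hI _).1 ((hJ _).1 hx₁).1).2 ?_ h1.symm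
      rw [Nat.descFactorial_self]
      exact Nat.cast_ne_zero.2 (Nat.factorial_ne_zero _)
    · intro x hx hne
      have h2 := hmin x hx
      rcases h2.lt_or_eq with h2 | h2
      · rw [Nat.descFactorial_eq_zero_iff_lt.2 h2]
        simp
      · refine absurd (Prod.ext (Fin.ext ?_) h2.symm) hne
        have h3 := ((hJ _).1 hx).2.trans ((hJ _).1 hx₁).2.symm
        have h4 := ((hI _).1 ((hJ _).1 hx).1).1
        simp only [t] at h3
        omega
  obtain ⟨M, hM⟩ : ∃ M : ℕ, ∀ m : ℕ, M ≤ m → Q.eval (m : ℂ) ≠ 0 := by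
    have hfin : {m : ℕ | Q.eval (m : ℂ) = 0}.Finite := by
      refine Set.Finite.preimage (f := fun m : ℕ => (m : ℂ)) Nat.cast_injective.injOn
        (s := {z | Q.IsRoot z}) (finite_setOfPred_isRoot hQ0)
    obtain ⟨M, hM⟩ := hfin.bddAbove
    exact ⟨M + 1, fun m hm h0 => absurd (hM h0) (by omega)⟩
  refine ⟨M + t x₀, fun K hK ha n => ?_⟩
  induction n using Nat.strong_induction_on with
  | _ n ih =>
    by_cases hn : n < M + t x₀
    · exact ha n hn
    obtain ⟨m, rfl⟩ : ∃ m, n = m + t x₀ := ⟨n - t x₀, by omega⟩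
    have h1 := h' m
    rw [← Finset.sum_filter_add_sum_filter_not I (fun x => t x = t x₀)] at h1
    have h2 : ∑ x ∈ I.filter (fun x => t x = t x₀),
        (p x.1).coeff x.2 * ((m + d).descFactorial x.2 : ℂ) * a (m + t x) =
          Q.eval ((m + d : ℕ) : ℂ) * a (m + t x₀) := by
      rw [hQ, Finset.sum_mul]
      refine Finset.sum_congr rfl fun x hx => ?_
      rw [((hJ x).1 hx).2]
    rw [h2] at h1
    have h3 : ∑ x ∈ I.filter (fun x => ¬ t x = t x₀),
        (p x.1).coeff x.2 * ((m + d).descFactorial x.2 : ℂ) * a (m + t x) ∈ K := by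
      refine sum_mem fun x hx => mul_mem (mul_mem (hK _ _) (natCast_mem K _)) (ih _ ?_)
      rw [Finset.mem_filter] at hx
      have := (hmax x hx.1).lt_of_ne hx.2
      omega
    have h4 : Q.eval ((m + d : ℕ) : ℂ) ∈ K := by
      rw [hQ]
      exact sum_mem fun x _ => mul_mem (hK _ _) (natCast_mem K _)
    rw [eq_div_of_mul_eq (hM (m + d) (by omega))
      ((mul_comm _ _).trans (eq_neg_of_add_eq_zero_left h1))]
    exact div_mem (neg_mem h3) h4

end EntireSeries
end SiegelShidlovskii

namespace SiegelShidlovskii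
open Polynomial NumberField

section Descent

/-- `Q` holds for every subfield of `ℂ` containing suitable finitely many algebraic numbers. -/
def HoldsEventually (Q : IntermediateField ℚ ℂ → Prop) : Prop :=
  ∃ G : Set ℂ, G.Finite ∧ (∀ x ∈ G, IsAlgebraic ℚ x) ∧ ∀ K : IntermediateField ℚ ℂ, G ⊆ K → Q K

theorem HoldsEventually.mono {Q R : IntermediateField ℚ ℂ → Prop} (h : HoldsEventually Q)
    (hQR : ∀ K, Q K → R K) : HoldsEventually R := by
  obtain ⟨G, hG, hG', h⟩ := h
  exact ⟨G, hG, hG', fun K hK => hQR K (h K hK)⟩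

theorem HoldsEventually.forall {ι : Type*} {s : Set ι} (hs : s.Finite)
    {Q : ι → IntermediateField ℚ ℂ → Prop} (h : ∀ i ∈ s, HoldsEventually (Q i)) :
    HoldsEventually fun K => ∀ i ∈ s, Q i K := by
  choose! G hG hG' h using h
  refine ⟨⋃ i ∈ s, G i, hs.biUnion hG, fun x hx => ?_, fun K hK i hi =>
    h i hi K ((Set.subset_biUnion_of_mem hi).trans hK)⟩
  simp only [Set.mem_iUnion] at hx
  obtain ⟨i, hi, hx⟩ := hx
  exact hG' i hi x hx

theorem HoldsEventually.and {Q R : IntermediateField ℚ ℂ → Prop} (hQ : HoldsEventually Q)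
    (hR : HoldsEventually R) : HoldsEventually fun K => Q K ∧ R K := by
  obtain ⟨G, hG, hG', hQ⟩ := hQ
  obtain ⟨H, hH, hH', hR⟩ := hR
  refine ⟨G ∪ H, hG.union hH, fun x hx => hx.elim (hG' x) (hH' x), fun K hK =>
    ⟨hQ K (Set.subset_union_left.trans hK), hR K (Set.subset_union_right.trans hK)⟩⟩

theorem HoldsEventually.exists {Q : IntermediateField ℚ ℂ → Prop} (h : HoldsEventually Q) :
    ∃ K : IntermediateField ℚ ℂ, FiniteDimensional ℚ K ∧ Q K := by
  obtain ⟨G, hG, hG', h⟩ := h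
  have := hG.to_subtype
  exact ⟨IntermediateField.adjoin ℚ G, IntermediateField.finiteDimensional_adjoin
    fun x hx => (hG' x hx).isIntegral, h _ (IntermediateField.subset_adjoin ℚ G)⟩

theorem holdsEventually_mem {x : ℂ} (hx : IsAlgebraic ℚ x) : HoldsEventually fun K => x ∈ K :=
  ⟨{x}, Set.finite_singleton x, by rintro _ rfl; exact hx, fun K hK => hK rfl⟩

theorem holdsEventually_coeff_mem {p : ℂ[X]} (hp : ∀ k, IsAlgebraic ℚ (p.coeff k)) :
    HoldsEventually fun K => ∀ k, p.coeff k ∈ K := by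
  refine (HoldsEventually.forall p.support.finite_toSet
    (fun k _ => holdsEventually_mem (hp k))).mono fun K hK k => ?_
  by_cases h : k ∈ p.support
  · exact hK k h
  · rw [notMem_support_iff.1 h]
    exact zero_mem K

theorem hasSeries_of_isEFunctionWith {a : ℕ → Qbar} {f : ℂ → ℂ} (h : IsEFunctionWith a f) :
    HasSeries (PowerSeries.mk fun n => (a n : ℂ) / n.factorial) f := by
  intro z
  simpa using h.1 z

theorem isAlgebraic_coe_Qbar (x : Qbar) : IsAlgebraic ℚ (x : ℂ) :=
  mem_algebraicClosure_iff.1 x.2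

theorem holdsEventually_mem_of_isEFunctionWith {a : ℕ → Qbar} {f : ℂ → ℂ}
    (h : IsEFunctionWith a f) : HoldsEventually fun K => ∀ n, (a n : ℂ) ∈ K := by
  obtain ⟨r, p, hp, hp0, hode⟩ := h.2.2.2
  let d := Finset.univ.sup fun j => (p j).natDegree
  have h0 : ∑ j, (p j : PowerSeries ℂ) * (PowerSeries.derivative ℂ)^[j]
      (PowerSeries.mk fun n => (a n : ℂ) / n.factorial) = 0 := by
    have h1 := HasSeries.sum (s := Finset.univ) fun (j : Fin (r + 1)) _ =>
      (hasSeries_coe (p j)).mul ((hasSeries_of_isEFunctionWith h).iteratedDeriv (j : ℕ))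
    exact h1.unique fun z => by simp [hode]
  obtain ⟨N, hN⟩ := exists_forall_mem_of_recurrence (d := d)
    (fun j => Finset.le_sup (f := fun j => (p j).natDegree) (Finset.mem_univ j)) hp0
    (sum_descFactorial_eq_zero
      (fun j => Finset.le_sup (f := fun j => (p j).natDegree) (Finset.mem_univ j)) h0)
  refine ((HoldsEventually.forall Set.finite_univ
    fun j _ => holdsEventually_coeff_mem (hp j)).and (HoldsEventually.forall (Set.finite_lt_nat N)
      fun n _ => holdsEventually_mem (isAlgebraic_coe_Qbar (a n)))).mono
        fun K hK => hN K (fun j => hK.1 j trivial) hK.2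

theorem exists_ringHom_Qbar_apply_eq {K : IntermediateField ℚ ℂ} (φ : K →+* ℂ) {x : K}
    {y : Qbar} (hxy : (x : ℂ) = y) : ∃ σ : Qbar →+* ℂ, σ y = φ x := by
  have hint : ∀ s : Qbar, IsIntegral ℚ s := fun s =>
    (isIntegral_algebraMap_iff (B := ℂ) Subtype.val_injective).1
      (isAlgebraic_coe_Qbar s).isIntegral
  have hmin : minpoly ℚ y = minpoly ℚ x := by
    rw [← minpoly.algebraMap_eq (B' := ℂ) Subtype.val_injective y,
      ← minpoly.algebraMap_eq (B' := ℂ) Subtype.val_injective x]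
    exact congrArg _ hxy.symm
  obtain ⟨σ, hσ⟩ := IntermediateField.exists_algHom_of_splits_of_aeval (K := ℂ)
    (fun s : Qbar => ⟨hint s, IsAlgClosed.splits _⟩) (x := y) (y := φ x) (by
      have := aeval_algHom_apply φ.toRatAlgHom x (minpoly ℚ x)
      rw [minpoly.aeval, map_zero] at this
      rw [hmin]
      exact this)
  exact ⟨σ.toRingHom, hσ⟩

theorem mk_mem_eSubalgebra_of_isEFunctionWith {K : IntermediateField ℚ ℂ} [FiniteDimensional ℚ K]
    [NumberField K] {a : ℕ → Qbar} {f : ℂ → ℂ} (h : IsEFunctionWith a f) {b : ℕ → K}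
    (hb : ∀ n, (b n : ℂ) = a n) :
    (PowerSeries.mk fun n => b n / n.factorial) ∈ eSubalgebra K := by
  obtain ⟨-, ⟨C, hC, hCa⟩, ⟨D, hD, d, hd, hda⟩, -⟩ := h
  have hcoeff : ∀ n, (n.factorial : K) *
      (PowerSeries.mk fun n => b n / n.factorial).coeff n = b n := fun n => by
    rw [PowerSeries.coeff_mk]
    exact mul_div_cancel₀ _ (Nat.cast_ne_zero.2 n.factorial_ne_zero)
  have hle : ∀ x : ℝ, 0 < x → x ≤ ⌈C⌉₊ + ⌈D⌉₊ → ∀ n : ℕ,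
      x ^ (n + 1) ≤ ((⌈C⌉₊ + ⌈D⌉₊ : ℕ) : ℝ) ^ (n + 1) := fun x hx hx' n => by
    push_cast
    gcongr
  have hC' := Nat.le_ceil C
  have hD' := Nat.le_ceil D
  refine ⟨⌈C⌉₊ + ⌈D⌉₊, Nat.add_pos_left (Nat.ceil_pos.2 hC) _, fun n => ?_, d, fun n =>
    ⟨(hd n).1, ?_, fun m hm => ?_⟩⟩
  · rw [hcoeff]
    refine le_trans ?_ (hle C hC (by linarith [Nat.cast_nonneg (α := ℝ) ⌈D⌉₊]) n)
    rw [house_eq_sup']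
    obtain ⟨φ, -, hφ⟩ := Finset.exists_mem_eq_sup' Finset.univ_nonempty
      (fun φ : K →+* ℂ => ‖φ (b n)‖₊)
    rw [hφ, coe_nnnorm]
    obtain ⟨σ, hσ⟩ := exists_ringHom_Qbar_apply_eq φ (hb n)
    rw [← hσ]
    exact hCa σ n
  · exact_mod_cast (hd n).2.trans (hle D hD (by linarith [Nat.cast_nonneg (α := ℝ) ⌈C⌉₊]) n)
  · rw [hcoeff]
    refine (isIntegral_algebraMap_iff (B := ℂ) Subtype.val_injective).1 ?_
    have := hda n m hm
    rw [← hb] at this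
    simpa using this

theorem algebraicIndependent_iff_rat {ι : Type*} {x : ι → ℂ} {L : IntermediateField ℚ ℂ}
    (hL : ∀ y : L, IsAlgebraic ℚ (y : ℂ)) :
    AlgebraicIndependent L x ↔ AlgebraicIndependent ℚ x := by
  have : Algebra.IsAlgebraic ℚ L :=
    ⟨fun y => (isAlgebraic_algebraMap_iff (A := ℂ) Subtype.val_injective).1 (hL y)⟩
  exact ⟨fun h => h.restrictScalars (algebraMap ℚ L).injective, fun h => h.extendScalars L⟩

section Functions
variable {K : IntermediateField ℚ ℂ} {ι : Type*} {F : ι → PowerSeries K} {g : ι → ℂ → ℂ}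

theorem hasSeries_map_aeval
    (hF : ∀ i, HasSeries (PowerSeries.map (algebraMap K ℂ) (F i)) (g i))
    (P : MvPolynomial ι K[X]) :
    HasSeries (PowerSeries.map (algebraMap K ℂ) (MvPolynomial.aeval F P)) fun z =>
      MvPolynomial.eval (fun i => g i z) (MvPolynomial.map (Polynomial.evalRingHom z)
        (MvPolynomial.map (Polynomial.mapRingHom (algebraMap K ℂ)) P)) := by
  induction P using MvPolynomial.induction_on with
  | C p =>
    have h := hasSeries_coe (p.map (algebraMap K ℂ))
    have h' : (PowerSeries.map (algebraMap K ℂ) (MvPolynomial.aeval F (MvPolynomial.C p))) =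
        (p.map (algebraMap K ℂ) : PowerSeries ℂ) := by
      rw [MvPolynomial.aeval_C, PowerSeries.algebraMap_apply']
      ext n
      simp
    rw [h']
    simpa using h
  | add p q hp hq =>
    intro z
    have := (hp z).add (hq z)
    simpa [add_mul] using this
  | mul_X p i hp =>
    have := hp.mul (hF i)
    simpa using this

theorem algebraicIndependent_of_algIndepFuncs
    (hF : ∀ i, HasSeries (PowerSeries.map (algebraMap K ℂ) (F i)) (g i))
    (halg : ∀ x : K, IsAlgebraic ℚ (x : ℂ)) (hg : AlgIndepFuncsOverQbarZ g) :
    AlgebraicIndependent K[X] F := by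
  rw [algebraicIndependent_iff]
  intro P hP
  have h := hasSeries_map_aeval hF P
  rw [hP, map_zero] at h
  have h0 := hg _ (fun m k => ?_) fun z => (h z).unique (by simp)
  · exact MvPolynomial.map_injective _
      (Polynomial.map_injective _ (algebraMap K ℂ).injective) (by rw [h0, map_zero])
  · rw [MvPolynomial.coeff_map, coe_mapRingHom, coeff_map]
    exact halg _

theorem eq_zero_of_algebraicIndependent
    (hF : ∀ i, HasSeries (PowerSeries.map (algebraMap K ℂ) (F i)) (g i))
    (hg : AlgebraicIndependent K[X] F) {P : MvPolynomial ι ℂ[X]}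
    (hPK : ∀ m k, (P.coeff m).coeff k ∈ K)
    (hP : ∀ z : ℂ, MvPolynomial.eval (fun i => g i z)
      (MvPolynomial.map (Polynomial.evalRingHom z) P) = 0) : P = 0 := by
  obtain ⟨P, rfl⟩ : P ∈ Set.range
      (MvPolynomial.map (Polynomial.mapRingHom (algebraMap K ℂ))) := by
    rw [MvPolynomial.mem_range_map_iff_coeffs_subset]
    intro p hp
    obtain ⟨m, -, rfl⟩ := MvPolynomial.mem_coeffs_iff.1 hp
    obtain ⟨q, hq⟩ := (mem_lifts _).1 ((lifts_iff_coeff_lifts (f := algebraMap K ℂ) _).2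
      fun k => ⟨⟨_, hPK m k⟩, rfl⟩)
    exact ⟨q, hq⟩
  have h := hasSeries_map_aeval hF P
  have h0 : PowerSeries.map (algebraMap K ℂ) (MvPolynomial.aeval F P) = 0 :=
    h.unique fun z => by simp [hP]
  rw [algebraicIndependent_iff.1 hg P (PowerSeries.map_injective _ (algebraMap K ℂ).injective
    (by rw [h0, map_zero])), map_zero]

end Functions

theorem holdsEventually_algIndepFuncs_of {ι : Type*} (g : ι → ℂ → ℂ) :
    HoldsEventually fun K => ∀ F : ι → PowerSeries K,
      (∀ i, HasSeries (PowerSeries.map (algebraMap K ℂ) (F i)) (g i)) →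
      AlgebraicIndependent K[X] F → AlgIndepFuncsOverQbarZ g := by
  by_cases hg : AlgIndepFuncsOverQbarZ g
  · exact ⟨∅, Set.finite_empty, by simp, fun _ _ _ _ _ => hg⟩
  · unfold AlgIndepFuncsOverQbarZ at hg
    push Not at hg
    obtain ⟨P, hPalg, hP, hP0⟩ := hg
    refine (HoldsEventually.forall P.support.finite_toSet
      (fun m _ => holdsEventually_coeff_mem (hPalg m))).mono fun K hK F hF hi => ?_
    refine absurd (eq_zero_of_algebraicIndependent hF hi (fun m k => ?_) hP) hP0
    by_cases h : m ∈ P.support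
    · exact hK m h k
    · rw [MvPolynomial.notMem_support_iff.1 h, coeff_zero]
      exact zero_mem K

end Descent
end SiegelShidlovskii

open SiegelShidlovskii

/-- **Siegel–Shidlovskii theorem.**  If the E-functions `f 0, …, f (n-1)` satisfy the
differential system `Y' = A Y` with `A` an `n × n` matrix over `ℚ̄(z)` (given here by
`A = B / T` where `B = T·A` has polynomial entries with algebraic coefficients), then
at every algebraic point `α` with `α · T(α) ≠ 0` the transcendence degree over `ℚ̄` of
`ℚ̄(f 0 (α), …, f (n-1) (α))` equals the transcendence degree over `ℚ̄(z)` of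
`ℚ̄(z)(f 0, …, f (n-1))`; both transcendence degrees are expressed as the largest
cardinality of an algebraically independent subfamily of the generators. -/
theorem siegel_shidlovskii (n : ℕ) (f : Fin n → ℂ → ℂ)
    (hf : ∀ i, IsEFunction (f i))
    (B : Matrix (Fin n) (Fin n) (Polynomial ℂ))
    (hB : ∀ i j k, IsAlgebraic ℚ ((B i j).coeff k))
    (T : Polynomial ℂ) (hT : T ≠ 0) (hTalg : ∀ k, IsAlgebraic ℚ (T.coeff k))
    (hsys : ∀ i, ∀ z : ℂ, T.eval z * deriv (f i) z = ∑ j, (B i j).eval z * f j z)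
    (α : ℂ) (hα : IsAlgebraic ℚ α) (hreg : α * T.eval α ≠ 0) :
    ∀ k : ℕ,
      (∃ S : Finset (Fin n), S.card = k ∧
        AlgebraicIndependent Qbar (fun i : S => f (i : Fin n) α)) ↔
      (∃ S : Finset (Fin n), S.card = k ∧
        AlgIndepFuncsOverQbarZ (fun i : S => f (i : Fin n))) := by
  choose a ha using hf
  obtain ⟨K, hK, haK, hBK, hTK, hαK, hfK⟩ := ((HoldsEventually.forall Set.finite_univ
    fun i _ => holdsEventually_mem_of_isEFunctionWith (ha i)).and
    ((HoldsEventually.forall (Set.finite_univ (α := Fin n × Fin n))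
      fun x _ => holdsEventually_coeff_mem (hB x.1 x.2)).and
    ((holdsEventually_coeff_mem hTalg).and ((holdsEventually_mem hα).and
    (HoldsEventually.forall (Set.finite_univ (α := Finset (Fin n)))
      fun S _ => holdsEventually_algIndepFuncs_of fun i : S => f (i : Fin n)))))).exists
  have : NumberField K := { to_charZero := inferInstance, to_finiteDimensional := hK }
  have halg : ∀ x : K, IsAlgebraic ℚ (x : ℂ) := fun x =>
    (Algebra.IsAlgebraic.isAlgebraic (R := ℚ) x).algebraMap
  let φ := algebraMap K ℂ
  have hφ : Function.Injective φ := φ.injective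
  have hlift : ∀ p : Polynomial ℂ, (∀ k, p.coeff k ∈ K) → ∃ q : Polynomial K, q.map φ = p :=
    fun p hp => (Polynomial.mem_lifts p).1 ((Polynomial.lifts_iff_coeff_lifts p).2
      fun k => ⟨⟨_, hp k⟩, rfl⟩)
  obtain ⟨T', rfl⟩ := hlift T hTK
  have hB' : ∀ i j, ∃ q : Polynomial K, q.map φ = B i j := fun i j =>
    hlift _ (hBK (i, j) trivial)
  choose B' hB' using hB'
  let b : Fin n → ℕ → K := fun i m => ⟨a i m, haK i trivial m⟩
  let F : Fin n → PowerSeries K := fun i => PowerSeries.mk fun m => b i m / m.factorial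
  have hFs : ∀ i, HasSeries (PowerSeries.map φ (F i)) (f i) := fun i => by
    convert hasSeries_of_isEFunctionWith (ha i) using 1
    ext m
    simp only [F, PowerSeries.coeff_map, PowerSeries.coeff_mk, map_div₀, map_natCast]
    rfl
  have hFE : ∀ i, F i ∈ eSubalgebra K := fun i =>
    mk_mem_eSubalgebra_of_isEFunctionWith (ha i) fun _ => rfl
  have hcoe : ∀ p : Polynomial K, PowerSeries.map φ (p : PowerSeries K) =
      (p.map φ : PowerSeries ℂ) := fun p => by
    ext m
    simp
  have hFsys : ∀ i, (T' : PowerSeries K) * PowerSeries.derivative K (F i) =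
      ∑ j, ((Matrix.of B') i j : PowerSeries K) * F j := fun i => by
    refine PowerSeries.map_injective φ hφ ?_
    have hder : PowerSeries.map φ (PowerSeries.derivative K (F i)) =
        PowerSeries.derivative ℂ (PowerSeries.map φ (F i)) := by
      ext m
      simp [PowerSeries.coeff_derivative]
    rw [map_mul, map_sum, hder, hcoe]
    simp only [map_mul, hcoe, Matrix.of_apply, hB']
    refine ((hasSeries_coe _).mul (hFs i).derivative).unique ?_
    simp only [hsys]
    exact HasSeries.sum fun j _ => (hasSeries_coe _).mul (hFs j)
  have heval : ∀ i, seriesEval φ α (F i) = f i α := fun i => by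
    rw [← (hFs i α).tsum_eq]
    simp [seriesEval]
  have hreg' := mul_ne_zero_iff.1 hreg
  intro k
  have hmain := exists_algebraicIndepOn_iff hFE hFsys ⟨α, hαK⟩
    (fun h => hreg'.1 (congrArg Subtype.val h)) (fun h => hreg'.2 (by
      have := Polynomial.eval_map_apply (p := T') φ ⟨α, hαK⟩
      rw [h, map_zero] at this
      exact this)) k
  have hval : (fun i => seriesEval (algebraMap K ℂ) (algebraMap K ℂ ⟨α, hαK⟩) (F i)) =
      fun i => f i α := funext heval
  rw [hval] at hmain
  have hnum : ∀ S : Finset (Fin n), AlgebraicIndependent Qbar (fun i : S => f (i : Fin n) α) ↔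
      AlgebraicIndepOn K (fun i => f i α) (S : Set (Fin n)) := fun S =>
    (algebraicIndependent_iff_rat isAlgebraic_coe_Qbar).trans
      (algebraicIndependent_iff_rat halg).symm
  have hfun : ∀ S : Finset (Fin n), AlgIndepFuncsOverQbarZ (fun i : S => f (i : Fin n)) ↔
      AlgebraicIndepOn (Polynomial K) F (S : Set (Fin n)) := fun S =>
    ⟨algebraicIndependent_of_algIndepFuncs (fun i => hFs i) halg,
      hfK S trivial _ (fun i => hFs i)⟩
  simp only [hnum, hfun]
  exact hmain
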